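/- arXiv:1910.04217 — 7 statements merged into one kernel-verified Lean document; each statement's English description precedes it below -/
import Mathlib

section
/- In the setting of the nlp-problem with c₂ > σ₃(λ), define ζ₁ as in (1.11) and assume ζ₁ ≤ c₂/(2d₃). Then s_nlp > 2√(d₃r₃(1 − a₃₂)) if and only if ζ₁c₂ − d₃ζ₁² − r₃(1 − a₃₁) < c₂·√(r₃(1 − a₃₂)/d₃) − 2r₃(1 − a₃₂). In that case, setting λ₂ := [c₂ − √((c₂ − 2d₃ζ₁)² + 4d₃r₃(a₃₂ − a₃₁))]/(2d₃), one has s_nlp = d₃λ₂ + r₃(1 − a₃₂)/λ₂, and ρ_nlp(s) = ζ₁s − d₃ζ₁² − r₃(1 − a₃₁) for c₂ < s ≤ c₁, ρ_nlp(s) = λ₂·(s − s_nlp) for s_nlp < s ≤ c₂, and ρ_nlp(s) = 0 for 0 ≤ s ≤ s_nlp. -/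
open Filter Set Topology

noncomputable section

/-- `ρ - φ` attains a strict local minimum at `s₀`. -/
def StrictLocMin (f : ℝ → ℝ) (s₀ : ℝ) : Prop :=
  ∀ᶠ s in 𝓝[≠] s₀, f s₀ < f s

/-- `ρ - φ` attains a strict local maximum at `s₀`. -/
def StrictLocMax (f : ℝ → ℝ) (s₀ : ℝ) : Prop :=
  ∀ᶠ s in 𝓝[≠] s₀, f s < f s₀

/-- `limsup_{s' → s₀} R s'`: the upper semicontinuous envelope of `R` at `s₀`. -/
def uscEnv (R : ℝ → ℝ) (s₀ : ℝ) : ℝ := Filter.limsup R (𝓝 s₀)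

/-- `liminf_{s' → s₀} R s'`: the lower semicontinuous envelope of `R` at `s₀`. -/
def lscEnv (R : ℝ → ℝ) (s₀ : ℝ) : ℝ := Filter.liminf R (𝓝 s₀)

/-- Viscosity super-solution of `min {ρ - s·ρ' + d·(ρ')² + R s, ρ} = 0` on `I`. -/
def IsViscSuper (d : ℝ) (R : ℝ → ℝ) (I : Set ℝ) (ρ : ℝ → ℝ) : Prop :=
  LowerSemicontinuousOn ρ I ∧ (∀ s ∈ I, 0 ≤ ρ s) ∧
    ∀ φ : ℝ → ℝ, ContDiff ℝ 1 φ → ∀ s₀ ∈ I,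
      StrictLocMin (fun s => ρ s - φ s) s₀ →
        0 ≤ ρ s₀ - s₀ * deriv φ s₀ + d * deriv φ s₀ ^ 2 + uscEnv R s₀

/-- Viscosity sub-solution of `min {ρ - s·ρ' + d·(ρ')² + R s, ρ} = 0` on `I`. -/
def IsViscSub (d : ℝ) (R : ℝ → ℝ) (I : Set ℝ) (ρ : ℝ → ℝ) : Prop :=
  UpperSemicontinuousOn ρ I ∧
    ∀ φ : ℝ → ℝ, ContDiff ℝ 1 φ → ∀ s₀ ∈ I,
      StrictLocMax (fun s => ρ s - φ s) s₀ → 0 < ρ s₀ →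
        ρ s₀ - s₀ * deriv φ s₀ + d * deriv φ s₀ ^ 2 + lscEnv R s₀ ≤ 0

/-- Viscosity solution: both a super- and a sub-solution. -/
def IsViscSol (d : ℝ) (R : ℝ → ℝ) (I : Set ℝ) (ρ : ℝ → ℝ) : Prop :=
  IsViscSuper d R I ρ ∧ IsViscSub d R I ρ

/-- A solution of the nlp-problem: continuous viscosity solution on `(0,∞)` of the
variational inequality with `R(s) = r₃(1 - a₃₁·1_{[c₂,c₁]}(s) - a₃₂·1_{(0,c₂]}(s))`,
vanishing at `0` with linear growth rate `lam` at infinity. -/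
def NlpSol (d3 r3 a31 a32 c1 c2 lam : ℝ) (ρ : ℝ → ℝ) : Prop :=
  ContinuousOn ρ (Set.Ici 0) ∧
    IsViscSol d3
      (fun s => r3 * (1 - a31 * (if c2 ≤ s ∧ s ≤ c1 then 1 else 0)
        - a32 * (if 0 < s ∧ s ≤ c2 then 1 else 0))) (Set.Ioi 0) ρ ∧
    ρ 0 = 0 ∧ Filter.Tendsto (fun s => ρ s / s) Filter.atTop (𝓝 lam)

lemma nlp_super_comp {d b : ℝ} {R ρ w : ℝ → ℝ} (hb0 : 0 ≤ b)
    (hs : IsViscSuper d R (Set.Ioi 0) ρ)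
    (hc : ContinuousOn ρ (Set.Icc 0 b)) (hw : ContinuousOn w (Set.Icc 0 b))
    (h0 : w 0 ≤ ρ 0) (hb : w b ≤ ρ b)
    (h : ∀ s0 ∈ Set.Ioo 0 b, ∃ (φ : ℝ → ℝ) (p : ℝ), ContDiff ℝ 1 φ ∧ HasDerivAt φ p s0 ∧
      φ s0 = w s0 ∧ (∀ᶠ s in 𝓝 s0, φ s ≤ w s) ∧
      w s0 - s0 * p + d * p ^ 2 + uscEnv R s0 ≤ 0) :
    ∀ s ∈ Set.Icc 0 b, w s ≤ ρ s := by
  intro s hsI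
  obtain ⟨s0, hs0, hmin⟩ := isCompact_Icc.exists_isMinOn ⟨s, hsI⟩ (hc.sub hw)
  have hmin' : ∀ x ∈ Set.Icc 0 b, ρ s0 - w s0 ≤ ρ x - w x := fun x hx => hmin hx
  by_contra hlt
  push Not at hlt
  have hneg : ρ s0 - w s0 < 0 := by have := hmin' s hsI; linarith
  have hne0 : s0 ≠ 0 := by rintro rfl; linarith
  have hneb : s0 ≠ b := by rintro rfl; linarith
  have hIoo : s0 ∈ Set.Ioo 0 b := ⟨lt_of_le_of_ne hs0.1 hne0.symm, lt_of_le_of_ne hs0.2 hneb⟩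
  obtain ⟨φ, p, hφ, hp, he, hle, hH⟩ := h s0 hIoo
  have hd : HasDerivAt (fun s => φ s - (s - s0) ^ 2) p s0 := by
    have h2 : HasDerivAt (fun s : ℝ => (s - s0) ^ 2) (2 * (s0 - s0)) s0 := by
      have := ((hasDerivAt_id s0).sub_const s0).fun_pow 2
      simpa using this
    have := hp.fun_sub h2
    simpa using this
  have key := hs.2.2 (fun s => φ s - (s - s0) ^ 2) (hφ.sub (by fun_prop)) s0 hIoo.1 (by
    unfold StrictLocMin
    rw [eventually_nhdsWithin_iff]
    filter_upwards [hle, Ioo_mem_nhds hIoo.1 hIoo.2] with x hx hxI hxne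
    have h1 := hmin' x ⟨hxI.1.le, hxI.2.le⟩
    have h3 : 0 < (x - s0) ^ 2 := by
      have : x - s0 ≠ 0 := sub_ne_zero.mpr hxne
      positivity
    simp only [sub_self]
    nlinarith)
  rw [hd.deriv] at key
  linarith

lemma nlp_sub_comp {d a b : ℝ} {R ρ w : ℝ → ℝ} (ha0 : 0 ≤ a)
    (hs : IsViscSub d R (Set.Ioi 0) ρ)
    (hc : ContinuousOn ρ (Set.Icc a b)) (hw : ContinuousOn w (Set.Icc a b))
    (h0 : ρ a ≤ w a) (hb : ρ b ≤ w b) (hnn : ∀ s ∈ Set.Ioo a b, 0 ≤ w s)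
    (h : ∀ s0 ∈ Set.Ioo a b, ∃ (φ : ℝ → ℝ) (p : ℝ), ContDiff ℝ 1 φ ∧ HasDerivAt φ p s0 ∧
      φ s0 = w s0 ∧ (∀ᶠ s in 𝓝 s0, w s ≤ φ s) ∧
      0 ≤ w s0 - s0 * p + d * p ^ 2 + lscEnv R s0) :
    ∀ s ∈ Set.Icc a b, ρ s ≤ w s := by
  intro s hsI
  obtain ⟨s0, hs0, hmin⟩ := isCompact_Icc.exists_isMaxOn ⟨s, hsI⟩ (hc.sub hw)
  have hmin' : ∀ x ∈ Set.Icc a b, ρ x - w x ≤ ρ s0 - w s0 := fun x hx => hmin hx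
  by_contra hlt
  push Not at hlt
  have hneg : 0 < ρ s0 - w s0 := by have := hmin' s hsI; linarith
  have hne0 : s0 ≠ a := by rintro rfl; linarith
  have hneb : s0 ≠ b := by rintro rfl; linarith
  have hIoo : s0 ∈ Set.Ioo a b := ⟨lt_of_le_of_ne hs0.1 hne0.symm, lt_of_le_of_ne hs0.2 hneb⟩
  obtain ⟨φ, p, hφ, hp, he, hle, hH⟩ := h s0 hIoo
  have hd : HasDerivAt (fun s => φ s + (s - s0) ^ 2) p s0 := by
    have h2 : HasDerivAt (fun s : ℝ => (s - s0) ^ 2) (2 * (s0 - s0)) s0 := by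
      have := ((hasDerivAt_id s0).sub_const s0).fun_pow 2
      simpa using this
    have := hp.fun_add h2
    simpa using this
  have key := hs.2 (fun s => φ s + (s - s0) ^ 2) (hφ.add (by fun_prop)) s0
    (lt_of_le_of_lt ha0 hIoo.1) (by
    unfold StrictLocMax
    rw [eventually_nhdsWithin_iff]
    filter_upwards [hle, Ioo_mem_nhds hIoo.1 hIoo.2] with x hx hxI hxne
    have h1 := hmin' x ⟨hxI.1.le, hxI.2.le⟩
    have h3 : 0 < (x - s0) ^ 2 := by
      have : x - s0 ≠ 0 := sub_ne_zero.mpr hxne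
      positivity
    simp only [sub_self]
    nlinarith) (by have := hnn s0 hIoo; linarith)
  rw [hd.deriv] at key
  linarith

lemma nlp_usc_le {R : ℝ → ℝ} {K L s0 : ℝ} (hL : ∀ s, L ≤ R s) (h : ∀ᶠ s in 𝓝 s0, R s ≤ K) :
    uscEnv R s0 ≤ K := by
  unfold uscEnv
  refine Filter.limsup_le_of_le ?_ h
  exact Filter.IsBoundedUnder.isCoboundedUnder_le ⟨L, by simpa using Eventually.of_forall hL⟩

lemma nlp_le_lsc {R : ℝ → ℝ} {K L s0 : ℝ} (hL : ∀ s, R s ≤ L) (h : ∀ᶠ s in 𝓝 s0, K ≤ R s) :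
    K ≤ lscEnv R s0 := by
  unfold lscEnv
  refine Filter.le_liminf_of_le ?_ h
  exact Filter.IsBoundedUnder.isCoboundedUnder_ge ⟨L, by simpa using Eventually.of_forall hL⟩

/-- one-sided upper bound -/
lemma nlp_upper {d a b K L : ℝ} {R ρ l l' : ℝ → ℝ} (ha0 : 0 ≤ a) (hab : a < b)
    (hs : IsViscSub d R (Set.Ioi 0) ρ) (hc : ContinuousOn ρ (Set.Icc a b))
    (hL : ∀ s, R s ≤ L) (hR : ∀ s ∈ Set.Ioo a b, K ≤ R s)
    (hl : ContDiff ℝ 1 l) (hl' : ∀ s, HasDerivAt l (l' s) s)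
    (hnn : ∀ s ∈ Set.Ioo a b, 0 ≤ l s) (hb : ρ b ≤ l b)
    (hH : ∀ s ∈ Set.Ioo a b, ∀ k, 0 ≤ k → 0 ≤ l s - s * (l' s - k) + d * (l' s - k) ^ 2 + K) :
    ∀ s ∈ Set.Icc a b, ρ s ≤ l s := by
  have hba : 0 < b - a := by linarith
  obtain ⟨M, hM0, hM⟩ : ∃ M : ℝ, 0 ≤ M ∧ ρ a ≤ l a + M :=
    ⟨|ρ a - l a|, abs_nonneg _, by have := le_abs_self (ρ a - l a); linarith⟩
  have main : ∀ n : ℕ, ∀ s ∈ Set.Icc a b, ρ s ≤ l s + M * ((b - s) / (b - a)) ^ (n + 1) := by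
    intro n
    have hder : ∀ s0, HasDerivAt (fun s => l s + M * ((b - s) / (b - a)) ^ (n + 1))
        (l' s0 - M * ((n + 1) * ((b - s0) / (b - a)) ^ n * (1 / (b - a)))) s0 := by
      intro s0
      have h1 : HasDerivAt (fun s => (b - s) / (b - a)) (-1 / (b - a)) s0 :=
        ((hasDerivAt_id s0).const_sub b).div_const _
      have h2 := (hl' s0).fun_add ((h1.fun_pow (n + 1)).const_mul M)
      refine h2.congr_deriv ?_
      rw [Nat.add_sub_cancel]
      push_cast
      ring
    have hcd : ContDiff ℝ 1 (fun s => l s + M * ((b - s) / (b - a)) ^ (n + 1)) :=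
      hl.add (by fun_prop)
    apply nlp_sub_comp ha0 hs hc hcd.continuous.continuousOn
    · rw [div_self hba.ne']; simpa using hM
    · simpa using hb
    · intro s hsI
      have : 0 ≤ (b - s) / (b - a) := div_nonneg (by linarith [hsI.2]) hba.le
      have := hnn s hsI
      positivity
    · intro s0 hs0
      have h5 : 0 ≤ (b - s0) / (b - a) := div_nonneg (by linarith [hs0.2]) hba.le
      refine ⟨_, _, hcd, hder s0, rfl, Eventually.of_forall fun _ => le_rfl, ?_⟩
      have h3 := hH s0 hs0 (M * ((n + 1) * ((b - s0) / (b - a)) ^ n * (1 / (b - a))))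
        (by positivity)
      have h4 : K ≤ lscEnv R s0 := nlp_le_lsc hL (by
        filter_upwards [Ioo_mem_nhds hs0.1 hs0.2] with x hx using hR x hx)
      have h6 : 0 ≤ M * ((b - s0) / (b - a)) ^ (n + 1) := by positivity
      linarith
  have hoc : ∀ s ∈ Set.Ioc a b, ρ s ≤ l s := by
    intro s hsI
    have h1 : 0 ≤ (b - s) / (b - a) := div_nonneg (by linarith [hsI.2]) hba.le
    have h2 : (b - s) / (b - a) < 1 := by rw [div_lt_one hba]; linarith [hsI.1]
    have h3 := (((tendsto_pow_atTop_nhds_zero_of_lt_one h1 h2).comp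
      (tendsto_add_atTop_nat 1)).const_mul M).const_add (l s)
    simp only [mul_zero, add_zero] at h3
    exact ge_of_tendsto' h3 (fun n => main n s ⟨hsI.1.le, hsI.2⟩)
  have hcl : closure (Set.Ioc a b) = Set.Icc a b := closure_Ioc hab.ne
  intro s hsI
  rw [← hcl] at hsI
  exact le_on_closure hoc (by rwa [hcl]) (hl.continuous.continuousOn) hsI

/-- line version -/
lemma nlp_upper_line {d a b K L p : ℝ} {R ρ : ℝ → ℝ} (hd : 0 < d) (ha0 : 0 ≤ a) (hab : a < b)
    (hs : IsViscSub d R (Set.Ioi 0) ρ) (hc : ContinuousOn ρ (Set.Icc a b))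
    (hL : ∀ s, R s ≤ L) (hR : ∀ s ∈ Set.Ioo a b, K ≤ R s) (hp0 : 0 ≤ p) (hp : 2 * d * p ≤ a)
    (hnn : 0 ≤ p * a - d * p ^ 2 - K) (hb : ρ b ≤ p * b - d * p ^ 2 - K) :
    ∀ s ∈ Set.Icc a b, ρ s ≤ p * s - d * p ^ 2 - K := by
  refine nlp_upper (l' := fun _ => p) ha0 hab hs hc hL hR (by fun_prop) ?_ ?_ hb ?_
  · intro s
    have := ((hasDerivAt_id s).const_mul p).sub_const (d * p ^ 2) |>.sub_const K
    simpa using this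
  · intro s hsI
    have := mul_le_mul_of_nonneg_left hsI.1.le hp0
    linarith
  · intro s hsI k hk
    have h1 : 0 ≤ k * (s - 2 * d * p) := mul_nonneg hk (by linarith [hsI.1])
    have h2 : 0 ≤ d * k ^ 2 := by positivity
    nlinarith

set_option maxHeartbeats 800000 in
lemma nlp_lower_n {d c1 c2 lam p z V r K1 K2 L : ℝ} {R ρ : ℝ → ℝ} (n : ℕ) (hn1 : 1 ≤ n) (hd : 0 < d)
    (hc2 : 0 < c2) (hc12 : c2 < c1)
    (hs : IsViscSuper d R (Set.Ioi 0) ρ) (hc : ContinuousOn ρ (Set.Ici 0)) (hρ0 : ρ 0 = 0)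
    (hlim : Filter.Tendsto (fun s => ρ s / s) Filter.atTop (𝓝 lam))
    (hL : ∀ s, L ≤ R s) (hRr : ∀ s, R s ≤ r) (hR1 : ∀ s ∈ Set.Ioo c2 c1, R s ≤ K1)
    (hR2 : ∀ s ∈ Set.Ioo 0 c2, R s ≤ K2) (hR12 : ∀ s ∈ Set.Ioo 0 c1, R s ≤ max K1 K2)
    (hK2 : 0 ≤ K2) (hpl : p < lam) (hzp : z ≤ p) (hz : z ≤ c2 / (2 * d))
    (hVp : V - c1 * p + d * p ^ 2 + r ≤ 0) (hVz : V - c1 * z + d * z ^ 2 + K1 ≤ 0)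
    (M : ℝ) (hM : M * (n + 1) = (c2 / (2 * d) - z) * (c1 - c2))
    (hG : V + z * (c2 - c1) - M + K2 ≤ c2 ^ 2 / (4 * d)) :
    (∀ s ∈ Set.Icc c2 c1, V + z * (s - c1) - M ≤ ρ s) ∧
    (∀ s, c1 ≤ s → V + p * (s - c1) ≤ ρ s) := by
  have hcc : 0 < c1 - c2 := by linarith
  have hn : (0 : ℝ) < n + 1 := by positivity
  have he0 : 0 ≤ c2 / (2 * d) - z := by linarith
  have hM0 : 0 ≤ M := by
    have : 0 ≤ M * (n + 1) := by rw [hM]; positivity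
    exact nonneg_of_mul_nonneg_left this hn
  obtain ⟨f, hf⟩ : ∃ f, f = c2 / (2 * d) := ⟨_, rfl⟩
  have hfd : 2 * d * f = c2 := by rw [hf]; field_simp
  have hff : c2 ^ 2 / (4 * d) = d * f ^ 2 := by rw [hf]; field_simp; norm_num
  rw [hff] at hG
  rw [← hf] at hz hM he0
  set g : ℝ → ℝ := fun s => V + z * (s - c1) - M * ((c1 - s) / (c1 - c2)) ^ (n + 1) with hg
  set A : ℝ → ℝ := fun s => (V + z * (c2 - c1) - M) + f * (s - c2) with hA
  set P : ℝ → ℝ := fun s => V + p * (s - c1) with hP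
  set w : ℝ → ℝ := fun s => if s ≤ c2 then A s else if s ≤ c1 then g s else P s with hw
  have hgcd : ContDiff ℝ 1 g := by rw [hg]; fun_prop
  have hAcd : ContDiff ℝ 1 A := by rw [hA]; fun_prop
  have hPcd : ContDiff ℝ 1 P := by rw [hP]; fun_prop
  have hgd : ∀ s0, HasDerivAt g (z + (f - z) * ((c1 - s0) / (c1 - c2)) ^ n) s0 := by
    intro s0
    have h1 : HasDerivAt (fun s => (c1 - s) / (c1 - c2)) (-1 / (c1 - c2)) s0 :=
      ((hasDerivAt_id s0).const_sub c1).div_const _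
    have h2 := (((hasDerivAt_id s0).sub_const c1).const_mul z |>.const_add V).fun_sub
      ((h1.fun_pow (n + 1)).const_mul M)
    refine h2.congr_deriv ?_
    rw [Nat.add_sub_cancel]
    push_cast
    have : f - z = M * (n + 1) / (c1 - c2) := by rw [hM]; field_simp
    rw [this]
    ring
  have hAd : ∀ s0, HasDerivAt A f s0 := by
    intro s0
    have := ((hasDerivAt_id s0).sub_const c2).const_mul f |>.const_add (V + z * (c2 - c1) - M)
    exact this.congr_deriv (mul_one f)
  have hPd : ∀ s0, HasDerivAt P p s0 := by
    intro s0
    have := ((hasDerivAt_id s0).sub_const c1).const_mul p |>.const_add V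
    exact this.congr_deriv (mul_one p)
  have hgc2 : g c2 = V + z * (c2 - c1) - M := by simp [hg, div_self hcc.ne']
  have hAc2 : A c2 = V + z * (c2 - c1) - M := by simp [hA]
  have hgc1 : g c1 = V := by simp [hg]
  have hPc1 : P c1 = V := by simp [hP]
  have hwcont : Continuous w := by
    refine Continuous.if_le hAcd.continuous ?_ continuous_id continuous_const ?_
    · refine Continuous.if_le hgcd.continuous hPcd.continuous continuous_id continuous_const ?_
      rintro x rfl; rw [hgc1, hPc1]
    · rintro x rfl
      rw [if_pos hc12.le, hAc2, hgc2]
  have hwP : ∀ s, c1 ≤ s → w s = P s := by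
    intro s hs1
    rcases eq_or_lt_of_le hs1 with h | h
    · rw [← h]; simp only [hw]; rw [if_neg (by linarith), if_pos le_rfl, hgc1, hPc1]
    · simp only [hw]; rw [if_neg (by linarith), if_neg (by linarith)]
  have hwg : ∀ s, c2 ≤ s → s ≤ c1 → w s = g s := by
    intro s hs1 hs2
    rcases eq_or_lt_of_le hs1 with h | h
    · rw [← h]; simp only [hw]; rw [if_pos le_rfl, hgc2, hAc2]
    · simp only [hw]; rw [if_neg (by linarith), if_pos hs2]
  have hwA : ∀ s, s ≤ c2 → w s = A s := by
    intro s h; simp only [hw]; rw [if_pos h]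
  -- G bound with K1
  have hG1 : V + z * (c2 - c1) - M + K1 ≤ d * f ^ 2 := by
    have h1 : c2 * z = 2 * d * f * z := by rw [hfd]
    have h2 : 0 ≤ d * (f - z) ^ 2 := by positivity
    have h3 : d * (f - z) ^ 2 = d * f ^ 2 - 2 * d * f * z + d * z ^ 2 := by ring
    linarith
  -- behaviour at infinity
  have hev : ∀ᶠ s in Filter.atTop, P s ≤ ρ s := by
    have h1 : ∀ᶠ s in Filter.atTop, (p + lam) / 2 < ρ s / s :=
      hlim.eventually (lt_mem_nhds (by linarith))
    filter_upwards [h1, eventually_gt_atTop 0,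
      eventually_ge_atTop ((V - p * c1) / ((lam - p) / 2))] with s h2 h3 h4
    rw [lt_div_iff₀ h3] at h2
    rw [div_le_iff₀ (by linarith)] at h4
    simp only [hP]
    nlinarith
  have main : ∀ b, c1 < b → P b ≤ ρ b → ∀ s ∈ Set.Icc 0 b, w s ≤ ρ s := by
    intro b hb1 hb2
    refine nlp_super_comp (by linarith) hs (hc.mono Set.Icc_subset_Ici_self)
      hwcont.continuousOn ?_ (by rw [hwP b hb1.le]; exact hb2) ?_
    · rw [hwA 0 hc2.le, hρ0]
      simp only [hA]
      nlinarith [mul_nonneg hd.le (sq_nonneg f)]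
    · intro s0 hs0
      rcases lt_trichotomy s0 c2 with h | h | h
      · refine ⟨A, f, hAcd, hAd s0, (hwA s0 h.le).symm, ?_, ?_⟩
        · filter_upwards [Iio_mem_nhds h] with x hx using (hwA x (le_of_lt hx)).ge
        · have hu : uscEnv R s0 ≤ K2 := nlp_usc_le hL (by
            filter_upwards [Ioo_mem_nhds hs0.1 h] with x hx using hR2 x hx)
          rw [hwA s0 h.le]
          simp only [hA]
          nlinarith
      · subst h
        refine ⟨g, _, hgcd, hgd s0, (hwg s0 le_rfl hc12.le).symm, ?_, ?_⟩
        · filter_upwards [Ioo_mem_nhds hs0.1 hc12] with x hx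
          rcases le_total s0 x with h | h
          · rw [hwg x h hx.2.le]
          · rw [hwA x h]
            have hb := one_add_mul_le_pow (a := (s0 - x) / (c1 - s0))
              (by have : 0 ≤ (s0 - x) / (c1 - s0) := div_nonneg (by linarith) hcc.le
                  linarith) (n + 1)
            have he : 1 + (s0 - x) / (c1 - s0) = (c1 - x) / (c1 - s0) := by
              field_simp; ring
            rw [he] at hb
            have h7 := mul_le_mul_of_nonneg_left hb hM0
            have h8 : M * (1 + ((n + 1 : ℕ) : ℝ) * ((s0 - x) / (c1 - s0)))
              = M + (f - z) * (s0 - x) := by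
              push_cast
              have : M * (1 + ((n : ℝ) + 1) * ((s0 - x) / (c1 - s0)))
                = M + (M * (n + 1)) * ((s0 - x) / (c1 - s0)) := by ring
              rw [this, hM]; field_simp
            rw [h8] at h7
            simp only [hA, hg]
            linarith
        · have hu : uscEnv R s0 ≤ max K1 K2 := nlp_usc_le hL (by
            filter_upwards [Ioo_mem_nhds hs0.1 hc12] with x hx using hR12 x hx)
          rw [hwg s0 le_rfl hc12.le, hgc2, div_self hcc.ne', one_pow]
          have : V + z * (s0 - c1) - M + max K1 K2 ≤ d * f ^ 2 := by
            rcases max_choice K1 K2 with h | h <;> rw [h] <;> assumption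
          nlinarith
      · rcases lt_or_ge s0 c1 with h1 | h1
        · refine ⟨g, _, hgcd, hgd s0, (hwg s0 h.le h1.le).symm, ?_, ?_⟩
          · filter_upwards [Ioo_mem_nhds h h1] with x hx using (hwg x hx.1.le hx.2.le).ge
          · have hu : uscEnv R s0 ≤ K1 := nlp_usc_le hL (by
              filter_upwards [Ioo_mem_nhds h h1] with x hx using hR1 x hx)
            rw [hwg s0 h.le h1.le]
            have hu0 : 0 ≤ (c1 - s0) / (c1 - c2) := div_nonneg (by linarith) hcc.le
            have hu1 : (c1 - s0) / (c1 - c2) ≤ 1 := by rw [div_le_one hcc]; linarith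
            have hv1 : ((c1 - s0) / (c1 - c2)) ^ n ≤ 1 := pow_le_one₀ hu0 hu1
            have hv0 : 0 ≤ ((c1 - s0) / (c1 - c2)) ^ n := by positivity
            have hgle : g s0 ≤ V + z * (s0 - c1) := by
              have : 0 ≤ M * ((c1 - s0) / (c1 - c2)) ^ (n + 1) := by positivity
              simp only [hg]; linarith
            generalize ((c1 - s0) / (c1 - c2)) ^ n = v at hv0 hv1 ⊢
            have hk0 : 0 ≤ (f - z) * v := mul_nonneg he0 hv0
            have hk1 : (f - z) * v ≤ f - z := mul_le_of_le_one_right he0 hv1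
            generalize (f - z) * v = k at hk0 hk1 ⊢
            have h9 : 0 ≤ d * (f - z - k) := mul_nonneg hd.le (by linarith)
            have h11 : 0 ≤ d * (f - z) := mul_nonneg hd.le he0
            have h10 : 0 ≤ k * (s0 - 2 * d * z - d * k) := by
              apply mul_nonneg hk0
              linarith
            have h12 : s0 * (z + k) - d * (z + k) ^ 2 =
              s0 * z - d * z ^ 2 + k * (s0 - 2 * d * z - d * k) := by ring
            linarith
        · have hu : uscEnv R s0 ≤ r := nlp_usc_le hL (Eventually.of_forall hRr)
          have hfin : w s0 - s0 * p + d * p ^ 2 + uscEnv R s0 ≤ 0 := by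
            rw [hwP s0 h1]
            simp only [hP]
            linarith
          rcases eq_or_lt_of_le h1 with h2 | h2
          · refine ⟨fun s => P s - M / (c1 - c2) ^ 2 * (s - s0) ^ 2, p,
              hPcd.sub (by fun_prop), ?_, by simp [hwP s0 h1], ?_, hfin⟩
            · have h3 := (((hasDerivAt_id s0).sub_const s0).fun_pow 2).const_mul
                (M / (c1 - c2) ^ 2)
              refine ((hPd s0).fun_sub h3).congr_deriv ?_
              simp
            · filter_upwards [Ioi_mem_nhds h] with x hx
              rw [← h2]
              have hB : 0 ≤ M / (c1 - c2) ^ 2 * (x - c1) ^ 2 := by positivity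
              rcases le_total c1 x with h2 | h2
              · rw [hwP x h2]; linarith
              · rw [hwg x (le_of_lt hx) h2]
                simp only [hP, hg]
                have hu0 : 0 ≤ (c1 - x) / (c1 - c2) := div_nonneg (by linarith) hcc.le
                have hu1 : (c1 - x) / (c1 - c2) ≤ 1 := by
                  rw [div_le_one hcc]; linarith [show c2 < x from hx]
                have h5 : ((c1 - x) / (c1 - c2)) ^ (n + 1) ≤ ((c1 - x) / (c1 - c2)) ^ 2 :=
                  pow_le_pow_of_le_one hu0 hu1 (by omega)
                have h6 := mul_le_mul_of_nonneg_left h5 hM0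
                have h7 : M * ((c1 - x) / (c1 - c2)) ^ 2
                  = M / (c1 - c2) ^ 2 * (x - c1) ^ 2 := by
                  rw [div_pow]; ring
                have h8 : 0 ≤ (p - z) * (c1 - x) := mul_nonneg (by linarith) (by linarith)
                linarith
          · refine ⟨P, p, hPcd, hPd s0, (hwP s0 h1).symm, ?_, hfin⟩
            filter_upwards [Ioi_mem_nhds h2] with x hx using (hwP x (le_of_lt hx)).ge
  have main2 : ∀ s, 0 ≤ s → w s ≤ ρ s := by
    intro s hs0
    obtain ⟨b, hb1, hb2, hb3⟩ := (hev.and ((eventually_gt_atTop c1).and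
      (eventually_ge_atTop s))).exists
    exact main b hb2 hb1 s ⟨hs0, hb3⟩
  constructor
  · intro s hsI
    have h1 := main2 s (by linarith [hsI.1])
    rw [hwg s hsI.1 hsI.2] at h1
    have hu0 : 0 ≤ (c1 - s) / (c1 - c2) := div_nonneg (by linarith [hsI.2]) hcc.le
    have hu1 : (c1 - s) / (c1 - c2) ≤ 1 := by rw [div_le_one hcc]; linarith [hsI.1]
    have h2 := mul_le_mul_of_nonneg_left (pow_le_one₀ (n := n + 1) hu0 hu1) hM0
    simp only [hg] at h1
    linarith
  · intro s hsI
    have h1 := main2 s (by linarith)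
    rwa [hwP s hsI] at h1

lemma nlp_lower {d c1 c2 lam m ζ V r K1 K2 L : ℝ} {R ρ : ℝ → ℝ} (hd : 0 < d)
    (hc2 : 0 < c2) (hc12 : c2 < c1)
    (hs : IsViscSuper d R (Set.Ioi 0) ρ) (hc : ContinuousOn ρ (Set.Ici 0)) (hρ0 : ρ 0 = 0)
    (hlim : Filter.Tendsto (fun s => ρ s / s) Filter.atTop (𝓝 lam))
    (hL : ∀ s, L ≤ R s) (hRr : ∀ s, R s ≤ r) (hR1 : ∀ s ∈ Set.Ioo c2 c1, R s ≤ K1)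
    (hR2 : ∀ s ∈ Set.Ioo 0 c2, R s ≤ K2) (hR12 : ∀ s ∈ Set.Ioo 0 c1, R s ≤ max K1 K2)
    (hK2 : 0 ≤ K2) (hml : m ≤ lam) (hζ0 : 0 ≤ ζ) (hζm : ζ ≤ m) (hζ : ζ ≤ c2 / (2 * d))
    (hVp : V - c1 * m + d * m ^ 2 + r ≤ 0) (hVz : V - c1 * ζ + d * ζ ^ 2 + K1 ≤ 0)
    (hG : V + ζ * (c2 - c1) + K2 ≤ c2 ^ 2 / (4 * d)) :
    (∀ s ∈ Set.Icc c2 c1, V + ζ * (s - c1) ≤ ρ s) ∧ (∀ s, c1 ≤ s → V ≤ ρ s) := by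
  have key : ∀ k : ℕ, ∀ t : ℝ, t = 1 / (((k + 1 : ℕ) : ℝ) + 1) →
      (∀ s ∈ Set.Icc c2 c1, (V - t * (c1 + d)) + (ζ - t) * (s - c1)
        - (c2 / (2 * d) - (ζ - t)) * (c1 - c2) * t ≤ ρ s) ∧
      (∀ s, c1 ≤ s → (V - t * (c1 + d)) + (m - t) * (s - c1) ≤ ρ s) := by
    intro k t ht
    have hk : (0 : ℝ) < ((k + 1 : ℕ) : ℝ) + 1 := by positivity
    have ht0 : 0 < t := by rw [ht]; positivity
    have ht1 : t ≤ 1 := by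
      rw [ht, div_le_one hk]
      have : (0 : ℝ) ≤ ((k + 1 : ℕ) : ℝ) := by positivity
      linarith
    have hdt : 0 ≤ t * d * (1 - t) := by
      have : 0 ≤ 1 - t := by linarith
      positivity
    have hM0 : 0 ≤ (c2 / (2 * d) - (ζ - t)) * (c1 - c2) * t :=
      mul_nonneg (mul_nonneg (by linarith) (by linarith)) ht0.le
    have h1 : 0 ≤ d * m * t := by
      have : 0 ≤ m := by linarith
      positivity
    have h2 : 0 ≤ d * ζ * t := by positivity
    refine nlp_lower_n (k + 1) (by omega) hd hc2 hc12 hs hc hρ0 hlim hL hRr hR1 hR2 hR12 hK2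
      (p := m - t) (z := ζ - t) (V := V - t * (c1 + d)) (by linarith) (by linarith)
      (by linarith) ?_ ?_ ((c2 / (2 * d) - (ζ - t)) * (c1 - c2) * t) ?_ ?_
    · nlinarith
    · nlinarith
    · rw [mul_assoc]
      have : t * (((k + 1 : ℕ) : ℝ) + 1) = 1 := by rw [ht]; field_simp
      rw [this, mul_one]
    · have h3 : 0 ≤ t * c2 := by positivity
      have h4 : 0 ≤ t * d := by positivity
      nlinarith
  have ht : Filter.Tendsto (fun k : ℕ => 1 / (((k + 1 : ℕ) : ℝ) + 1)) Filter.atTop (𝓝 0) :=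
    (tendsto_one_div_add_atTop_nhds_zero_nat (𝕜 := ℝ)).comp (tendsto_add_atTop_nat 1)
  constructor
  · intro s hsI
    have hcont : Continuous (fun t : ℝ => (V - t * (c1 + d)) + (ζ - t) * (s - c1)
        - (c2 / (2 * d) - (ζ - t)) * (c1 - c2) * t) := by fun_prop
    have h1 := (hcont.tendsto 0).comp ht
    simp only [zero_mul, sub_zero, mul_zero] at h1
    exact le_of_tendsto' h1 (fun k => (key k _ rfl).1 s hsI)
  · intro s hsI
    have hcont : Continuous (fun t : ℝ => (V - t * (c1 + d)) + (m - t) * (s - c1)) := by fun_prop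
    have h1 := (hcont.tendsto 0).comp ht
    simp only [zero_mul, sub_zero] at h1
    have h2 := le_of_tendsto' h1 (fun k => (key k _ rfl).2 s hsI)
    have h3 : 0 ≤ m * (s - c1) := mul_nonneg (by linarith) (by linarith)
    linarith

set_option maxHeartbeats 1000000 in
lemma nlp_alg {d r a1 c1 c2 lam ζ : ℝ} (hd : 0 < d) (hr : 0 < r) (ha1 : 0 ≤ a1) (ha1' : a1 < 1)
    (hc2 : 0 < c2) (hc12 : c2 < c1) (hlam : 0 < lam)
    (hσ : (if lam < Real.sqrt (r / d) then d * lam + r / lam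
      else 2 * Real.sqrt (d * r)) < c2)
    (hζ : ζ = if c1 / (2 * d) ≤ lam then c1 / (2 * d) - Real.sqrt (r * a1 / d)
      else (c1 - Real.sqrt ((c1 - 2 * d * lam) ^ 2 + 4 * d * r * a1)) / (2 * d))
    (hζle : ζ ≤ c2 / (2 * d)) :
    ∃ m, m ≤ lam ∧ 2 * d * m ≤ c1 ∧
      ((lam < c1 / (2 * d) ∧ m = lam) ∨ (c1 / (2 * d) ≤ lam ∧ m = c1 / (2 * d))) ∧
      0 < ζ ∧ ζ ≤ m ∧ ζ * c1 - d * ζ ^ 2 - r * (1 - a1) = m * c1 - d * m ^ 2 - r ∧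
      0 < ζ * c2 - d * ζ ^ 2 - r * (1 - a1) ∧ 4 * d * r < c2 ^ 2 := by
  obtain ⟨e, he⟩ : ∃ e, e = Real.sqrt (r / d) := ⟨_, rfl⟩
  have he0 : 0 < e := by rw [he]; positivity
  have hde : d * e ^ 2 = r := by rw [he, Real.sq_sqrt (by positivity)]; field_simp
  have hsq : Real.sqrt (d * r) = d * e := by
    rw [← hde, show d * (d * e ^ 2) = (d * e) ^ 2 by ring, Real.sqrt_sq (by positivity)]
  rw [hsq, ← he] at hσ
  obtain ⟨f, hf⟩ : ∃ f, f = c2 / (2 * d) := ⟨_, rfl⟩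
  have hfd : c2 = 2 * d * f := by rw [hf]; field_simp
  obtain ⟨F, hF⟩ : ∃ F, F = c1 / (2 * d) := ⟨_, rfl⟩
  have hFd : c1 = 2 * d * F := by rw [hF]; field_simp
  rw [← hf] at hζle
  rw [← hF] at hζ
  rw [← hF]
  have hfF : f < F := by rw [hf, hF]; gcongr
  have hef : e < f ∧ (lam < e → r < lam * c2 - d * lam ^ 2) := by
    split_ifs at hσ with h
    · have h1 : d * lam ^ 2 + r < c2 * lam := by
        have := mul_lt_mul_of_pos_right hσ hlam
        have h2 : (d * lam + r / lam) * lam = d * lam ^ 2 + r := by field_simp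
        linarith
      refine ⟨?_, fun _ => by linarith⟩
      by_contra hcon
      push Not at hcon
      have h3 : c2 * lam ≤ 2 * d * e * lam := by rw [hfd]; gcongr
      have h4 : 0 ≤ d * (lam - e) ^ 2 := by positivity
      nlinarith
    · refine ⟨?_, fun h' => absurd h' h⟩
      have : 2 * d * e < 2 * d * f := by rw [← hfd]; linarith
      exact lt_of_mul_lt_mul_left this (by positivity)
  obtain ⟨hef, hle⟩ := hef
  -- monotonicity
  have mono : ∀ x y c, x ≤ y → y ≤ c → x * (2 * d * c) - d * x ^ 2 ≤ y * (2 * d * c) - d * y ^ 2 := by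
    intro x y c hxy hyc
    have : 0 ≤ d * ((y - x) * (2 * c - x - y)) :=
      mul_nonneg hd.le (mul_nonneg (by linarith) (by linarith))
    nlinarith
  have hx : ∀ x, x = min lam f → r < x * c2 - d * x ^ 2 := by
    intro x hx
    rcases lt_or_ge lam e with h | h
    · rw [hx, min_eq_left (by linarith)]; exact hle h
    · have h1 : e ≤ x := by rw [hx]; exact le_min h hef.le
      have h2 : x ≤ f := by rw [hx]; exact min_le_right _ _
      have h3 := mono e x f h1 h2
      rw [← hfd] at h3
      have h4 : 0 < d * e * (f - e) := mul_pos (by positivity) (by linarith)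
      have h5 : e * c2 - d * e ^ 2 = r + 2 * (d * e * (f - e)) := by rw [hfd, ← hde]; ring
      linarith
  have hquad : ∃ m, m ≤ lam ∧ m ≤ F ∧ ((lam < F ∧ m = lam) ∨ (F ≤ lam ∧ m = F)) ∧
      m = min lam F ∧
      ζ = F - Real.sqrt ((F - m) ^ 2 + r * a1 / d) := by
    rcases lt_or_ge lam F with h | h
    · refine ⟨lam, le_rfl, h.le, Or.inl ⟨h, rfl⟩, (min_eq_left h.le).symm, ?_⟩
      rw [hζ, if_neg (not_le.mpr h)]
      have : (c1 - 2 * d * lam) ^ 2 + 4 * d * r * a1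
        = (2 * d) ^ 2 * ((F - lam) ^ 2 + r * a1 / d) := by
        rw [hFd]; field_simp; ring
      rw [this, Real.sqrt_mul (by positivity), Real.sqrt_sq (by positivity), sub_div, ← hF]
      field_simp
    · refine ⟨F, h, le_rfl, Or.inr ⟨h, rfl⟩, (min_eq_right h).symm, ?_⟩
      rw [hζ, if_pos h]; simp
  obtain ⟨m, hm1, hm2, hm3, hm4, hm5⟩ := hquad
  obtain ⟨S, hS⟩ : ∃ S, S = Real.sqrt ((F - m) ^ 2 + r * a1 / d) := ⟨_, rfl⟩
  have hS0 : 0 ≤ S := by rw [hS]; positivity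
  have hS2 : S ^ 2 = (F - m) ^ 2 + r * a1 / d := by rw [hS, Real.sq_sqrt (by positivity)]
  have hdS : d * S ^ 2 = d * (F - m) ^ 2 + r * a1 := by rw [hS2]; field_simp
  rw [← hS] at hm5
  have hxm : min lam f ≤ m := by rw [hm4]; exact min_le_min le_rfl hfF.le
  have hxx := hx _ rfl
  have hx0 : 0 < min lam f := lt_min hlam (by linarith)
  set x := min lam f with hxdef
  have hζm : ζ ≤ m := by
    rw [hm5]
    have : F - m ≤ S := by
      apply le_of_sq_le_sq _ hS0
      rw [hS2]
      have : 0 ≤ r * a1 / d := by positivity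
      linarith
    linarith
  have hζx : ζ ≤ x := le_min (by linarith) hζle
  have hmx := mono x m F hxm hm2
  rw [← hFd] at hmx
  have hxc : x * c2 ≤ x * c1 := by gcongr
  have heq : ζ * c1 - d * ζ ^ 2 - r * (1 - a1) = m * c1 - d * m ^ 2 - r := by
    rw [hm5, hFd]
    nlinarith
  have hr1 : r * (1 - a1) ≤ r := by nlinarith
  refine ⟨m, hm1, by rw [hFd]; exact mul_le_mul_of_nonneg_left hm2 (by positivity), hm3, ?_, hζm, heq, ?_, ?_⟩
  · by_contra hcon
    push Not at hcon
    have h1 : ζ * c1 ≤ 0 := mul_nonpos_of_nonpos_of_nonneg hcon (by linarith)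
    have h2 : 0 ≤ d * ζ ^ 2 := by positivity
    have h3 : 0 < r * (1 - a1) := mul_pos hr (by linarith)
    linarith
  · have : 0 ≤ (x - ζ) * (c1 - c2) := mul_nonneg (by linarith) (by linarith)
    nlinarith
  · rw [hfd, ← hde]
    have : 0 < d ^ 2 * ((f - e) * (f + e)) :=
      mul_pos (by positivity) (mul_pos (by linarith) (by linarith))
    nlinarith

set_option maxHeartbeats 4000000 in
theorem nlp_profile_small_zeta (d3 r3 a31 a32 c1 c2 lam : ℝ)
    (hd3 : 0 < d3) (hr3 : 0 < r3) (ha31 : 0 ≤ a31) (ha32 : 0 ≤ a32)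
    (hsum : a31 + a32 < 1) (hc2 : 0 < c2) (hc12 : c2 < c1) (hlam : 0 < lam)
    (hσc2 : (if lam < Real.sqrt (r3 / d3) then d3 * lam + r3 / lam
      else 2 * Real.sqrt (d3 * r3)) < c2)
    (ρ : ℝ → ℝ) (hρ : NlpSol d3 r3 a31 a32 c1 c2 lam ρ)
    (snlp : ℝ) (hsnlp : snlp = sSup {s : ℝ | 0 ≤ s ∧ ρ s = 0})
    (ζ1 : ℝ) (hζ1 : ζ1 = if c1 / (2 * d3) ≤ lam then c1 / (2 * d3) - Real.sqrt (r3 * a31 / d3)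
      else (c1 - Real.sqrt ((c1 - 2 * d3 * lam) ^ 2 + 4 * d3 * r3 * a31)) / (2 * d3))
    (hζle : ζ1 ≤ c2 / (2 * d3))
    (lam2 : ℝ)
    (hlam2 : lam2 = (c2 - Real.sqrt ((c2 - 2 * d3 * ζ1) ^ 2
      + 4 * d3 * r3 * (a32 - a31))) / (2 * d3)) :
    (2 * Real.sqrt (d3 * r3 * (1 - a32)) < snlp ↔
      ζ1 * c2 - d3 * ζ1 ^ 2 - r3 * (1 - a31) <
        c2 * Real.sqrt (r3 * (1 - a32) / d3) - 2 * r3 * (1 - a32)) ∧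
    (ζ1 * c2 - d3 * ζ1 ^ 2 - r3 * (1 - a31) <
        c2 * Real.sqrt (r3 * (1 - a32) / d3) - 2 * r3 * (1 - a32) →
      snlp = d3 * lam2 + r3 * (1 - a32) / lam2 ∧
      (∀ s, c2 < s → s ≤ c1 → ρ s = ζ1 * s - d3 * ζ1 ^ 2 - r3 * (1 - a31)) ∧
      (∀ s, snlp < s → s ≤ c2 → ρ s = lam2 * (s - snlp)) ∧
      (∀ s, 0 ≤ s → s ≤ snlp → ρ s = 0)) := by
  obtain ⟨hcont, ⟨hsup, hsub⟩, hρ0, hlim⟩ := hρ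
  set R : ℝ → ℝ := fun s => r3 * (1 - a31 * (if c2 ≤ s ∧ s ≤ c1 then 1 else 0)
        - a32 * (if 0 < s ∧ s ≤ c2 then 1 else 0)) with hR
  have hc1 : 0 < c1 := by linarith
  obtain ⟨m, hm1, hm2, hm3, hζ0, hζm, hVeq, hV2, hc2r⟩ :=
    nlp_alg hd3 hr3 ha31 (by linarith) hc2 hc12 hlam hσc2 hζ1 hζle
  -- bounds for R
  have hRL : ∀ s, r3 * (1 - a31 - a32) ≤ R s := by
    intro s; simp only [hR]
    apply mul_le_mul_of_nonneg_left _ hr3.le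
    split_ifs <;> linarith
  have hRr : ∀ s, R s ≤ r3 := by
    intro s; simp only [hR]
    apply mul_le_of_le_one_right hr3.le
    split_ifs <;> linarith
  have hRc1 : ∀ s, c1 < s → R s = r3 := by
    intro s hs; simp only [hR]
    rw [if_neg (by rintro ⟨_, h⟩; linarith), if_neg (by rintro ⟨_, h⟩; linarith)]; ring
  have hR1 : ∀ s ∈ Set.Ioo c2 c1, R s = r3 * (1 - a31) := by
    intro s hs; simp only [hR]
    rw [if_pos ⟨hs.1.le, hs.2.le⟩, if_neg (by rintro ⟨_, h⟩; linarith [hs.1])]; ring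
  have hR2 : ∀ s ∈ Set.Ioo 0 c2, R s = r3 * (1 - a32) := by
    intro s hs; simp only [hR]
    rw [if_neg (by rintro ⟨h, _⟩; linarith [hs.2]), if_pos ⟨hs.1, hs.2.le⟩]; ring
  have hR12 : ∀ s ∈ Set.Ioo 0 c1, R s ≤ max (r3 * (1 - a31)) (r3 * (1 - a32)) := by
    intro s hs
    rcases lt_trichotomy s c2 with h | h | h
    · rw [hR2 s ⟨hs.1, h⟩]; exact le_max_right _ _
    · refine le_trans ?_ (le_max_left _ _)
      simp only [hR]
      apply mul_le_mul_of_nonneg_left _ hr3.le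
      rw [if_pos ⟨h.ge, hs.2.le⟩]
      split_ifs <;> linarith
    · rw [hR1 s ⟨h, hs.2⟩]; exact le_max_left _ _
  clear_value R
  obtain ⟨q, hq⟩ : ∃ q, q = Real.sqrt (r3 * (1 - a32) / d3) := ⟨_, rfl⟩
  have h1a : 0 < 1 - a32 := by linarith
  have hq0 : 0 < q := by rw [hq]; positivity
  have hdq : r3 * (1 - a32) = d3 * q ^ 2 := by
    rw [hq, Real.sq_sqrt (by positivity)]; field_simp
  have hsq : Real.sqrt (d3 * r3 * (1 - a32)) = d3 * q := by
    rw [mul_assoc, hdq, show d3 * (d3 * q ^ 2) = (d3 * q) ^ 2 by ring,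
      Real.sqrt_sq (by positivity)]
  have hqc : 2 * d3 * q < c2 := by
    apply lt_of_pow_lt_pow_left₀ 2 hc2.le
    have h1 : (2 * d3 * q) ^ 2 = 4 * d3 * (r3 * (1 - a32)) := by rw [hdq]; ring
    have h2 : 4 * d3 * (r3 * (1 - a32)) ≤ 4 * d3 * r3 := by
      have : 0 ≤ 4 * d3 * r3 * a32 := by positivity
      linarith
    linarith
  have hK2 : 0 ≤ r3 * (1 - a32) := by positivity
  rw [hsq, ← hq]
  obtain ⟨V2, hV2e⟩ : ∃ V2, V2 = ζ1 * c2 - d3 * ζ1 ^ 2 - r3 * (1 - a31) := ⟨_, rfl⟩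
  rw [← hV2e] at hV2 ⊢
  have hdisc : (c2 - 2 * d3 * ζ1) ^ 2 + 4 * d3 * r3 * (a32 - a31)
      = c2 ^ 2 - 4 * d3 * (V2 + d3 * q ^ 2) := by rw [← hdq, hV2e]; ring
  rw [hdisc] at hlam2
  -- the set of zeros
  have hlow := fun V => nlp_lower (V := V) hd3 hc2 hc12 hsup hcont hρ0 hlim hRL hRr
    (fun s hs => (hR1 s hs).le) (fun s hs => (hR2 s hs).le) hR12 hK2 hm1 hζ0.le hζm hζle
  -- lower bound on (0, c2)
  have hlow2 : ∀ p, p * c2 - d3 * p ^ 2 - d3 * q ^ 2 ≤ ρ c2 →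
      ∀ s ∈ Set.Icc 0 c2, p * s - d3 * p ^ 2 - d3 * q ^ 2 ≤ ρ s := by
    intro p hp
    have hcd : ContDiff ℝ 1 (fun s : ℝ => p * s - d3 * p ^ 2 - d3 * q ^ 2) := by fun_prop
    refine nlp_super_comp hc2.le hsup (hcont.mono Set.Icc_subset_Ici_self)
      hcd.continuous.continuousOn ?_ hp ?_
    · rw [hρ0]
      have : 0 ≤ d3 * p ^ 2 := by positivity
      have : 0 ≤ d3 * q ^ 2 := by positivity
      linarith
    · intro s0 hs0
      refine ⟨_, p, hcd, ?_, rfl, Eventually.of_forall fun _ => le_rfl, ?_⟩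
      · have := ((hasDerivAt_id s0).const_mul p).sub_const (d3 * p ^ 2) |>.sub_const (d3 * q ^ 2)
        exact this.congr_deriv (mul_one p)
      · have hu : uscEnv R s0 ≤ r3 * (1 - a32) := nlp_usc_le hRL (by
            filter_upwards [Ioo_mem_nhds hs0.1 hs0.2] with x hx using (hR2 x hx).le)
        rw [hdq] at hu
        linarith
  have hc2q : q * c2 - d3 * q ^ 2 ≤ c2 ^ 2 / (4 * d3) := by
    rw [le_div_iff₀ (by positivity)]
    nlinarith [sq_nonneg (c2 - 2 * d3 * q)]
  -- negative case
  have hneg : ¬ (V2 < c2 * q - 2 * r3 * (1 - a32)) → snlp ≤ 2 * (d3 * q) := by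
    intro hcon
    push Not at hcon
    have hcon' : c2 * q - 2 * (d3 * q ^ 2) ≤ V2 := by rw [← hdq]; linarith
    obtain ⟨V, hVd⟩ : ∃ V, V + ζ1 * (c2 - c1) = c2 * q - 2 * (d3 * q ^ 2) :=
      ⟨_, sub_add_cancel _ _⟩
    have hVpos : 0 < c2 * q - 2 * (d3 * q ^ 2) := by
      have : 0 < q * (c2 - 2 * d3 * q) := mul_pos hq0 (by linarith)
      linarith
    obtain ⟨hA, hB⟩ := hlow V (by linarith) (by linarith) (by rw [hdq]; linarith)
    have hAc2 := hA c2 ⟨le_rfl, hc12.le⟩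
    have hC := hlow2 q (by linarith)
    rw [hsnlp]
    refine csSup_le (Set.nonempty_of_mem (x := 0) ⟨le_rfl, hρ0⟩) ?_
    rintro s ⟨hs0, hsz⟩
    by_contra hlt
    push Not at hlt
    have hpos : 0 < ρ s := by
      rcases le_total s c2 with h | h
      · have h1 := hC s ⟨hs0, h⟩
        have : 0 < q * (s - 2 * (d3 * q)) := mul_pos hq0 (by linarith)
        linarith
      · rcases le_total s c1 with h' | h'
        · have h1 := hA s ⟨h, h'⟩
          have : 0 ≤ ζ1 * (s - c2) := mul_nonneg hζ0.le (by linarith)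
          linarith
        · have h1 := hB s h'
          have : 0 ≤ ζ1 * (c1 - c2) := mul_nonneg hζ0.le (by linarith)
          linarith
    linarith
  -- positive case
  have hpos : V2 < c2 * q - 2 * r3 * (1 - a32) →
      2 * (d3 * q) < snlp ∧ snlp = d3 * lam2 + r3 * (1 - a32) / lam2 ∧
      (∀ s, c2 < s → s ≤ c1 → ρ s = ζ1 * s - d3 * ζ1 ^ 2 - r3 * (1 - a31)) ∧
      (∀ s, snlp < s → s ≤ c2 → ρ s = lam2 * (s - snlp)) ∧
      (∀ s, 0 ≤ s → s ≤ snlp → ρ s = 0) := by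
    intro hcond
    have hcond' : V2 < c2 * q - 2 * (d3 * q ^ 2) := by rw [← hdq]; linarith
    obtain ⟨D, hD⟩ : ∃ D, D = Real.sqrt (c2 ^ 2 - 4 * d3 * (V2 + d3 * q ^ 2)) := ⟨_, rfl⟩
    have hDnn : (c2 - 2 * d3 * q) ^ 2 < c2 ^ 2 - 4 * d3 * (V2 + d3 * q ^ 2) := by
      have := mul_lt_mul_of_pos_left hcond' (show 0 < 4 * d3 by positivity)
      nlinarith
    have hD2 : D ^ 2 = c2 ^ 2 - 4 * d3 * (V2 + d3 * q ^ 2) := by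
      rw [hD, Real.sq_sqrt]
      exact le_trans (sq_nonneg _) hDnn.le
    have hD0 : 0 ≤ D := by rw [hD]; positivity
    have hD1 : c2 - 2 * d3 * q < D := by
      apply lt_of_pow_lt_pow_left₀ 2 hD0; rw [hD2]; exact hDnn
    have hDc : D < c2 := by
      apply lt_of_pow_lt_pow_left₀ 2 hc2.le; rw [hD2]
      have : 0 < 4 * d3 * (V2 + d3 * q ^ 2) := by positivity
      linarith
    rw [← hD] at hlam2
    have hDl : D = c2 - 2 * d3 * lam2 := by rw [hlam2]; field_simp; ring
    have hl0 : 0 < lam2 := by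
      rw [hlam2]; exact div_pos (by linarith) (by positivity)
    have hlq : lam2 < q := by
      have : 2 * d3 * lam2 < 2 * d3 * q := by linarith
      exact lt_of_mul_lt_mul_left this (by positivity)
    have hlquad : lam2 * c2 - d3 * lam2 ^ 2 - d3 * q ^ 2 = V2 := by
      rw [hDl] at hD2
      have : 4 * d3 * (lam2 * c2 - d3 * lam2 ^ 2 - d3 * q ^ 2 - V2) = 0 := by nlinarith
      have := (mul_eq_zero.mp this).resolve_left (by positivity)
      linarith
    obtain ⟨S, hS⟩ : ∃ S, S = d3 * lam2 + r3 * (1 - a32) / lam2 := ⟨_, rfl⟩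
    have hlS : lam2 * S = d3 * lam2 ^ 2 + d3 * q ^ 2 := by
      rw [hS, hdq]; field_simp
    have hSq : 2 * (d3 * q) < S := by
      have h1 : 0 < d3 * (q - lam2) ^ 2 := by
        have : 0 < q - lam2 := by linarith
        positivity
      have : lam2 * (2 * (d3 * q)) < lam2 * S := by rw [hlS]; linarith
      exact lt_of_mul_lt_mul_left this hl0.le
    have hSpos : 0 < S := lt_trans (by positivity) hSq
    have hSc2 : S < c2 := by
      have : lam2 * S < lam2 * c2 := by rw [hlS]; linarith
      exact lt_of_mul_lt_mul_left this hl0.le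
    -- lower bounds
    obtain ⟨V, hVd⟩ : ∃ V, V = m * c1 - d3 * m ^ 2 - r3 := ⟨_, rfl⟩
    have hVV2 : V + ζ1 * (c2 - c1) = V2 := by rw [hVd, ← hVeq, hV2e]; ring
    have hVpos : 0 < V := by
      have : 0 ≤ ζ1 * (c1 - c2) := mul_nonneg hζ0.le (by linarith)
      linarith
    obtain ⟨hA, hB⟩ := hlow V (by linarith) (by linarith) (by rw [hdq]; linarith)
    have hAc2 := hA c2 ⟨le_rfl, hc12.le⟩
    have hC := hlow2 lam2 (by linarith)
    -- upper bounds
    have hgrow : ∀ μ, lam < μ → ∀ C, ∀ᶠ s in Filter.atTop, ρ s ≤ μ * s - C := by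
      intro μ hμ C
      have h1 : ∀ᶠ s in Filter.atTop, ρ s / s < (μ + lam) / 2 :=
        hlim.eventually (gt_mem_nhds (by linarith))
      filter_upwards [h1, eventually_gt_atTop 0,
        eventually_ge_atTop (C / ((μ - lam) / 2))] with s h2 h3 h4
      rw [div_lt_iff₀ h3] at h2
      rw [div_le_iff₀ (by linarith)] at h4
      linarith
    have hup1 : ρ c1 ≤ V := by
      rcases hm3 with ⟨h, hm⟩ | ⟨h, hm⟩
      · have hμ : ∀ μ, lam < μ → μ < c1 / (2 * d3) → ρ c1 ≤ μ * c1 - d3 * μ ^ 2 - r3 := by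
          intro μ h1 h2
          rw [lt_div_iff₀ (by positivity)] at h2
          have hnn : 0 ≤ μ * c1 - d3 * μ ^ 2 - r3 := by
            have h3 : 0 ≤ (μ - lam) * (c1 - d3 * μ - d3 * lam) := by
              apply mul_nonneg (by linarith)
              have : d3 * lam ≤ d3 * μ := by gcongr
              linarith
            rw [hm] at hVd
            linarith
          obtain ⟨b, hb1, hb2⟩ := ((hgrow μ h1 (d3 * μ ^ 2 + r3)).and
            (eventually_gt_atTop c1)).exists
          exact nlp_upper_line hd3 hc1.le hb2 hsub
            (hcont.mono (fun x hx => le_trans hc1.le hx.1)) hRr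
            (fun s hs => (hRc1 s hs.1).ge) (by linarith) (by linarith) hnn
            (by linarith) c1 ⟨le_rfl, hb2.le⟩
        have hct : Continuous (fun μ : ℝ => μ * c1 - d3 * μ ^ 2 - r3) := by fun_prop
        have h1 := (hct.tendsto lam).mono_left (nhdsWithin_le_nhds (s := Set.Ioi lam))
        rw [hVd, hm]
        refine ge_of_tendsto h1 ?_
        filter_upwards [Ioo_mem_nhdsGT h] with μ hμ' using hμ μ hμ'.1 hμ'.2
      · obtain ⟨b, hb1, hb2, hb3⟩ := ((hgrow (lam + 1) (by linarith) r3).and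
            ((eventually_gt_atTop c1).and (eventually_ge_atTop (4 * d3 * (lam + 1))))).exists
        have hVe : V = c1 ^ 2 / (4 * d3) - r3 := by
          rw [hVd, hm]; field_simp; ring
        have := nlp_upper (d := d3) (a := c1) (b := b) (K := r3)
          (l := fun s => s ^ 2 / (4 * d3) - r3) (l' := fun s => s / (2 * d3)) hc1.le hb2 hsub
          (hcont.mono (fun x hx => le_trans hc1.le hx.1)) hRr
          (fun s hs => (hRc1 s hs.1).ge) (by fun_prop) ?_ ?_ ?_ ?_ c1 ⟨le_rfl, hb2.le⟩
        · rw [hVe]; exact this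
        · intro s
          have := (((hasDerivAt_id s).fun_pow 2).div_const (4 * d3)).sub_const r3
          refine this.congr_deriv ?_
          simp only [id]
          field_simp
          norm_num
          ring
        · intro s hs
          have h1 : c1 ^ 2 / (4 * d3) ≤ s ^ 2 / (4 * d3) := by
            have := hs.1.le
            gcongr
          linarith
        · have h1 : (lam + 1) * b ≤ b ^ 2 / (4 * d3) := by
            rw [le_div_iff₀ (by positivity)]
            have := mul_le_mul_of_nonneg_right hb3 (show 0 ≤ b by linarith)
            linarith
          linarith
        · intro s hs k hk
          have : s ^ 2 / (4 * d3) - r3 - s * (s / (2 * d3) - k) + d3 * (s / (2 * d3) - k) ^ 2 + r3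
            = d3 * k ^ 2 := by field_simp; ring
          rw [this]; positivity
    have hζ2 : 2 * d3 * ζ1 ≤ c2 := by
      rw [le_div_iff₀ (by positivity)] at hζle; linarith
    have hup2 := nlp_upper_line (p := ζ1) (K := r3 * (1 - a31)) hd3 hc2.le hc12 hsub
      (hcont.mono (fun x hx => le_trans hc2.le hx.1)) hRr
      (fun s hs => (hR1 s hs).ge) hζ0.le hζ2 (by linarith) (by linarith)
    have hup3 := nlp_upper_line (p := lam2) (K := r3 * (1 - a32)) hd3 hSpos.le hSc2 hsub
      (hcont.mono (fun x hx => le_trans hSpos.le hx.1)) hRr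
      (fun s hs => (hR2 s ⟨lt_trans hSpos hs.1, hs.2⟩).ge) hl0.le
      (by have : d3 * lam2 < d3 * q := by gcongr
          linarith) (by rw [hdq]; linarith)
      (by have := hup2 c2 ⟨le_rfl, hc12.le⟩
          rw [hdq]; linarith)
    have hρS : ρ S ≤ 0 := by
      have := hup3 S ⟨le_rfl, hSc2.le⟩
      rw [hdq] at this; linarith
    have hnn : ∀ s, 0 ≤ s → 0 ≤ ρ s := by
      intro s hs
      rcases eq_or_lt_of_le hs with h | h
      · rw [← h, hρ0]
      · exact hsup.2.1 s h
    have hup4 : ∀ s ∈ Set.Icc 0 S, ρ s ≤ 0 := by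
      refine nlp_sub_comp (w := fun _ => 0) le_rfl hsub (hcont.mono Set.Icc_subset_Ici_self)
        continuousOn_const hρ0.le hρS (fun _ _ => le_rfl) ?_
      intro s0 hs0
      refine ⟨fun _ => 0, 0, contDiff_const, hasDerivAt_const _ _, rfl,
        Eventually.of_forall fun _ => le_rfl, ?_⟩
      have h1 : r3 * (1 - a31 - a32) ≤ lscEnv R s0 := nlp_le_lsc hRr (Eventually.of_forall hRL)
      have h2 : 0 < r3 * (1 - a31 - a32) := mul_pos hr3 (by linarith)
      linarith
    have hzero : ∀ s, 0 ≤ s → s ≤ S → ρ s = 0 := fun s h1 h2 =>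
      le_antisymm (hup4 s ⟨h1, h2⟩) (hnn s h1)
    have hSs : snlp = S := by
      rw [hsnlp]
      apply IsGreatest.csSup_eq
      refine ⟨⟨hSpos.le, hzero S hSpos.le le_rfl⟩, ?_⟩
      rintro s ⟨hs0, hsz⟩
      by_contra hlt
      push Not at hlt
      have hpos : 0 < ρ s := by
        rcases le_total s c2 with h | h
        · have h1 := hC s ⟨hs0, h⟩
          have : 0 < lam2 * (s - S) := mul_pos hl0 (by linarith)
          linarith
        · rcases le_total s c1 with h' | h'
          · have h1 := hA s ⟨h, h'⟩
            have : 0 ≤ ζ1 * (s - c2) := mul_nonneg hζ0.le (by linarith)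
            linarith
          · have h1 := hB s h'
            linarith
      linarith
    rw [hSs]
    refine ⟨hSq, hS, ?_, ?_, hzero⟩
    · intro s h1 h2
      have h3 := hA s ⟨h1.le, h2⟩
      have h4 := hup2 s ⟨h1.le, h2⟩
      apply le_antisymm h4
      linarith
    · intro s h1 h2
      have h3 := hC s ⟨by linarith, h2⟩
      have h4 := hup3 s ⟨h1.le, h2⟩
      rw [hdq] at h4
      apply le_antisymm <;> linarith
  refine ⟨⟨fun h => ?_, fun h => (hpos h).1⟩, fun h => (hpos h).2⟩
  by_contra hcon
  linarith [hneg hcon]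
end
end

section
/- In the setting of the nlp-problem with c₂ > σ₃(λ), define ζ₁ as in (1.11) and assume ζ₁ > c₂/(2d₃). Then s_nlp > 2√(d₃r₃(1 − a₃₂)) if and only if c₂²/(4d₃) − r₃(1 − a₃₁) < c₂·√(r₃(1 − a₃₂)/d₃) − 2r₃(1 − a₃₂) (this inequality forces a₃₂ > a₃₁). In that case, setting λ₁ := c₂/(2d₃) − √(r₃(a₃₂ − a₃₁)/d₃), one has s_nlp = d₃λ₁ + r₃(1 − a₃₂)/λ₁, and ρ_nlp(s) = ζ₁s − d₃ζ₁² − r₃(1 − a₃₁) for 2d₃ζ₁ < s ≤ c₁, ρ_nlp(s) = s²/(4d₃) − r₃(1 − a₃₁) for c₂ < s ≤ 2d₃ζ₁, ρ_nlp(s) = λ₁·(s − s_nlp) for s_nlp < s ≤ c₂, and ρ_nlp(s) = 0 for 0 ≤ s ≤ s_nlp. -/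
open Filter Set Topology

noncomputable section

lemma test_super {d : ℝ} {R ρ : ℝ → ℝ} (hS : IsViscSuper d R (Ioi 0) ρ)
    (φ : ℝ → ℝ) (hφ : ContDiff ℝ 1 φ) (s₀ p : ℝ) (hs : 0 < s₀) (hp : HasDerivAt φ p s₀)
    (hm : ∀ᶠ s in 𝓝 s₀, ρ s₀ - φ s₀ ≤ ρ s - φ s) :
    0 ≤ ρ s₀ - s₀ * p + d * p ^ 2 + uscEnv R s₀ := by
  have h1 : HasDerivAt (fun s => φ s - (s - s₀) ^ 2) p s₀ := by
    have := hp.sub (((hasDerivAt_id s₀).sub_const s₀).pow 2)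
    simpa [Pi.add_def, Pi.sub_def, Pi.pow_def] using this
  have := hS.2.2 (fun s => φ s - (s - s₀) ^ 2) (by fun_prop) s₀ hs ?_
  · rwa [h1.deriv] at this
  · have h2 := hm.filter_mono (nhdsWithin_le_nhds (s := {s₀}ᶜ))
    unfold StrictLocMin
    filter_upwards [h2, self_mem_nhdsWithin] with s hs1 hs2
    have : 0 < (s - s₀) ^ 2 := by
      have : s - s₀ ≠ 0 := sub_ne_zero.2 hs2
      positivity
    simp only [sub_self]
    nlinarith

lemma test_sub {d : ℝ} {R ρ : ℝ → ℝ} (hS : IsViscSub d R (Ioi 0) ρ)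
    (φ : ℝ → ℝ) (hφ : ContDiff ℝ 1 φ) (s₀ p : ℝ) (hs : 0 < s₀) (hp : HasDerivAt φ p s₀)
    (hm : ∀ᶠ s in 𝓝 s₀, ρ s - φ s ≤ ρ s₀ - φ s₀) (hpos : 0 < ρ s₀) :
    ρ s₀ - s₀ * p + d * p ^ 2 + lscEnv R s₀ ≤ 0 := by
  have h1 : HasDerivAt (fun s => φ s + (s - s₀) ^ 2) p s₀ := by
    have := hp.add (((hasDerivAt_id s₀).sub_const s₀).pow 2)
    simpa [Pi.add_def, Pi.sub_def, Pi.pow_def] using this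
  have := hS.2 (fun s => φ s + (s - s₀) ^ 2) (by fun_prop) s₀ hs ?_ hpos
  · rwa [h1.deriv] at this
  · have h2 := hm.filter_mono (nhdsWithin_le_nhds (s := {s₀}ᶜ))
    unfold StrictLocMax
    filter_upwards [h2, self_mem_nhdsWithin] with s hs1 hs2
    have : 0 < (s - s₀) ^ 2 := by
      have : s - s₀ ≠ 0 := sub_ne_zero.2 hs2
      positivity
    simp only [sub_self]
    nlinarith

lemma super_line {d : ℝ} {R ρ : ℝ → ℝ} (hc : ContinuousOn ρ (Ici 0))
    (hS : IsViscSuper d R (Ioi 0) ρ) (m e k β : ℝ) (hβ : 0 < β) (h0 : -e ≤ ρ 0)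
    (hb : m * β - e ≤ ρ β) (hR : ∀ s, 0 < s → s < β → uscEnv R s ≤ k)
    (he : d * m ^ 2 + k ≤ e) : ∀ s, 0 ≤ s → s ≤ β → m * s - e ≤ ρ s := by
  have hcg : ContinuousOn (fun s => ρ s - (m * s - e)) (Icc 0 β) := by
    apply ContinuousOn.sub (hc.mono Icc_subset_Ici_self)
    fun_prop
  obtain ⟨x, hx, hmin⟩ := isCompact_Icc.exists_isMinOn (nonempty_Icc.2 hβ.le) hcg
  have hmin' : ∀ s ∈ Icc 0 β, ρ x - (m * x - e) ≤ ρ s - (m * s - e) := fun s hs => hmin hs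
  intro s hs0 hsb
  by_contra hneg
  push Not at hneg
  have hx1 := hmin' s ⟨hs0, hsb⟩
  have hx0 : x ≠ 0 := by rintro rfl; linarith
  have hxb : x ≠ β := by rintro rfl; linarith
  have hxp : 0 < x := lt_of_le_of_ne hx.1 (Ne.symm hx0)
  have hxl : x < β := lt_of_le_of_ne hx.2 hxb
  have hd : HasDerivAt (fun s : ℝ => m * s - e) m x := by
    simpa using ((hasDerivAt_id x).const_mul m).sub_const e
  have := test_super hS (fun s => m * s - e) (by fun_prop) x m hxp hd (by
    filter_upwards [Icc_mem_nhds hxp hxl] with y hy using hmin' y hy)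
  have := hR x hxp hxl
  nlinarith

lemma sub_line {d : ℝ} {R ρ : ℝ → ℝ} (hc : ContinuousOn ρ (Ici 0))
    (hS : IsViscSub d R (Ioi 0) ρ) (hd : 0 < d) (m e k s1 s2 : ℝ) (h1 : 0 < s1) (h12 : s1 < s2)
    (hm : 0 ≤ m) (hms : 2 * d * m ≤ s1) (hl : 0 ≤ m * s1 - e) (h2 : ρ s2 ≤ m * s2 - e)
    (hR : ∀ s, s1 < s → s < s2 → k ≤ lscEnv R s) (he : e ≤ d * m ^ 2 + k) :
    ρ s1 ≤ m * s1 - e := by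
  by_contra hcon
  push Not at hcon
  have hcg : ContinuousOn (fun s => ρ s - (m * s - e)) (Icc s1 s2) := by
    apply ContinuousOn.sub (hc.mono _)
    · fun_prop
    · intro y hy; exact h1.le.trans hy.1
  obtain ⟨t, ht1, ht2, htg⟩ : ∃ t, s1 < t ∧ t < s2 ∧ 0 < ρ t - (m * t - e) := by
    have hw : Tendsto (fun s => ρ s - (m * s - e)) (𝓝[>] s1) (𝓝 (ρ s1 - (m * s1 - e))) := by
      have := (hcg s1 ⟨le_rfl, h12.le⟩).mono Ioo_subset_Icc_self
      rw [ContinuousWithinAt, nhdsWithin_Ioo_eq_nhdsGT h12] at this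
      exact this
    have e1 := hw.eventually (lt_mem_nhds (show (0:ℝ) < _ by linarith))
    obtain ⟨t, ht, ht'⟩ := (e1.and (Ioo_mem_nhdsGT h12)).exists
    exact ⟨t, ht'.1, ht'.2, ht⟩
  set A := (ρ t - (m * t - e)) / 2 with hA
  have hApos : 0 < A := by positivity
  set K := (ρ s1 - (m * s1 - e)) / (A * (t - s1)) with hK
  have hts : 0 < t - s1 := by linarith
  have hKpos : 0 < K := div_pos (by linarith) (by positivity)
  have hKA : A * (K * (t - s1)) = ρ s1 - (m * s1 - e) := by
    rw [hK]; field_simp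
  have hch : ContinuousOn (fun s => ρ s - (m * s - e) - A * Real.exp (K * (t - s))) (Icc s1 s2) :=
    hcg.sub (by fun_prop)
  obtain ⟨x, hx, hmax⟩ := isCompact_Icc.exists_isMaxOn (nonempty_Icc.2 h12.le) hch
  have hmax' : ∀ s ∈ Icc s1 s2, ρ s - (m * s - e) - A * Real.exp (K * (t - s)) ≤
    ρ x - (m * x - e) - A * Real.exp (K * (t - x)) := fun s hs => hmax hs
  have hxt := hmax' t ⟨ht1.le, ht2.le⟩
  simp only [sub_self, mul_zero, Real.exp_zero, mul_one] at hxt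
  have hep : 0 < A * Real.exp (K * (t - x)) := by positivity
  have hx1 : x ≠ s1 := by
    rintro rfl
    have := Real.add_one_le_exp (K * (t - x))
    nlinarith
  have hx2 : x ≠ s2 := by rintro rfl; linarith
  have hxp : s1 < x := lt_of_le_of_ne hx.1 (Ne.symm hx1)
  have hxl : x < s2 := lt_of_le_of_ne hx.2 hx2
  set c := A * (K * Real.exp (K * (t - x))) with hcdef
  have hcpos : 0 < c := by positivity
  have hder : HasDerivAt (fun s : ℝ => (m * s - e) + A * Real.exp (K * (t - s))) (m - c) x := by
    have a1 : HasDerivAt (fun s : ℝ => m * s - e) m x := by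
      simpa using ((hasDerivAt_id x).const_mul m).sub_const e
    have a2 : HasDerivAt (fun s : ℝ => K * (t - s)) (-K) x := by
      simpa using ((hasDerivAt_id x).const_sub t).const_mul K
    have a3 := a1.add (a2.exp.const_mul A)
    rw [show m - c = m + A * (Real.exp (K * (t - x)) * -K) by rw [hcdef]; ring]
    exact a3
  have hpos : 0 < ρ x := by nlinarith
  have := test_sub hS _ (by fun_prop) x (m - c) (h1.trans hxp) hder (by
    filter_upwards [Icc_mem_nhds hxp hxl] with y hy
    have := hmax' y hy
    linarith) hpos
  have := hR x hxp hxl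
  have : 0 ≤ c * (x - 2 * d * m) := mul_nonneg hcpos.le (by linarith)
  have : 0 < d * c ^ 2 := by positivity
  nlinarith

lemma sub_parab {d : ℝ} {R ρ : ℝ → ℝ} (hc : ContinuousOn ρ (Ici 0))
    (hS : IsViscSub d R (Ioi 0) ρ) (hd : 0 < d) (k s0 : ℝ) (hs0 : 0 < s0) (hpos : 0 < ρ s0)
    (hR : ∀ᶠ s in 𝓝 s0, k ≤ lscEnv R s) : ρ s0 ≤ s0 ^ 2 / (4 * d) - k := by
  by_contra hcon
  push Not at hcon
  have hca : ContinuousAt ρ s0 := hc.continuousAt (Ici_mem_nhds hs0)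
  have e1 : ∀ᶠ s in 𝓝 s0, 0 < ρ s := hca.eventually (lt_mem_nhds hpos)
  have e2 : ∀ᶠ s in 𝓝 s0, s ^ 2 / (4 * d) - k < ρ s :=
    ContinuousAt.eventually_lt (by fun_prop) hca hcon
  obtain ⟨ε, hε, hb⟩ := Metric.eventually_nhds_iff_ball.1
    ((e1.and e2).and (hR.and (lt_mem_nhds hs0)))
  set δ := ε / 2 with hδ
  have hδp : 0 < δ := by positivity
  have hin : ∀ s ∈ Icc (s0 - δ) (s0 + δ), s ∈ Metric.ball s0 ε := by
    intro s hs
    rw [Real.ball_eq_Ioo]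
    constructor <;> linarith [hs.1, hs.2]
  set K := (|ρ (s0 - δ)| + |ρ (s0 + δ)|) / δ ^ 2 with hK
  have hKd : K * δ ^ 2 = |ρ (s0 - δ)| + |ρ (s0 + δ)| := by rw [hK]; field_simp
  have hch : ContinuousOn (fun s => ρ s - K * (s - s0) ^ 2) (Icc (s0 - δ) (s0 + δ)) := by
    apply ContinuousOn.sub (hc.mono _)
    · fun_prop
    · intro y hy; exact (hb y (hin y hy)).2.2.le
  obtain ⟨x, hx, hmax⟩ := isCompact_Icc.exists_isMaxOn (nonempty_Icc.2 (by linarith)) hch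
  have hmax' : ∀ s ∈ Icc (s0 - δ) (s0 + δ), ρ s - K * (s - s0) ^ 2 ≤
    ρ x - K * (x - s0) ^ 2 := fun s hs => hmax hs
  have hx0 := hmax' s0 ⟨by linarith, by linarith⟩
  have hx1 : x ≠ s0 - δ := by
    intro h
    rw [h] at hx0
    have := le_abs_self (ρ (s0 - δ))
    have := abs_nonneg (ρ (s0 + δ))
    nlinarith
  have hx2 : x ≠ s0 + δ := by
    intro h
    rw [h] at hx0
    have := le_abs_self (ρ (s0 + δ))
    have := abs_nonneg (ρ (s0 - δ))
    nlinarith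
  have hxp : s0 - δ < x := lt_of_le_of_ne hx.1 (Ne.symm hx1)
  have hxl : x < s0 + δ := lt_of_le_of_ne hx.2 hx2
  obtain ⟨⟨b1, b2⟩, b3, b4⟩ := hb x (hin x hx)
  have hder : HasDerivAt (fun s : ℝ => K * (s - s0) ^ 2) (K * (2 * (x - s0))) x := by
    have := (((hasDerivAt_id x).sub_const s0).pow 2).const_mul K
    simpa using this
  have := test_sub hS _ (by fun_prop) x _ b4 hder (by
    filter_upwards [Icc_mem_nhds hxp hxl] with y hy using hmax' y hy) b1
  generalize K * (2 * (x - s0)) = p at this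
  have h5 : x ^ 2 / (4 * d) - x * p + d * p ^ 2 = d * (p - x / (2 * d)) ^ 2 := by
    field_simp; ring
  have h6 : 0 ≤ d * (p - x / (2 * d)) ^ 2 := by positivity
  linarith

lemma usc_le {R : ℝ → ℝ} {s k B : ℝ} (hB : ∀ x, B ≤ R x) (h : ∀ᶠ x in 𝓝 s, R x ≤ k) :
    uscEnv R s ≤ k := by
  apply Filter.limsup_le_of_le _ h
  exact Filter.IsBoundedUnder.isCoboundedUnder_le (Filter.isBoundedUnder_of ⟨B, hB⟩)

lemma le_lsc {R : ℝ → ℝ} {s k B : ℝ} (hB : ∀ x, R x ≤ B) (h : ∀ᶠ x in 𝓝 s, k ≤ R x) :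
    k ≤ lscEnv R s := by
  apply Filter.le_liminf_of_le _ h
  exact Filter.IsBoundedUnder.isCoboundedUnder_ge (Filter.isBoundedUnder_of ⟨B, hB⟩)

lemma lower_inf {d r lam : ℝ} {R ρ : ℝ → ℝ} (hd : 0 < d) (hr : 0 < r)
    (hc : ContinuousOn ρ (Ici 0))
    (hS : IsViscSuper d R (Ioi 0) ρ) (h0 : ρ 0 = 0)
    (hl : Tendsto (fun s => ρ s / s) atTop (𝓝 lam)) (hU : ∀ s, 0 < s → uscEnv R s ≤ r)
    (m s : ℝ) (hm : m ≤ lam) (hs : 0 ≤ s) : m * s - (d * m ^ 2 + r) ≤ ρ s := by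
  have key : ∀ m < lam, m * s - (d * m ^ 2 + r) ≤ ρ s := by
    intro m hm
    have he : 0 ≤ d * m ^ 2 + r := by positivity
    obtain ⟨β, hb1, hb2⟩ := ((hl.eventually (lt_mem_nhds hm)).and
      (eventually_gt_atTop s)).exists
    have hb : 0 < β := hs.trans_lt hb2
    rw [lt_div_iff₀ hb] at hb1
    exact super_line hc hS m _ r β hb (by linarith) (by linarith)
      (fun x hx _ => hU x hx) le_rfl s hs hb2.le
  rcases hm.lt_or_eq with h | rfl
  · exact key m h
  · have ht : Tendsto (fun x => x * s - (d * x ^ 2 + r)) (𝓝[<] m)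
        (𝓝 (m * s - (d * m ^ 2 + r))) := by
      apply Tendsto.mono_left _ nhdsWithin_le_nhds
      apply Continuous.tendsto
      fun_prop
    refine le_of_tendsto ht ?_
    filter_upwards [self_mem_nhdsWithin] with x hx using key x hx

lemma val_c1 {d r a c1 lam m0 : ℝ} {R ρ : ℝ → ℝ} (hd : 0 < d) (hr : 0 < r) (ha : 0 ≤ a)
    (hc1 : 0 < c1)
    (hc : ContinuousOn ρ (Ici 0))
    (hS : IsViscSuper d R (Ioi 0) ρ) (hS2 : IsViscSub d R (Ioi 0) ρ) (h0 : ρ 0 = 0)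
    (hl : Tendsto (fun s => ρ s / s) atTop (𝓝 lam)) (hU : ∀ s, 0 < s → uscEnv R s ≤ r)
    (hL : ∀ s, c1 < s → r ≤ lscEnv R s) (hm0 : 0 < m0) (hml : m0 ≤ lam)
    (hm1 : d * m0 ^ 2 + r < m0 * c1)
    (ζ1 : ℝ) (hζ1 : ζ1 = if c1 / (2 * d) ≤ lam then c1 / (2 * d) - Real.sqrt (r * a / d)
      else (c1 - Real.sqrt ((c1 - 2 * d * lam) ^ 2 + 4 * d * r * a)) / (2 * d)) :
    2 * d * ζ1 ≤ c1 ∧ ρ c1 = ζ1 * c1 - d * ζ1 ^ 2 - r * (1 - a) := by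
  have hpos : 0 < ρ c1 := by
    have := lower_inf hd hr hc hS h0 hl hU m0 c1 hml hc1.le
    linarith
  split_ifs at hζ1 with h
  · set q := Real.sqrt (r * a / d) with hq
    have hq0 : 0 ≤ q := Real.sqrt_nonneg _
    have hq2 : d * q ^ 2 = r * a := by
      rw [hq, Real.sq_sqrt (by positivity)]; field_simp
    have e1 : 2 * d * ζ1 = c1 - 2 * d * q := by rw [hζ1]; field_simp
    refine ⟨by rw [e1]; nlinarith, ?_⟩
    have e2 : ζ1 * c1 - d * ζ1 ^ 2 - r * (1 - a) = c1 ^ 2 / (4 * d) - r := by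
      have : ζ1 * c1 - d * ζ1 ^ 2 = c1 ^ 2 / (4 * d) - d * q ^ 2 := by
        rw [hζ1]; field_simp; ring
      rw [this]; linarith
    rw [e2]
    apply le_antisymm
    · have hca : ContinuousAt ρ c1 := hc.continuousAt (Ici_mem_nhds hc1)
      have e1 : ∀ᶠ s in 𝓝 c1, 0 < ρ s := hca.eventually (lt_mem_nhds hpos)
      have hct : Tendsto (fun s => s ^ 2 / (4 * d) - r) (𝓝[>] c1) (𝓝 (c1 ^ 2 / (4 * d) - r)) := by
        apply Tendsto.mono_left _ nhdsWithin_le_nhds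
        apply Continuous.tendsto
        fun_prop
      refine le_of_tendsto_of_tendsto (hca.tendsto.mono_left nhdsWithin_le_nhds) hct ?_
      filter_upwards [e1.filter_mono nhdsWithin_le_nhds, self_mem_nhdsWithin] with s hs1 hs2
      have hs2' : c1 < s := hs2
      refine sub_parab hc hS2 hd r s (hc1.trans hs2') hs1 ?_
      filter_upwards [lt_mem_nhds hs2'] with y hy using hL y hy
    · have := lower_inf hd hr hc hS h0 hl hU _ c1 h hc1.le
      have e3 : c1 / (2 * d) * c1 - (d * (c1 / (2 * d)) ^ 2 + r) = c1 ^ 2 / (4 * d) - r := by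
        field_simp; ring
      linarith
  · push Not at h
    set q := Real.sqrt ((c1 - 2 * d * lam) ^ 2 + 4 * d * r * a) with hq
    have hq0 : 0 ≤ q := Real.sqrt_nonneg _
    have hq2 : q ^ 2 = (c1 - 2 * d * lam) ^ 2 + 4 * d * r * a := Real.sq_sqrt (by positivity)
    have e1 : 2 * d * ζ1 = c1 - q := by rw [hζ1]; field_simp
    refine ⟨by rw [e1]; linarith, ?_⟩
    have e2 : ζ1 * c1 - d * ζ1 ^ 2 - r * (1 - a) = lam * c1 - (d * lam ^ 2 + r) := by
      have : 4 * d * (ζ1 * c1 - d * ζ1 ^ 2 - r * (1 - a)) =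
          4 * d * (lam * c1 - (d * lam ^ 2 + r)) := by
        linear_combination (2 * c1 - 2 * d * ζ1 - (c1 - q)) * e1 - hq2
      exact mul_left_cancel₀ (by positivity) this
    rw [e2]
    apply le_antisymm
    · have ht : Tendsto (fun x => x * c1 - (d * x ^ 2 + r)) (𝓝[>] lam)
          (𝓝 (lam * c1 - (d * lam ^ 2 + r))) := by
        apply Tendsto.mono_left _ nhdsWithin_le_nhds
        apply Continuous.tendsto
        fun_prop
      refine ge_of_tendsto ht ?_
      filter_upwards [Ioo_mem_nhdsGT h] with μ hμ
      obtain ⟨hμ1, hμ2⟩ := hμ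
      rw [lt_div_iff₀ (by positivity)] at hμ2
      set ν := (lam + μ) / 2 with hν
      have hν1 : lam < ν := by linarith
      have hν2 : ν < μ := by linarith
      obtain ⟨S, ⟨hS1, hSc⟩, hSe⟩ := (((hl.eventually (gt_mem_nhds hν1)).and
        (eventually_gt_atTop c1)).and
        (eventually_gt_atTop ((d * μ ^ 2 + r) / (μ - ν)))).exists
      rw [div_lt_iff₀ (hc1.trans hSc)] at hS1
      rw [div_lt_iff₀ (by linarith)] at hSe
      refine sub_line hc hS2 hd μ _ r c1 S hc1 hSc (by linarith) (by linarith) ?_ (by nlinarith)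
        (fun s hs _ => hL s hs) le_rfl
      have : 0 ≤ (μ - m0) * (c1 - d * (μ + m0)) :=
        mul_nonneg (by linarith) (by nlinarith)
      nlinarith
    · exact lower_inf hd hr hc hS h0 hl hU _ c1 le_rfl hc1.le

lemma env_facts (r a b c1 c2 : ℝ) (hr : 0 < r) (ha : 0 ≤ a) (hb : 0 ≤ b) (hc12 : c2 < c1)
    (hc2 : 0 < c2)
    (R : ℝ → ℝ) (hR : R = fun s => r * (1 - a * (if c2 ≤ s ∧ s ≤ c1 then 1 else 0)
        - b * (if 0 < s ∧ s ≤ c2 then 1 else 0))) :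
    (∀ s, 0 < s → uscEnv R s ≤ r) ∧
    (∀ s, 0 < s → s < c1 → uscEnv R s ≤ max (r * (1 - a)) (r * (1 - b))) ∧
    (∀ s, 0 < s → s < c2 → uscEnv R s ≤ r * (1 - b)) ∧
    (∀ s, c1 < s → r ≤ lscEnv R s) ∧
    (∀ s, c2 < s → s < c1 → r * (1 - a) ≤ lscEnv R s) ∧
    (∀ s, 0 < s → s < c2 → r * (1 - b) ≤ lscEnv R s) := by
  have hra : 0 ≤ r * a := by positivity
  have hrb : 0 ≤ r * b := by positivity
  have hB1 : ∀ x, r * (1 - a - b) ≤ R x := by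
    intro x; rw [hR]; dsimp only; split_ifs <;> nlinarith
  have hB2 : ∀ x, R x ≤ r := by
    intro x; rw [hR]; dsimp only; split_ifs <;> nlinarith
  have hA : ∀ x, 0 < x → x < c2 → R x = r * (1 - b) := by
    intro x h1 h2
    rw [hR]; dsimp only
    rw [if_neg (by intro h; linarith [h.1]), if_pos ⟨h1, h2.le⟩]; ring
  have hM : ∀ x, c2 < x → x < c1 → R x = r * (1 - a) := by
    intro x h1 h2
    rw [hR]; dsimp only
    rw [if_pos ⟨h1.le, h2.le⟩, if_neg (by intro h; linarith [h.2])]; ring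
  have hE : ∀ x, c1 < x → R x = r := by
    intro x h1
    rw [hR]; dsimp only
    rw [if_neg (by intro h; linarith [h.2]), if_neg (by intro h; linarith [h.2])]; ring
  have hC : R c2 ≤ r * (1 - a) := by
    rw [hR]; dsimp only
    rw [if_pos ⟨le_rfl, hc12.le⟩, if_pos ⟨hc2, le_rfl⟩]; nlinarith
  refine ⟨fun s _ => usc_le hB1 (Eventually.of_forall hB2), fun s h1 h2 => usc_le hB1 ?_,
    fun s h1 h2 => usc_le hB1 ?_, fun s h1 => le_lsc hB2 ?_, fun s h1 h2 => le_lsc hB2 ?_,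
    fun s h1 h2 => le_lsc hB2 ?_⟩
  · filter_upwards [Ioo_mem_nhds h1 h2] with x hx
    rcases lt_trichotomy x c2 with h | h | h
    · rw [hA x hx.1 h]; exact le_max_right _ _
    · rw [h]; exact hC.trans (le_max_left _ _)
    · rw [hM x h hx.2]; exact le_max_left _ _
  · filter_upwards [Ioo_mem_nhds h1 h2] with x hx using (hA x hx.1 hx.2).le
  · filter_upwards [lt_mem_nhds h1] with x hx using (hE x hx).ge
  · filter_upwards [Ioo_mem_nhds h1 h2] with x hx using (hM x hx.1 hx.2).ge
  · filter_upwards [Ioo_mem_nhds h1 h2] with x hx using (hA x hx.1 hx.2).ge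

set_option maxHeartbeats 4000000 in
theorem nlp_profile_large_zeta (d3 r3 a31 a32 c1 c2 lam : ℝ)
    (hd3 : 0 < d3) (hr3 : 0 < r3) (ha31 : 0 ≤ a31) (ha32 : 0 ≤ a32)
    (hsum : a31 + a32 < 1) (hc2 : 0 < c2) (hc12 : c2 < c1) (hlam : 0 < lam)
    (hσc2 : (if lam < Real.sqrt (r3 / d3) then d3 * lam + r3 / lam
      else 2 * Real.sqrt (d3 * r3)) < c2)
    (ρ : ℝ → ℝ) (hρ : NlpSol d3 r3 a31 a32 c1 c2 lam ρ)
    (snlp : ℝ) (hsnlp : snlp = sSup {s : ℝ | 0 ≤ s ∧ ρ s = 0})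
    (ζ1 : ℝ) (hζ1 : ζ1 = if c1 / (2 * d3) ≤ lam then c1 / (2 * d3) - Real.sqrt (r3 * a31 / d3)
      else (c1 - Real.sqrt ((c1 - 2 * d3 * lam) ^ 2 + 4 * d3 * r3 * a31)) / (2 * d3))
    (hζgt : c2 / (2 * d3) < ζ1)
    (lam1 : ℝ)
    (hlam1 : lam1 = c2 / (2 * d3) - Real.sqrt (r3 * (a32 - a31) / d3)) :
    (2 * Real.sqrt (d3 * r3 * (1 - a32)) < snlp ↔
      c2 ^ 2 / (4 * d3) - r3 * (1 - a31) <
        c2 * Real.sqrt (r3 * (1 - a32) / d3) - 2 * r3 * (1 - a32)) ∧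
    (c2 ^ 2 / (4 * d3) - r3 * (1 - a31) <
        c2 * Real.sqrt (r3 * (1 - a32) / d3) - 2 * r3 * (1 - a32) →
      a31 < a32 ∧
      snlp = d3 * lam1 + r3 * (1 - a32) / lam1 ∧
      (∀ s, 2 * d3 * ζ1 < s → s ≤ c1 → ρ s = ζ1 * s - d3 * ζ1 ^ 2 - r3 * (1 - a31)) ∧
      (∀ s, c2 < s → s ≤ 2 * d3 * ζ1 → ρ s = s ^ 2 / (4 * d3) - r3 * (1 - a31)) ∧
      (∀ s, snlp < s → s ≤ c2 → ρ s = lam1 * (s - snlp)) ∧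
      (∀ s, 0 ≤ s → s ≤ snlp → ρ s = 0)) := by
  obtain ⟨hc, ⟨hSup, hSub⟩, h0, hl⟩ := hρ
  set R : ℝ → ℝ := (fun s => r3 * (1 - a31 * (if c2 ≤ s ∧ s ≤ c1 then 1 else 0)
        - a32 * (if 0 < s ∧ s ≤ c2 then 1 else 0))) with hRdef
  obtain ⟨hU0, hU1, hU2, hL0, hL1, hL2⟩ := env_facts r3 a31 a32 c1 c2 hr3 ha31 ha32 hc12 hc2 R hRdef
  have hc1 : 0 < c1 := hc2.trans hc12
  have hnn : ∀ s, 0 ≤ s → 0 ≤ ρ s := by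
    intro s hs
    rcases hs.eq_or_lt with h | h
    · rw [← h, h0]
    · exact hSup.2.1 s h
  -- a slope witnessing positivity beyond c2
  obtain ⟨m0, hm0, hm0l, hm0c⟩ : ∃ m0, 0 < m0 ∧ m0 ≤ lam ∧ d3 * m0 ^ 2 + r3 < m0 * c2 := by
    split_ifs at hσc2 with h
    · refine ⟨lam, hlam, le_rfl, ?_⟩
      have := mul_lt_mul_of_pos_left hσc2 hlam
      have e : lam * (d3 * lam + r3 / lam) = d3 * lam ^ 2 + r3 := by field_simp
      linarith
    · push Not at h
      have hp : 0 < Real.sqrt (r3 / d3) := Real.sqrt_pos.2 (by positivity)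
      refine ⟨Real.sqrt (r3 / d3), hp, h, ?_⟩
      have h2 : d3 * Real.sqrt (r3 / d3) ^ 2 = r3 := by
        rw [Real.sq_sqrt (by positivity)]; field_simp
      have h3 : Real.sqrt (d3 * r3) = d3 * Real.sqrt (r3 / d3) := by
        rw [Real.sqrt_eq_iff_mul_self_eq (by positivity) (by positivity)]
        linear_combination -d3 * h2
      rw [h3] at hσc2
      have := mul_lt_mul_of_pos_left hσc2 hp
      first | linarith | nlinarith
  have h4 : 4 * d3 * r3 < c2 ^ 2 := by
    have h5 : (d3 * m0 ^ 2 + r3) ^ 2 < (m0 * c2) ^ 2 := by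
      apply pow_lt_pow_left₀ hm0c (by positivity) (by norm_num)
    have h6 : m0 ^ 2 * (4 * d3 * r3) < m0 ^ 2 * c2 ^ 2 := by
      nlinarith [sq_nonneg (d3 * m0 ^ 2 - r3)]
    exact lt_of_mul_lt_mul_left h6 (by positivity)
  have hpos : ∀ s, c2 ≤ s → 0 < ρ s := by
    intro s hs
    have := lower_inf hd3 hr3 hc hSup h0 hl hU0 m0 s hm0l (hc2.le.trans hs)
    have := mul_le_mul_of_nonneg_left hs hm0.le
    linarith
  obtain ⟨hζc, hv1⟩ := val_c1 hd3 hr3 ha31 hc1 hc hSup hSub h0 hl hU0 hL0 hm0 hm0l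
    (by linarith [mul_lt_mul_of_pos_left hc12 hm0]) ζ1 hζ1
  have hζ2 : c2 < 2 * d3 * ζ1 := by
    rw [div_lt_iff₀ (by positivity)] at hζgt; linarith
  have hb1 : 0 < 1 - a32 := by linarith
  have hrb : 0 < r3 * (1 - a32) := by positivity
  set q := Real.sqrt (r3 * (1 - a32) / d3) with hq
  have hqp : 0 < q := Real.sqrt_pos.2 (by positivity)
  have hq2 : d3 * q ^ 2 = r3 * (1 - a32) := by
    rw [hq, Real.sq_sqrt (by positivity)]; field_simp
  have hq3 : Real.sqrt (d3 * r3 * (1 - a32)) = d3 * q := by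
    rw [Real.sqrt_eq_iff_mul_self_eq (by positivity) (by positivity)]
    linear_combination -d3 * hq2
  have hqc : 2 * d3 * q < c2 := by
    apply lt_of_pow_lt_pow_left₀ 2 hc2.le
    have e : (2 * d3 * q) ^ 2 = 4 * d3 * (r3 * (1 - a32)) := by rw [← hq2]; ring
    have : d3 * r3 * a32 ≥ 0 := by positivity
    rw [e]; first | linarith | nlinarith
  have hra : 0 ≤ r3 * a31 := by positivity
  have hrb' : 0 ≤ r3 * a32 := by positivity
  have hr1a : 0 < r3 * (1 - a31) := mul_pos hr3 (by linarith)
  -- lower bounds by lines of slope at most ζ1 with rate r(1-a31), when a31 ≤ a32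
  have low1 : a31 ≤ a32 → ∀ m s, 0 ≤ m → m ≤ ζ1 → 0 ≤ s → s ≤ c1 →
      m * s - (d3 * m ^ 2 + r3 * (1 - a31)) ≤ ρ s := by
    intro hab m s hm hmz hs hsc
    refine super_line hc hSup m _ (r3 * (1 - a31)) c1 hc1 ?_ ?_ ?_ le_rfl s hs hsc
    · rw [h0]; have : 0 ≤ d3 * m ^ 2 := by positivity
      linarith
    · rw [hv1]
      have : 0 ≤ (ζ1 - m) * (c1 - d3 * (ζ1 + m)) :=
        mul_nonneg (by linarith) (by linarith [mul_le_mul_of_nonneg_left hmz hd3.le])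
      linarith
    · intro x hx1 hx2
      refine (hU1 x hx1 hx2).trans (max_le le_rfl ?_)
      exact mul_le_mul_of_nonneg_left (by linarith) hr3.le
  have lowc2 : a31 ≤ a32 → c2 ^ 2 / (4 * d3) - r3 * (1 - a31) ≤ ρ c2 := by
    intro hab
    have := low1 hab (c2 / (2 * d3)) c2 (by positivity) hζgt.le hc2.le hc12.le
    have e : c2 / (2 * d3) * c2 - (d3 * (c2 / (2 * d3)) ^ 2 + r3 * (1 - a31))
      = c2 ^ 2 / (4 * d3) - r3 * (1 - a31) := by field_simp; ring
    linarith
  have hne : (0:ℝ) ∈ {s : ℝ | 0 ≤ s ∧ ρ s = 0} := ⟨le_rfl, h0⟩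
  -- negation of the condition
  have neg : ¬ (c2 ^ 2 / (4 * d3) - r3 * (1 - a31) < c2 * q - 2 * r3 * (1 - a32)) →
      snlp ≤ 2 * (d3 * q) := by
    intro hn
    push Not at hn
    rw [hsnlp]
    refine csSup_le ⟨0, hne⟩ ?_
    rintro s ⟨hs0, hs⟩
    by_contra hlt
    push Not at hlt
    have hsc2 : s < c2 := by
      by_contra h
      push Not at h
      exact (hpos s h).ne' hs
    have hqs : q * s - (d3 * q ^ 2 + r3 * (1 - a32)) ≤ ρ s := by
      rcases le_total a31 a32 with hab | hab
      · refine super_line hc hSup q _ (r3 * (1 - a32)) c2 hc2 ?_ ?_ hU2 le_rfl s hs0 hsc2.le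
        · rw [h0, hq2]; linarith
        · have := lowc2 hab
          rw [hq2]; linarith
      · refine super_line hc hSup q _ (r3 * (1 - a32)) c1 hc1 ?_ ?_ ?_ le_rfl s hs0
          (hsc2.trans hc12).le
        · rw [h0, hq2]; linarith
        · rw [hv1]
          have hzq : q < ζ1 := by
            have : 2 * d3 * q < 2 * d3 * ζ1 := by linarith
            exact lt_of_mul_lt_mul_left this (by positivity)
          have : 0 ≤ (ζ1 - q) * (c1 - d3 * (ζ1 + q)) :=
            mul_nonneg (by linarith) (by linarith [mul_le_mul_of_nonneg_left hzq.le hd3.le])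
          linarith [mul_le_mul_of_nonneg_left hab hr3.le]
        · intro x hx1 hx2
          refine (hU1 x hx1 hx2).trans (max_le ?_ le_rfl)
          exact mul_le_mul_of_nonneg_left (by linarith) hr3.le
    rw [hs, ← hq2] at hqs
    linarith [mul_lt_mul_of_pos_left hlt hqp]
  -- the profile under the condition
  have main : c2 ^ 2 / (4 * d3) - r3 * (1 - a31) < c2 * q - 2 * r3 * (1 - a32) →
      2 * (d3 * q) < snlp ∧ a31 < a32 ∧
      snlp = d3 * lam1 + r3 * (1 - a32) / lam1 ∧
      (∀ s, 2 * d3 * ζ1 < s → s ≤ c1 → ρ s = ζ1 * s - d3 * ζ1 ^ 2 - r3 * (1 - a31)) ∧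
      (∀ s, c2 < s → s ≤ 2 * d3 * ζ1 → ρ s = s ^ 2 / (4 * d3) - r3 * (1 - a31)) ∧
      (∀ s, snlp < s → s ≤ c2 → ρ s = lam1 * (s - snlp)) ∧
      (∀ s, 0 ≤ s → s ≤ snlp → ρ s = 0) := by
    intro hcond
    have hsq : d3 * (c2 / (2 * d3) - q) ^ 2 < r3 * (a32 - a31) := by
      have e : d3 * (c2 / (2 * d3) - q) ^ 2 = c2 ^ 2 / (4 * d3) - c2 * q + d3 * q ^ 2 := by
        field_simp; ring
      rw [e, hq2]; first | linarith | nlinarith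
    have hab : a31 < a32 := by
      have : 0 ≤ d3 * (c2 / (2 * d3) - q) ^ 2 := by positivity
      have : 0 < a32 - a31 := pos_of_mul_pos_right (this.trans_lt hsq) hr3.le
      linarith
    have hab' : 0 ≤ r3 * (a32 - a31) / d3 := div_nonneg (mul_nonneg hr3.le (by linarith)) hd3.le
    set w := Real.sqrt (r3 * (a32 - a31) / d3) with hw
    have hw0 : 0 ≤ w := Real.sqrt_nonneg _
    have hw2 : d3 * w ^ 2 = r3 * (a32 - a31) := by
      rw [hw, Real.sq_sqrt hab']; field_simp
    have hl1 : 2 * d3 * lam1 = c2 - 2 * d3 * w := by rw [hlam1]; field_simp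
    have hlpos : 0 < lam1 := by
      have : 2 * d3 * w < c2 := by
        apply lt_of_pow_lt_pow_left₀ 2 hc2.le
        have e : (2 * d3 * w) ^ 2 = 4 * d3 * (r3 * (a32 - a31)) := by rw [← hw2]; ring
        have h1 : r3 * (a32 - a31) < r3 := by linarith
        have := mul_lt_mul_of_pos_left h1 (show 0 < 4 * d3 by positivity)
        rw [e]; linarith
      have h1 : 0 < 2 * d3 * lam1 := by linarith
      exact pos_of_mul_pos_right h1 (by positivity)
    have hlq : lam1 < q := by
      have h1 : (c2 / (2 * d3) - q) ^ 2 < w ^ 2 := by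
        apply lt_of_mul_lt_mul_left _ hd3.le
        rw [hw2]; exact hsq
      have h2 : c2 / (2 * d3) - q < w := lt_of_pow_lt_pow_left₀ 2 hw0 h1
      linarith
    set S := d3 * lam1 + r3 * (1 - a32) / lam1 with hSdef
    have hlS : lam1 * S = d3 * lam1 ^ 2 + r3 * (1 - a32) := by
      rw [hSdef]; field_simp
    have hSq : 2 * (d3 * q) < S := by
      have : lam1 * (2 * (d3 * q)) < lam1 * S := by
        rw [hlS, ← hq2]
        have : 0 < d3 * (q - lam1) ^ 2 := mul_pos hd3 (pow_pos (by linarith) 2)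
        first | linarith | nlinarith
      exact lt_of_mul_lt_mul_left this hlpos.le
    have hS2 : 2 * d3 * lam1 ≤ S := by
      have := mul_lt_mul_of_pos_left hlq hd3
      linarith
    have hS0 : 0 < S := by
      have : 0 < d3 * q := by positivity
      linarith
    -- value at c2 of the line of slope lam1
    have hlc2 : lam1 * c2 - lam1 * S = c2 ^ 2 / (4 * d3) - r3 * (1 - a31) := by
      rw [hlS]
      have e : lam1 * c2 - d3 * lam1 ^ 2 = c2 ^ 2 / (4 * d3) - d3 * w ^ 2 := by
        rw [hlam1]; field_simp; ring
      linarith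
    -- parabola formula
    have par : ∀ s, c2 < s → s < c1 → ρ s ≤ s ^ 2 / (4 * d3) - r3 * (1 - a31) := by
      intro s h1 h2
      refine sub_parab hc hSub hd3 _ s (hc2.trans h1) (hpos s h1.le) ?_
      filter_upwards [Ioo_mem_nhds h1 h2] with y hy using hL1 y hy.1 hy.2
    have hvc2 : ρ c2 = c2 ^ 2 / (4 * d3) - r3 * (1 - a31) := by
      refine le_antisymm ?_ (lowc2 hab.le)
      have hca : ContinuousAt ρ c2 := hc.continuousAt (Ici_mem_nhds hc2)
      have hct : Tendsto (fun s => s ^ 2 / (4 * d3) - r3 * (1 - a31)) (𝓝[>] c2)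
          (𝓝 (c2 ^ 2 / (4 * d3) - r3 * (1 - a31))) := by
        apply Tendsto.mono_left _ nhdsWithin_le_nhds
        apply Continuous.tendsto
        fun_prop
      refine le_of_tendsto_of_tendsto (hca.tendsto.mono_left nhdsWithin_le_nhds) hct ?_
      filter_upwards [Ioo_mem_nhdsGT hc12] with s hs using par s hs.1 hs.2
    have hSc2 : S < c2 := by
      have h1 : 0 < ρ c2 := hpos c2 le_rfl
      have : lam1 * S < lam1 * c2 := by linarith
      exact lt_of_mul_lt_mul_left this hlpos.le
    have f3 : ∀ s, S ≤ s → s ≤ c2 → ρ s = lam1 * (s - S) := by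
      intro s h1 h2
      rw [mul_sub]
      apply le_antisymm
      · rcases h2.eq_or_lt with h | h
        · rw [h, hvc2, hlc2]
        · refine sub_line hc hSub hd3 lam1 _ (r3 * (1 - a32)) s c2 (hS0.trans_le h1) h hlpos.le
            (hS2.trans h1) ?_ ?_ ?_ hlS.le
          · have := mul_le_mul_of_nonneg_left h1 hlpos.le
            linarith
          · rw [hvc2, hlc2]
          · intro x hx1 hx2
            exact hL2 x (by linarith) hx2
      · refine super_line hc hSup lam1 _ (r3 * (1 - a32)) c2 hc2 ?_ ?_ hU2 hlS.ge s
          (hS0.le.trans h1) h2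
        · rw [h0, hlS]
          have : 0 ≤ d3 * lam1 ^ 2 := by positivity
          linarith
        · rw [hvc2, hlc2]
    have hρS : ρ S = 0 := by rw [f3 S le_rfl hSc2.le]; ring
    have f4 : ∀ s, 0 ≤ s → s ≤ S → ρ s = 0 := by
      intro s h1 h2
      rcases h1.eq_or_lt with h | h
      · rw [← h, h0]
      rcases h2.eq_or_lt with h' | h'
      · rw [h', hρS]
      refine le_antisymm ?_ (hnn s h1)
      have := sub_line hc hSub hd3 0 0 (r3 * (1 - a32)) s S h h' le_rfl (by linarith) (by simp)
        (by rw [hρS]; simp) (fun x hx1 hx2 => hL2 x (by linarith) (by linarith)) (by simpa using hrb.le)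
      simpa using this
    have hsn : snlp = S := by
      rw [hsnlp]
      apply IsGreatest.csSup_eq
      refine ⟨⟨hS0.le, hρS⟩, ?_⟩
      rintro s ⟨hs0, hs⟩
      by_contra hlt
      push Not at hlt
      rcases le_total s c2 with h | h
      · rw [f3 s hlt.le h] at hs
        have : 0 < lam1 * (s - S) := mul_pos hlpos (by linarith)
        linarith
      · exact (hpos s h).ne' hs
    have hζp : 0 < ζ1 := lt_trans (by positivity) hζgt
    rw [hsn]
    refine ⟨hSq, hab, rfl, ?_, ?_, fun s h1 h2 => f3 s h1.le h2, f4⟩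
    · intro s h1 h2
      have hs0 : 0 < s := by linarith
      have hlow := low1 hab.le ζ1 s hζp.le le_rfl hs0.le h2
      apply le_antisymm _ (by linarith)
      rcases h2.eq_or_lt with h | h
      · rw [h, hv1]
      have := sub_line hc hSub hd3 ζ1 (d3 * ζ1 ^ 2 + r3 * (1 - a31)) (r3 * (1 - a31)) s c1 hs0 h
        hζp.le h1.le ?_ (by rw [hv1]; linarith) (fun x hx1 hx2 => hL1 x (by linarith) hx2) le_rfl
      · linarith
      · have h7 : c2 ^ 2 < (2 * d3 * ζ1) ^ 2 := pow_lt_pow_left₀ hζ2 hc2.le (by norm_num)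
        have h8 : (4 * d3) * r3 < (4 * d3) * (d3 * ζ1 ^ 2) := by linarith
        have h9 : r3 < d3 * ζ1 ^ 2 := lt_of_mul_lt_mul_left h8 (by positivity)
        have := mul_le_mul_of_nonneg_left h1.le hζp.le
        first | linarith | nlinarith
    · intro s h1 h2
      have hs0 : 0 < s := by linarith
      have hlow := low1 hab.le (s / (2 * d3)) s (by positivity)
        (by rw [div_le_iff₀ (by positivity)]; linarith) hs0.le (by linarith)
      have e : s / (2 * d3) * s - (d3 * (s / (2 * d3)) ^ 2 + r3 * (1 - a31))
        = s ^ 2 / (4 * d3) - r3 * (1 - a31) := by field_simp; ring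
      apply le_antisymm _ (by linarith)
      rcases lt_or_ge s c1 with h | h
      · exact par s h1 h
      · have hs1 : s = c1 := by linarith
        have hs2 : 2 * d3 * ζ1 = c1 := by linarith
        have e2 : ζ1 = c1 / (2 * d3) := by field_simp; linarith
        rw [hs1, hv1, e2]
        apply le_of_eq
        field_simp; ring
  rw [hq3]
  refine ⟨⟨fun h => ?_, fun h => (main h).1⟩, fun h => (main h).2⟩
  by_contra hn
  linarith [neg hn]
end
end

section
/- In the setting of the nlp-problem with c₂ > σ₃(λ), define ζ₁ as in (1.11), and further set ζ₂ := c₂/(2d₃) + √(r₃(a₃₁ − a₃₂)/d₃) (used only when a₃₁ ≥ a₃₂), λ_nlp1 := c₂/(2d₃) − √(r₃(a₃₂ − a₃₁)/d₃) (used only when a₃₁ < a₃₂), and λ_nlp2 := [c₂ − √((c₂ − 2d₃ζ₁)² + 4d₃r₃(a₃₂ − a₃₁))]/(2d₃). Then: s_nlp = d₃λ_nlp1 + r₃(1 − a₃₂)/λ_nlp1 if ζ₁ > c₂/(2d₃), a₃₁ < a₃₂, and λ_nlp1 ≤ √(r₃(1 − a₃₂)/d₃); s_nlp = d₃λ_nlp2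 + r₃(1 − a₃₂)/λ_nlp2 if ζ₁ ≤ c₂/(2d₃), λ_nlp2 ≤ √(r₃(1 − a₃₂)/d₃), and either (i) a₃₁ < a₃₂, or (ii) a₃₁ ≥ a₃₂ and ζ₁ + ζ₂ < c₂/d₃; and s_nlp = 2√(d₃r₃(1 − a₃₂)) in all other cases. -/
open Filter Set Topology

noncomputable section

/-- The growth rate. -/
def Rf (r a1 a2 c1 c2 : ℝ) : ℝ → ℝ :=
  fun s => r * (1 - a1 * (if c2 ≤ s ∧ s ≤ c1 then 1 else 0)
        - a2 * (if 0 < s ∧ s ≤ c2 then 1 else 0))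

lemma Rf_le (r a1 a2 c1 c2 : ℝ) (hr : 0 < r) (h1 : 0 ≤ a1) (h2 : 0 ≤ a2) (s : ℝ) :
    Rf r a1 a2 c1 c2 s ≤ r := by
  unfold Rf
  split_ifs <;> nlinarith [mul_nonneg hr.le h1, mul_nonneg hr.le h2]

lemma le_Rf (r a1 a2 c1 c2 : ℝ) (hr : 0 < r) (h1 : 0 ≤ a1) (h2 : 0 ≤ a2) (s : ℝ) :
    r * (1 - a1 - a2) ≤ Rf r a1 a2 c1 c2 s := by
  unfold Rf
  split_ifs <;> nlinarith [mul_nonneg hr.le h1, mul_nonneg hr.le h2]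

/-- usable supersolution property -/
def SupP (d : ℝ) (R ρ : ℝ → ℝ) : Prop :=
  ∀ (φ : ℝ → ℝ) (p s₀ Rb : ℝ), 0 < s₀ → ContDiff ℝ 1 φ → HasDerivAt φ p s₀ →
    (∀ᶠ s in 𝓝 s₀, ρ s₀ - φ s₀ ≤ ρ s - φ s) → (∀ᶠ s in 𝓝 s₀, R s ≤ Rb) →
    s₀ * p - d * p ^ 2 - Rb ≤ ρ s₀

/-- usable subsolution property -/
def SubP (d : ℝ) (R ρ : ℝ → ℝ) : Prop :=
  ∀ (φ : ℝ → ℝ) (p s₀ Rb : ℝ), 0 < s₀ → 0 < ρ s₀ → ContDiff ℝ 1 φ → HasDerivAt φ p s₀ →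
    (∀ᶠ s in 𝓝 s₀, ρ s - φ s ≤ ρ s₀ - φ s₀) → (∀ᶠ s in 𝓝 s₀, Rb ≤ R s) →
    ρ s₀ ≤ s₀ * p - d * p ^ 2 - Rb

lemma supP_of (d : ℝ) (R ρ : ℝ → ℝ) (m : ℝ) (hm : ∀ s, m ≤ R s)
    (h : IsViscSuper d R (Set.Ioi 0) ρ) : SupP d R ρ := by
  intro φ p s₀ Rb hs hφ hp hmin hR
  have hd : HasDerivAt (fun s => φ s - (s - s₀) ^ 2) p s₀ := by
    have h2 : HasDerivAt (fun s : ℝ => (s - s₀) ^ 2) (2 * (s₀ - s₀) ^ 1 * 1) s₀ := by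
      exact (((hasDerivAt_id s₀).sub_const s₀).fun_pow 2).congr_deriv (by simp)
    exact (hp.fun_sub h2).congr_deriv (by simp)
  have := h.2.2 (fun s => φ s - (s - s₀) ^ 2) (by fun_prop) s₀ hs (by
    unfold StrictLocMin
    filter_upwards [hmin.filter_mono nhdsWithin_le_nhds, self_mem_nhdsWithin] with s h1 h2
    have : 0 < (s - s₀) ^ 2 := by
      have : s - s₀ ≠ 0 := sub_ne_zero.mpr h2
      positivity
    simp only [sub_self]
    nlinarith)
  rw [hd.deriv] at this
  have h3 : uscEnv R s₀ ≤ Rb := by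
    unfold uscEnv
    refine Filter.limsup_le_of_le ?_ hR
    refine Filter.IsBoundedUnder.isCoboundedUnder_le ?_
    exact Filter.isBoundedUnder_of ⟨m, fun s => hm s⟩
  linarith

lemma subP_of (d : ℝ) (R ρ : ℝ → ℝ) (m : ℝ) (hm : ∀ s, R s ≤ m)
    (h : IsViscSub d R (Set.Ioi 0) ρ) : SubP d R ρ := by
  intro φ p s₀ Rb hs hpos hφ hp hmin hR
  have hd : HasDerivAt (fun s => φ s + (s - s₀) ^ 2) p s₀ := by
    have h2 : HasDerivAt (fun s : ℝ => (s - s₀) ^ 2) (2 * (s₀ - s₀) ^ 1 * 1) s₀ := by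
      exact (((hasDerivAt_id s₀).sub_const s₀).fun_pow 2).congr_deriv (by simp)
    exact (hp.fun_add h2).congr_deriv (by simp)
  have := h.2 (fun s => φ s + (s - s₀) ^ 2) (by fun_prop) s₀ hs (by
    unfold StrictLocMax
    filter_upwards [hmin.filter_mono nhdsWithin_le_nhds, self_mem_nhdsWithin] with s h1 h2
    have : 0 < (s - s₀) ^ 2 := by
      have : s - s₀ ≠ 0 := sub_ne_zero.mpr h2
      positivity
    simp only [sub_self]
    nlinarith) hpos
  rw [hd.deriv] at this
  have h3 : Rb ≤ lscEnv R s₀ := by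
    unfold lscEnv
    refine Filter.le_liminf_of_le ?_ hR
    refine Filter.IsBoundedUnder.isCoboundedUnder_ge ?_
    exact Filter.isBoundedUnder_of ⟨m, fun s => hm s⟩
  linarith

/-- lower comparison with a line -/
lemma lower_line (d : ℝ) (R ρ : ℝ → ℝ) (hsup : SupP d R ρ)
    (hc : ContinuousOn ρ (Set.Ici 0)) (b p Rb : ℝ) (hd : 0 < d) (hb : 0 < b)
    (hR : ∀ s, 0 < s → s < b → ∀ᶠ t in 𝓝 s, R t ≤ Rb) (hRb : 0 ≤ Rb) (h0 : ρ 0 = 0)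
    (hρb : p * b - d * p ^ 2 - Rb ≤ ρ b) (x : ℝ) (hx0 : 0 ≤ x) (hxb : x ≤ b) :
    p * x - d * p ^ 2 - Rb ≤ ρ x := by
  by_contra hcon
  push Not at hcon
  have hc' : ContinuousOn (fun s => ρ s - p * s) (Set.Icc 0 b) :=
    (hc.mono Set.Icc_subset_Ici_self).sub (by fun_prop)
  obtain ⟨s₀, hs₀, hmin⟩ := isCompact_Icc.exists_isMinOn ⟨x, hx0, hxb⟩ hc'
  have hx := hmin (show x ∈ Set.Icc 0 b from ⟨hx0, hxb⟩)
  simp only [Set.mem_ofPred_eq] at hx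
  have hne0 : s₀ ≠ 0 := by
    rintro rfl
    nlinarith [sq_nonneg p]
  have hneb : s₀ ≠ b := by
    rintro rfl
    nlinarith [sq_nonneg p]
  have hs1 : 0 < s₀ := lt_of_le_of_ne hs₀.1 hne0.symm
  have hs2 : s₀ < b := lt_of_le_of_ne hs₀.2 hneb
  have := hsup (fun s => p * s) p s₀ Rb hs1 (by fun_prop)
    (by simpa using (hasDerivAt_id s₀).const_mul p) (by
      filter_upwards [Icc_mem_nhds hs1 hs2] with s hs
      exact hmin hs) (hR s₀ hs1 hs2)
  nlinarith

/-- upper bound by the envelope -/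
lemma upper_env (d : ℝ) (R ρ : ℝ → ℝ) (hsub : SubP d R ρ)
    (hc : ContinuousOn ρ (Set.Ici 0)) (hd : 0 < d) (a b Rb : ℝ) (ha : 0 ≤ a)
    (hR : ∀ s, a < s → s < b → ∀ᶠ t in 𝓝 s, Rb ≤ R t) (x : ℝ) (hxa : a < x) (hxb : x < b)
    (hpos : 0 < ρ x) : ρ x ≤ x ^ 2 / (4 * d) - Rb := by
  have key : ∀ e, 0 < e → a < x - e → x + e < b → ρ x ≤ (x + e) ^ 2 / (4 * d) - Rb := by
    intro e he hae hbe
    have hsubI : Set.Icc (x - e) (x + e) ⊆ Set.Ici 0 := fun s hs => by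
      simp only [Set.mem_Ici]; linarith [hs.1]
    obtain ⟨M, hM⟩ := isCompact_Icc.bddAbove_image (hc.mono hsubI)
    have hM' : ∀ s ∈ Set.Icc (x - e) (x + e), ρ s ≤ M := fun s hs => hM ⟨s, hs, rfl⟩
    set K := (|M| + 1) / e ^ 2 with hK
    have hKe : K * e ^ 2 = |M| + 1 := by rw [hK]; field_simp
    have hK0 : 0 < K := by positivity
    obtain ⟨s₀, hs₀, hmax⟩ := isCompact_Icc.exists_isMaxOn
      (f := fun s => ρ s - K * (s - x) ^ 2)
      (show (Set.Icc (x - e) (x + e)).Nonempty from ⟨x, by linarith, by linarith⟩)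
      ((hc.mono hsubI).sub (by fun_prop))
    have hx := hmax (show x ∈ Set.Icc (x - e) (x + e) from ⟨by linarith, by linarith⟩)
    simp only [Set.mem_ofPred_eq, sub_self] at hx
    have hMs := hM' s₀ hs₀
    have habs := le_abs_self M
    have h1 : x - e < s₀ := by
      refine lt_of_le_of_ne hs₀.1 ?_
      rintro rfl
      nlinarith
    have h2 : s₀ < x + e := by
      refine lt_of_le_of_ne hs₀.2 ?_
      rintro rfl
      nlinarith
    have hρ0 : ρ x ≤ ρ s₀ := by nlinarith [mul_nonneg hK0.le (sq_nonneg (s₀ - x))]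
    have := hsub (fun s => K * (s - x) ^ 2) (K * (2 * (s₀ - x))) s₀ Rb (by linarith)
      (by linarith) (by fun_prop)
      (by simpa using (((hasDerivAt_id s₀).sub_const x).pow 2).const_mul K)
      (by
        filter_upwards [Icc_mem_nhds h1 h2] with s hs
        exact hmax hs) (hR s₀ (by linarith) (by linarith))
    set p := K * (2 * (s₀ - x))
    have h3 : s₀ * p - d * p ^ 2 ≤ s₀ ^ 2 / (4 * d) := by
      rw [le_div_iff₀ (by positivity)]
      nlinarith [sq_nonneg (s₀ - 2 * d * p)]
    have h4 : s₀ ^ 2 / (4 * d) ≤ (x + e) ^ 2 / (4 * d) := by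
      have : 0 ≤ s₀ := by linarith
      gcongr
    linarith
  have ht : Tendsto (fun e : ℝ => (x + e) ^ 2 / (4 * d) - Rb) (𝓝[>] 0)
      (𝓝 (x ^ 2 / (4 * d) - Rb)) := by
    have : Continuous (fun e : ℝ => (x + e) ^ 2 / (4 * d) - Rb) := by fun_prop
    have h := this.tendsto 0
    simp only [add_zero] at h
    exact h.mono_left nhdsWithin_le_nhds
  refine ge_of_tendsto ht ?_
  have h1 : Set.Iio (min (x - a) (b - x)) ∈ 𝓝 (0 : ℝ) :=
    Iio_mem_nhds (lt_min (by linarith) (by linarith))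
  filter_upwards [self_mem_nhdsWithin, mem_nhdsWithin_of_mem_nhds h1] with e he he2
  have := lt_min_iff.mp (Set.mem_Iio.mp he2)
  exact key e he (by linarith [this.1]) (by linarith [this.2])

/-- upper comparison with a line -/
lemma upper_line (d : ℝ) (R ρ : ℝ → ℝ) (hsub : SubP d R ρ)
    (hc : ContinuousOn ρ (Set.Ici 0)) (hd : 0 < d) (a b p Rb : ℝ) (ha : 0 ≤ a)
    (hap : 2 * d * p ≤ a)
    (hR : ∀ s, a < s → s < b → ∀ᶠ t in 𝓝 s, Rb ≤ R t)
    (hρb : ρ b ≤ p * b - d * p ^ 2 - Rb) (x : ℝ) (hxa : a < x) (hxb : x < b)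
    (hpos : ∀ s, x ≤ s → s < b → p * s - d * p ^ 2 - Rb < ρ s → 0 < ρ s) :
    ρ x ≤ p * x - d * p ^ 2 - Rb := by
  by_contra hcon
  push Not at hcon
  set D := (ρ x - (p * x - d * p ^ 2 - Rb)) / 2 with hD
  have hD0 : 0 < D := by rw [hD]; linarith
  have hxpos := hpos x le_rfl hxb hcon
  have hcx : ContinuousAt ρ x := hc.continuousAt (Ici_mem_nhds (by linarith))
  obtain ⟨e, he, hball⟩ := Metric.eventually_nhds_iff.mp (hcx.eventually (lt_mem_nhds hxpos))
  obtain ⟨x1, hx1a, hx1b⟩ := exists_between (max_lt hxa (show x - e < x by linarith))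
  have hax1 := (max_lt_iff.mp hx1a).1
  have hex1 := (max_lt_iff.mp hx1a).2
  have hposI : ∀ s, x1 ≤ s → s ≤ x → 0 < ρ s := by
    intro s h1 h2
    apply hball
    rw [Real.dist_eq, abs_lt]
    constructor <;> linarith
  obtain ⟨K, hK0, hK⟩ : ∃ K : ℝ, 0 < K ∧
      ρ x1 - (p * x1 - d * p ^ 2 - Rb) < D * (1 + K * (x - x1)) := by
    refine ⟨(|ρ x1 - (p * x1 - d * p ^ 2 - Rb)| + 1) / (D * (x - x1)), ?_, ?_⟩
    · have : 0 < x - x1 := by linarith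
      positivity
    · have h1 : 0 < x - x1 := by linarith
      have h2 := le_abs_self (ρ x1 - (p * x1 - d * p ^ 2 - Rb))
      generalize |ρ x1 - (p * x1 - d * p ^ 2 - Rb)| = Q at *
      have : D * (1 + (Q + 1) / (D * (x - x1)) * (x - x1)) = D + Q + 1 := by
        field_simp
        ring
      rw [this]; linarith
  set φ : ℝ → ℝ := fun s => p * s + D * Real.exp (K * (x - s)) with hφ
  have hφd : ∀ s, HasDerivAt φ (p - D * K * Real.exp (K * (x - s))) s := by
    intro s
    have h1 : HasDerivAt (fun s : ℝ => K * (x - s)) (K * (-1)) s :=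
      ((hasDerivAt_id s).const_sub x).const_mul K
    have h2 := (h1.exp).const_mul D
    have h3 := ((hasDerivAt_id s).const_mul p).fun_add h2
    exact h3.congr_deriv (by ring)
  have hsubI : Set.Icc x1 b ⊆ Set.Ici 0 := fun s hs => by
    simp only [Set.mem_Ici]; linarith [hs.1]
  obtain ⟨s₀, hs₀, hmax⟩ := isCompact_Icc.exists_isMaxOn
      (f := fun s => ρ s - φ s)
      (show (Set.Icc x1 b).Nonempty from ⟨x, by linarith, by linarith⟩)
      ((hc.mono hsubI).sub (by fun_prop))
  have hx := hmax (show x ∈ Set.Icc x1 b from ⟨by linarith, by linarith⟩)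
  simp only [Set.mem_ofPred_eq] at hx
  have hφx : φ x = p * x + D := by simp [hφ]
  have hbig : D - d * p ^ 2 - Rb ≤ ρ s₀ - φ s₀ := by
    rw [hφx] at hx
    linarith
  have hE : 0 < Real.exp (K * (x - s₀)) := Real.exp_pos _
  have hDE := mul_pos hD0 hE
  have hφs : φ s₀ = p * s₀ + D * Real.exp (K * (x - s₀)) := rfl
  have hneb : s₀ ≠ b := by
    intro h
    rw [hφs] at hbig
    rw [h] at hbig hDE
    linarith
  have hnex : s₀ ≠ x1 := by
    intro h
    rw [hφs] at hbig
    rw [h] at hbig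
    have := Real.add_one_le_exp (K * (x - x1))
    have := mul_le_mul_of_nonneg_left this hD0.le
    nlinarith
  have hs1 : x1 < s₀ := lt_of_le_of_ne hs₀.1 hnex.symm
  have hs2 : s₀ < b := lt_of_le_of_ne hs₀.2 hneb
  have hgt : p * s₀ - d * p ^ 2 - Rb < ρ s₀ := by rw [hφs] at hbig; linarith
  have hpos0 : 0 < ρ s₀ := by
    rcases le_total s₀ x with h | h
    · exact hposI s₀ hs1.le h
    · exact hpos s₀ h hs2 hgt
  have := hsub φ _ s₀ Rb (by linarith) hpos0 (by rw [hφ]; fun_prop) (hφd s₀) (by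
      filter_upwards [Icc_mem_nhds hs1 hs2] with s hs
      exact hmax hs) (hR s₀ (by linarith) hs2)
  have hu : 0 < D * K * Real.exp (K * (x - s₀)) := by positivity
  set u := D * K * Real.exp (K * (x - s₀))
  nlinarith [mul_pos hu (show 0 < s₀ - 2 * d * p by linarith), mul_pos hd (mul_pos hu hu)]

/-- lower bound at `c2` in the case `R1 ≤ R2` -/
lemma lower_c2 (d : ℝ) (R ρ : ℝ → ℝ) (hsup : SupP d R ρ)
    (hc : ContinuousOn ρ (Set.Ici 0)) (hd : 0 < d) (c1 c2 R1 R2 z A : ℝ)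
    (hc2 : 0 < c2) (hc12 : c2 < c1) (hR2 : 0 ≤ R2) (h0 : ρ 0 = 0)
    (hRl : ∀ s, 0 < s → s ≤ c2 → ∀ᶠ t in 𝓝 s, R t ≤ R2)
    (hRr : ∀ s, c2 < s → s < c1 → ∀ᶠ t in 𝓝 s, R t ≤ R1)
    (hz : 2 * d * z ≤ c1) (hA0 : 0 ≤ A) (hA : c2 - 2 * d * z ≤ A)
    (hρ1 : z * c1 - d * z ^ 2 - R1 ≤ ρ c1) :
    (c2 ^ 2 - A ^ 2) / (4 * d) - R1 ≤ ρ c2 ∨ c2 ^ 2 / (4 * d) - R2 ≤ ρ c2 := by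
  by_contra hcon
  push Not at hcon
  obtain ⟨hv, hw⟩ := hcon
  obtain ⟨e, he, hve⟩ : ∃ e : ℝ, 0 < e ∧ ρ c2 < (c2 ^ 2 - (A + e) ^ 2) / (4 * d) - R1 := by
    have hcont : Continuous (fun e : ℝ => (c2 ^ 2 - (A + e) ^ 2) / (4 * d) - R1) := by fun_prop
    have h1 : ∀ᶠ e in 𝓝 (0 : ℝ), ρ c2 < (c2 ^ 2 - (A + e) ^ 2) / (4 * d) - R1 :=
      hcont.continuousAt.eventually (lt_mem_nhds (by simpa using hv))
    have h2 := (h1.filter_mono (nhdsWithin_le_nhds (s := Set.Ioi 0))).and self_mem_nhdsWithin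
    obtain ⟨e, h3, h4⟩ := h2.exists
    exact ⟨e, h4, h3⟩
  set g : ℝ → ℝ := fun s => Real.sqrt ((s - c2) ^ 2 + e ^ 2) with hg
  have hin : ∀ s : ℝ, 0 < (s - c2) ^ 2 + e ^ 2 := fun s => by positivity
  have hg2 : ∀ s, g s ^ 2 = (s - c2) ^ 2 + e ^ 2 := fun s => Real.sq_sqrt (hin s).le
  have hgpos : ∀ s, 0 < g s := fun s => Real.sqrt_pos.mpr (hin s)
  have hgd : ∀ s, HasDerivAt g ((s - c2) / g s) s := by
    intro s
    have h1 : HasDerivAt (fun s : ℝ => (s - c2) ^ 2 + e ^ 2) (2 * (s - c2)) s := by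
      simpa using (((hasDerivAt_id s).sub_const c2).pow 2).add_const (e ^ 2)
    have h2 := h1.sqrt (hin s).ne'
    convert h2 using 1
    have := (hgpos s).ne'
    simp only [hg] at this ⊢
    field_simp
  have hgC : ContDiff ℝ 1 g := by
    rw [hg]
    exact ContDiff.sqrt (by fun_prop) (fun s => (hin s).ne')
  set φ : ℝ → ℝ := fun s => (s ^ 2 - (A + g s) ^ 2) / (4 * d) - R1 with hφ
  have hφC : ContDiff ℝ 1 φ := by rw [hφ]; fun_prop
  have hφd : ∀ s, HasDerivAt φ ((s - (A + g s) * ((s - c2) / g s)) / (2 * d)) s := by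
    intro s
    have h1 : HasDerivAt (fun s : ℝ => s ^ 2) (2 * s) s := by
      simpa using hasDerivAt_pow 2 s
    have h2 : HasDerivAt (fun s : ℝ => (A + g s) ^ 2) (2 * (A + g s) * ((s - c2) / g s)) s := by
      exact (((hgd s).const_add A).fun_pow 2).congr_deriv (by simp)
    have h3 := ((h1.fun_sub h2).div_const (4 * d)).sub_const R1
    refine h3.congr_deriv ?_
    rw [show 2 * (A + g s) * ((s - c2) / g s) = 2 * ((A + g s) * ((s - c2) / g s)) by ring]
    generalize (A + g s) * ((s - c2) / g s) = Q
    field_simp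
    ring
  have hgc2 : g c2 = e := by simp [hg, Real.sqrt_sq he.le]
  have hφc2 : φ c2 = (c2 ^ 2 - (A + e) ^ 2) / (4 * d) - R1 := by simp only [hφ, hgc2]
  have hφc1 : φ c1 ≤ ρ c1 := by
    refine le_trans ?_ hρ1
    have h1 : c1 - c2 ≤ g c1 := by
      apply Real.le_sqrt_of_sq_le
      nlinarith
    have h2 : c1 - 2 * d * z ≤ A + g c1 := by linarith
    have h3 : (c1 - 2 * d * z) ^ 2 ≤ (A + g c1) ^ 2 := by
      apply pow_le_pow_left₀ <;> linarith
    have h4 : z * c1 - d * z ^ 2 = (c1 ^ 2 - (c1 - 2 * d * z) ^ 2) / (4 * d) := by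
      field_simp
      ring
    rw [h4]
    simp only [hφ]
    gcongr
  have hsubI : Set.Icc c2 c1 ⊆ Set.Ici 0 := fun s hs => by
    simp only [Set.mem_Ici]; linarith [hs.1]
  obtain ⟨s₀, hs₀, hmin⟩ := isCompact_Icc.exists_isMinOn
      (f := fun s => ρ s - φ s)
      (show (Set.Icc c2 c1).Nonempty from ⟨c2, le_rfl, hc12.le⟩)
      ((hc.mono hsubI).sub hφC.continuous.continuousOn)
  have hx := hmin (show c2 ∈ Set.Icc c2 c1 from ⟨le_rfl, hc12.le⟩)
  simp only [Set.mem_ofPred_eq] at hx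
  have hneg : ρ s₀ - φ s₀ < 0 := by rw [hφc2] at hx; linarith
  have hne1 : s₀ ≠ c1 := by
    rintro rfl
    linarith
  have hs2 : s₀ < c1 := lt_of_le_of_ne hs₀.2 hne1
  have heq : s₀ = c2 := by
    by_contra hne
    have hs1 : c2 < s₀ := lt_of_le_of_ne hs₀.1 (Ne.symm hne)
    have := hsup φ _ s₀ R1 (by linarith) hφC (hφd s₀) (by
      filter_upwards [Icc_mem_nhds hs1 hs2] with s hs
      exact hmin hs) (hRr s₀ hs1 hs2)
    set k := (s₀ - c2) / g s₀ with hk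
    have hk2 : k ^ 2 ≤ 1 := by
      rw [hk, div_pow, hg2, div_le_one (hin s₀)]
      nlinarith
    have h5 : s₀ * ((s₀ - (A + g s₀) * k) / (2 * d)) - d * ((s₀ - (A + g s₀) * k) / (2 * d)) ^ 2
        = (s₀ ^ 2 - (A + g s₀) ^ 2 * k ^ 2) / (4 * d) := by
      field_simp
      ring
    rw [h5] at this
    have h6 : (s₀ ^ 2 - (A + g s₀) ^ 2) / (4 * d) ≤
        (s₀ ^ 2 - (A + g s₀) ^ 2 * k ^ 2) / (4 * d) := by
      gcongr
      nlinarith [sq_nonneg (A + g s₀)]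
    have h7 : φ s₀ = (s₀ ^ 2 - (A + g s₀) ^ 2) / (4 * d) - R1 := rfl
    linarith
  subst heq
  -- left side
  set h := Real.sqrt (s₀ ^ 2 - 4 * d * (R2 + ρ s₀)) with hh
  have harg : 0 < s₀ ^ 2 - 4 * d * (R2 + ρ s₀) := by
    have : ρ s₀ + R2 < s₀ ^ 2 / (4 * d) := by linarith
    rw [lt_div_iff₀ (by positivity)] at this
    linarith
  have hhpos : 0 < h := Real.sqrt_pos.mpr harg
  have hh2 : h ^ 2 = s₀ ^ 2 - 4 * d * (R2 + ρ s₀) := Real.sq_sqrt harg.le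
  obtain ⟨L, hL⟩ : ∃ L, L = (s₀ - h) / (2 * d) := ⟨_, rfl⟩
  have hL' : h = s₀ - 2 * d * L := by rw [hL]; field_simp; ring
  have hLv : L * s₀ - d * L ^ 2 - R2 = ρ s₀ := by
    rw [hL'] at hh2
    have : 4 * d * (L * s₀ - d * L ^ 2 - R2) = 4 * d * ρ s₀ := by linarith
    exact mul_left_cancel₀ (by positivity) this
  have hleft := lower_line d R ρ hsup hc s₀ L R2 hd hc2
    (fun s h1 h2 => hRl s h1 h2.le) hR2 h0 hLv.le
  have hder := hφd s₀
  have := hsup φ _ s₀ R2 hc2 hφC hder (by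
    have hm : max 0 (4 * d * L - s₀) < s₀ := max_lt hc2 (by linarith)
    filter_upwards [Icc_mem_nhds hm hc12] with s hs
    rcases le_total s₀ s with h1 | h1
    · exact hmin ⟨h1, hs.2⟩
    · have h2 := max_le_iff.mp hs.1
      have h3 := hleft s h2.1 h1
      have h4 : e ≤ g s := by
        apply Real.le_sqrt_of_sq_le
        nlinarith [sq_nonneg (s - s₀)]
      have h5 : φ s - φ s₀ ≤ L * (s - s₀) := by
        have h6 : φ s ≤ (s ^ 2 - (A + e) ^ 2) / (4 * d) - R1 := by
          simp only [hφ]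
          gcongr
        have h7 : (s ^ 2 - (A + e) ^ 2) / (4 * d) - R1 - φ s₀ = (s - s₀) * (s + s₀) / (4 * d) := by
          rw [hφc2]; field_simp; ring
        have h8 : (s - s₀) * (s + s₀) / (4 * d) ≤ L * (s - s₀) := by
          rw [div_le_iff₀ (by positivity)]
          have h10 := mul_nonneg (show 0 ≤ s₀ - s by linarith)
            (show 0 ≤ s + s₀ - 4 * d * L by linarith [h2.2])
          linarith
        linarith
      linarith) (hRl s₀ hc2 le_rfl)
  simp only [sub_self, zero_div, mul_zero, sub_zero] at this
  have h9 : s₀ * (s₀ / (2 * d)) - d * (s₀ / (2 * d)) ^ 2 = s₀ ^ 2 / (4 * d) := by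
    field_simp
    ring
  linarith

/-- final step: read off the free boundary -/
lemma final_step (d : ℝ) (R ρ : ℝ → ℝ) (hsup : SupP d R ρ) (hsub : SubP d R ρ)
    (hc : ContinuousOn ρ (Set.Ici 0)) (hd : 0 < d) (c2 R2 p : ℝ)
    (hc2 : 0 < c2) (hR2 : 0 < R2) (h0 : ρ 0 = 0)
    (hnn : ∀ s, 0 < s → 0 ≤ ρ s)
    (hRu : ∀ s, 0 < s → s < c2 → ∀ᶠ t in 𝓝 s, R t ≤ R2)
    (hRl : ∀ s, 0 < s → s < c2 → ∀ᶠ t in 𝓝 s, R2 ≤ R t)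
    (hpos : ∀ s, c2 ≤ s → 0 < ρ s) (hp : 0 < p) (hpR : d * p ^ 2 ≤ R2)
    (hlow : p * c2 - d * p ^ 2 - R2 ≤ ρ c2)
    (hup : (d * p ^ 2 = R2 ∧ 2 * d * p < c2) ∨ ρ c2 ≤ p * c2 - d * p ^ 2 - R2) :
    sSup {s : ℝ | 0 ≤ s ∧ ρ s = 0} = d * p + R2 / p := by
  set s' := d * p + R2 / p with hs'
  have hps : p * s' = d * p ^ 2 + R2 := by rw [hs']; field_simp
  have hs0 : 0 < s' := by positivity
  have hsc : s' < c2 := by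
    have : p * s' < p * c2 := by
      rw [hps]
      rcases hup with ⟨h1, h2⟩ | h
      · nlinarith
      · linarith [hpos c2 le_rfl]
    exact lt_of_mul_lt_mul_left this hp.le
  have h2dp : 2 * d * p ≤ s' := by
    have : p * (2 * d * p) ≤ p * s' := by rw [hps]; nlinarith
    exact le_of_mul_le_mul_left this hp
  apply IsGreatest.csSup_eq
  constructor
  · refine ⟨hs0.le, le_antisymm ?_ (hnn s' hs0)⟩
    by_contra hcon
    push Not at hcon
    rcases eq_or_lt_of_le h2dp with heq | hlt
    · have := upper_env d R ρ hsub hc hd 0 c2 R2 le_rfl hRl s' hs0 hsc hcon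
      have h1 : s' ^ 2 / (4 * d) = R2 := by
        rw [div_eq_iff (by positivity)]
        rw [← heq] at hps ⊢
        nlinarith
      linarith
    · have hpr : ρ c2 ≤ p * c2 - d * p ^ 2 - R2 := by
        rcases hup with ⟨h1, h2⟩ | h
        · exfalso
          have : p * (2 * d * p) < p * s' := by gcongr
          nlinarith
        · exact h
      have := upper_line d R ρ hsub hc hd (2 * d * p) c2 p R2 (by positivity) le_rfl
        (fun s h1 h2 => hRl s (lt_trans (by positivity) h1) h2) hpr s' hlt hsc
        (fun s h1 h2 h3 => by nlinarith)
      linarith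
  · rintro s ⟨h1, h2⟩
    by_contra hcon
    push Not at hcon
    rcases le_total c2 s with h3 | h3
    · linarith [hpos s h3]
    · have := lower_line d R ρ hsup hc c2 p R2 hd hc2 hRu hR2.le h0 hlow s h1 h3
      nlinarith [mul_lt_mul_of_pos_left hcon hp]

lemma sqrt_scale (d x : ℝ) (hd : 0 < d) : 2 * d * Real.sqrt (x / d) = Real.sqrt (4 * d * x) := by
  have h1 : 4 * d * x = (2 * d) ^ 2 * (x / d) := by field_simp; ring
  rw [h1, Real.sqrt_mul (by positivity), Real.sqrt_sq (by positivity)]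

lemma right_limit (ρ f : ℝ → ℝ) (c : ℝ) (h1 : ContinuousAt ρ c) (h2 : ContinuousAt f c)
    (h : ∀ᶠ x in 𝓝[>] c, ρ x ≤ f x) : ρ c ≤ f c :=
  le_of_tendsto_of_tendsto (h1.tendsto.mono_left nhdsWithin_le_nhds)
    (h2.tendsto.mono_left nhdsWithin_le_nhds) h

set_option maxHeartbeats 2000000

theorem snlp_explicit_formula (d3 r3 a31 a32 c1 c2 lam : ℝ)
    (hd3 : 0 < d3) (hr3 : 0 < r3) (ha31 : 0 ≤ a31) (ha32 : 0 ≤ a32)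
    (hsum : a31 + a32 < 1) (hc2 : 0 < c2) (hc12 : c2 < c1) (hlam : 0 < lam)
    (hσc2 : (if lam < Real.sqrt (r3 / d3) then d3 * lam + r3 / lam
      else 2 * Real.sqrt (d3 * r3)) < c2)
    (ρ : ℝ → ℝ) (hρ : NlpSol d3 r3 a31 a32 c1 c2 lam ρ)
    (snlp : ℝ) (hsnlp : snlp = sSup {s : ℝ | 0 ≤ s ∧ ρ s = 0})
    (ζ1 : ℝ) (hζ1 : ζ1 = if c1 / (2 * d3) ≤ lam then c1 / (2 * d3) - Real.sqrt (r3 * a31 / d3)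
      else (c1 - Real.sqrt ((c1 - 2 * d3 * lam) ^ 2 + 4 * d3 * r3 * a31)) / (2 * d3))
    (ζ2 : ℝ) (hζ2 : ζ2 = c2 / (2 * d3) + Real.sqrt (r3 * (a31 - a32) / d3))
    (lnlp1 : ℝ) (hlnlp1 : lnlp1 = c2 / (2 * d3) - Real.sqrt (r3 * (a32 - a31) / d3))
    (lnlp2 : ℝ) (hlnlp2 : lnlp2 = (c2 - Real.sqrt ((c2 - 2 * d3 * ζ1) ^ 2
      + 4 * d3 * r3 * (a32 - a31))) / (2 * d3)) :
    snlp = if c2 / (2 * d3) < ζ1 ∧ a31 < a32 ∧ lnlp1 ≤ Real.sqrt (r3 * (1 - a32) / d3)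
      then d3 * lnlp1 + r3 * (1 - a32) / lnlp1
      else if ζ1 ≤ c2 / (2 * d3) ∧ lnlp2 ≤ Real.sqrt (r3 * (1 - a32) / d3) ∧
          (a31 < a32 ∨ (a32 ≤ a31 ∧ ζ1 + ζ2 < c2 / d3))
      then d3 * lnlp2 + r3 * (1 - a32) / lnlp2
      else 2 * Real.sqrt (d3 * r3 * (1 - a32)) := by
  obtain ⟨hc, ⟨hsup', hsub'⟩, h0, hlim⟩ := hρ
  have hsup : SupP d3 (Rf r3 a31 a32 c1 c2) ρ :=
    supP_of d3 _ ρ _ (le_Rf r3 a31 a32 c1 c2 hr3 ha31 ha32) hsup'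
  have hsub : SubP d3 (Rf r3 a31 a32 c1 c2) ρ :=
    subP_of d3 _ ρ _ (Rf_le r3 a31 a32 c1 c2 hr3 ha31 ha32) hsub'
  have hnn : ∀ s, 0 < s → 0 ≤ ρ s := fun s hs => hsup'.2.1 s hs
  have hRle := Rf_le r3 a31 a32 c1 c2 hr3 ha31 ha32
  clear hsup' hsub'
  have hRL : ∀ s, 0 < s → s < c2 → ∀ᶠ t in 𝓝 s, Rf r3 a31 a32 c1 c2 t = r3 * (1 - a32) := by
    intro s h1 h2
    filter_upwards [Ioo_mem_nhds h1 h2] with t ht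
    have e1 : ¬ (c2 ≤ t ∧ t ≤ c1) := fun h => by linarith [ht.2, h.1]
    have e2 : 0 < t ∧ t ≤ c2 := ⟨ht.1, ht.2.le⟩
    simp only [Rf, if_neg e1, if_pos e2]; ring
  have hRM : ∀ s, c2 < s → s < c1 → ∀ᶠ t in 𝓝 s, Rf r3 a31 a32 c1 c2 t = r3 * (1 - a31) := by
    intro s h1 h2
    filter_upwards [Ioo_mem_nhds h1 h2] with t ht
    have e1 : (c2 ≤ t ∧ t ≤ c1) := ⟨ht.1.le, ht.2.le⟩
    have e2 : ¬ (0 < t ∧ t ≤ c2) := fun h => by linarith [ht.1, h.2]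
    simp only [Rf, if_pos e1, if_neg e2]; ring
  have hRR : ∀ s, c1 < s → ∀ᶠ t in 𝓝 s, Rf r3 a31 a32 c1 c2 t = r3 := by
    intro s h1
    filter_upwards [Ioi_mem_nhds h1] with t ht
    have ht' : c1 < t := ht
    have e1 : ¬ (c2 ≤ t ∧ t ≤ c1) := fun h => by linarith [h.2]
    have e2 : ¬ (0 < t ∧ t ≤ c2) := fun h => by linarith [h.2]
    simp only [Rf, if_neg e1, if_neg e2]; ring
  have hRmax : ∀ M, r3 * (1 - a31) ≤ M → r3 * (1 - a32) ≤ M →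
      ∀ s, 0 < s → s < c1 → ∀ᶠ t in 𝓝 s, Rf r3 a31 a32 c1 c2 t ≤ M := by
    intro M hM1 hM2 s h1 h2
    filter_upwards [Ioo_mem_nhds h1 h2] with t ht
    have ha := mul_nonneg hr3.le ha31
    unfold Rf
    split_ifs with e1 e2 e2
    · linarith
    · linarith
    · linarith
    · exfalso
      rcases le_total c2 t with h | h
      · exact e1 ⟨h, ht.2.le⟩
      · exact e2 ⟨ht.1, h⟩
  have hR2pos : 0 < r3 * (1 - a32) := mul_pos hr3 (by linarith)
  have hR1pos : 0 < r3 * (1 - a31) := mul_pos hr3 (by linarith)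
  have hc1 : 0 < c1 := by linarith
  have hcat : ∀ s, 0 < s → ContinuousAt ρ s := fun s hs => hc.continuousAt (Ici_mem_nhds hs)
  -- global lower bound
  have hG : ∀ p, p ≤ lam → ∀ s, 0 ≤ s → p * s - d3 * p ^ 2 - r3 ≤ ρ s := by
    have hlt : ∀ p, p < lam → ∀ s, 0 ≤ s → p * s - d3 * p ^ 2 - r3 ≤ ρ s := by
      intro p hp s hs
      obtain ⟨b, hb1, hb2⟩ := ((hlim.eventually (lt_mem_nhds hp)).and
        (eventually_gt_atTop s)).exists
      have hb : 0 < b := by linarith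
      rw [lt_div_iff₀ hb] at hb1
      refine lower_line d3 _ ρ hsup hc b p r3 hd3 hb (fun s _ _ => Eventually.of_forall hRle)
        hr3.le h0 ?_ s hs hb2.le
      nlinarith [sq_nonneg p]
    intro p hp s hs
    rcases lt_or_eq_of_le hp with h | h
    · exact hlt p h s hs
    · have hcont : Continuous (fun q : ℝ => q * s - d3 * q ^ 2 - r3) := by fun_prop
      refine le_of_tendsto ((hcont.tendsto p).mono_left (nhdsWithin_le_nhds (s := Set.Iio p))) ?_
      filter_upwards [self_mem_nhdsWithin] with q hq
      exact hlt q (lt_of_lt_of_le hq hp) s hs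
  obtain ⟨p0, hp0, hp0l, hp0c⟩ : ∃ p, 0 < p ∧ p ≤ lam ∧ 0 < p * c2 - d3 * p ^ 2 - r3 := by
    split_ifs at hσc2 with h
    · refine ⟨lam, hlam, le_rfl, ?_⟩
      have h1 := mul_lt_mul_of_pos_left hσc2 hlam
      have h2 : lam * (d3 * lam + r3 / lam) = d3 * lam ^ 2 + r3 := by field_simp
      linarith
    · push Not at h
      have hq : 0 < Real.sqrt (r3 / d3) := Real.sqrt_pos.mpr (by positivity)
      refine ⟨Real.sqrt (r3 / d3), hq, h, ?_⟩
      have h2 : Real.sqrt (r3 / d3) ^ 2 = r3 / d3 := Real.sq_sqrt (by positivity)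
      have h3 : 2 * Real.sqrt (d3 * r3) = 2 * d3 * Real.sqrt (r3 / d3) := by
        rw [sqrt_scale d3 r3 hd3, show 4 * d3 * r3 = 2 ^ 2 * (d3 * r3) by ring,
          Real.sqrt_mul (show (0 : ℝ) ≤ 2 ^ 2 by positivity), Real.sqrt_sq (by positivity)]
      have h4 : d3 * Real.sqrt (r3 / d3) ^ 2 = r3 := by rw [h2]; field_simp
      rw [h3] at hσc2
      nlinarith [mul_lt_mul_of_pos_left hσc2 hq]
  have hposc : ∀ s, c2 ≤ s → 0 < ρ s := by
    intro s hs
    have := hG p0 hp0l s (by linarith)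
    nlinarith [mul_le_mul_of_nonneg_left hs hp0.le]
  have hc2r : 4 * d3 * r3 < c2 ^ 2 := by
    nlinarith [sq_nonneg (c2 - 2 * d3 * p0), mul_pos hd3 hp0c]
  clear hσc2 hp0 hp0l hp0c
  -- the value at c1
  obtain ⟨L, hLl, hLc, hLup, q, hq0, hq2, hqz⟩ : ∃ L, L ≤ lam ∧ 2 * d3 * L ≤ c1 ∧
      ρ c1 ≤ L * c1 - d3 * L ^ 2 - r3 ∧ ∃ q, 0 ≤ q ∧
      q ^ 2 = (c1 - 2 * d3 * L) ^ 2 + 4 * d3 * r3 * a31 ∧ 2 * d3 * ζ1 = c1 - q := by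
    have hnn4 : 0 ≤ 4 * d3 * r3 * a31 := by positivity
    split_ifs at hζ1 with h
    · refine ⟨c1 / (2 * d3), h, le_of_eq (by field_simp), ?_,
        Real.sqrt (4 * d3 * (r3 * a31)), Real.sqrt_nonneg _, ?_, ?_⟩
      · have h1 : c1 / (2 * d3) * c1 - d3 * (c1 / (2 * d3)) ^ 2 - r3 = c1 ^ 2 / (4 * d3) - r3 := by
          field_simp; ring
        rw [h1]
        refine right_limit ρ (fun x => x ^ 2 / (4 * d3) - r3) c1 (hcat c1 hc1)
          (by fun_prop) ?_
        filter_upwards [self_mem_nhdsWithin] with x hx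
        have hx' : c1 < x := hx
        exact upper_env d3 _ ρ hsub hc hd3 c1 (x + 1) r3 hc1.le
          (fun s h1 _ => (hRR s h1).mono fun t ht => ht.ge) x hx' (by linarith)
          (hposc x (by linarith))
      · rw [Real.sq_sqrt (by linarith), show c1 - 2 * d3 * (c1 / (2 * d3)) = 0 by field_simp; ring]
        ring
      · rw [hζ1, mul_sub, sqrt_scale d3 _ hd3]
        congr 1
        field_simp
    · push Not at h
      rw [lt_div_iff₀ (by positivity)] at h
      refine ⟨lam, le_rfl, by linarith, ?_, Real.sqrt ((c1 - 2 * d3 * lam) ^ 2 + 4 * d3 * r3 * a31),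
        Real.sqrt_nonneg _, ?_, ?_⟩
      · have key : ∀ p, lam < p → 2 * d3 * p < c1 → ρ c1 ≤ p * c1 - d3 * p ^ 2 - r3 := by
          intro p hp hpc
          refine right_limit ρ (fun x => p * x - d3 * p ^ 2 - r3) c1 (hcat c1 hc1)
            (by fun_prop) ?_
          filter_upwards [self_mem_nhdsWithin] with x hx
          have hx' : c1 < x := hx
          obtain ⟨m, hm1, hm2⟩ := exists_between hp
          obtain ⟨b, ⟨hb1, hb2⟩, hb3⟩ := (((hlim.eventually (gt_mem_nhds hm1)).and
            (eventually_gt_atTop x)).and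
            (eventually_gt_atTop ((d3 * p ^ 2 + r3) / (p - m)))).exists
          have hb : 0 < b := by linarith
          rw [div_lt_iff₀ hb] at hb1
          rw [div_lt_iff₀ (by linarith)] at hb3
          exact upper_line d3 _ ρ hsub hc hd3 c1 b p r3 hc1.le hpc.le
            (fun s h1 _ => (hRR s h1).mono fun t ht => ht.ge) (by linarith) x hx' hb2
            (fun s h1 _ _ => hposc s (by linarith))
        have hcont : Continuous (fun p : ℝ => p * c1 - d3 * p ^ 2 - r3) := by fun_prop
        refine ge_of_tendsto ((hcont.tendsto lam).mono_left
          (nhdsWithin_le_nhds (s := Set.Ioi lam))) ?_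
        have hmem : Set.Iio (c1 / (2 * d3)) ∈ 𝓝 lam :=
          Iio_mem_nhds (by rw [lt_div_iff₀ (by positivity)]; linarith)
        filter_upwards [self_mem_nhdsWithin, mem_nhdsWithin_of_mem_nhds hmem] with p hp hp2
        have hp2' : p < c1 / (2 * d3) := hp2
        rw [lt_div_iff₀ (by positivity)] at hp2'
        exact key p hp (by linarith)
      · rw [Real.sq_sqrt (by positivity)]
      · rw [hζ1]; field_simp
  have hζc : 2 * d3 * ζ1 ≤ c1 := by linarith
  have hζv : ζ1 * c1 - d3 * ζ1 ^ 2 - r3 * (1 - a31) = L * c1 - d3 * L ^ 2 - r3 := by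
    have hq' : q = c1 - 2 * d3 * ζ1 := by linarith
    rw [hq'] at hq2
    have : 4 * d3 * (ζ1 * c1 - d3 * ζ1 ^ 2 - r3 * (1 - a31)) =
        4 * d3 * (L * c1 - d3 * L ^ 2 - r3) := by linarith
    exact mul_left_cancel₀ (by positivity) this
  have hρ1 : ζ1 * c1 - d3 * ζ1 ^ 2 - r3 * (1 - a31) ≤ ρ c1 := by
    rw [hζv]; exact hG L hLl c1 hc1.le
  have hρ1u : ρ c1 ≤ ζ1 * c1 - d3 * ζ1 ^ 2 - r3 * (1 - a31) := by
    rw [hζv]; exact hLup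
  clear hLup hLl hLc hq0 hq2 hqz hζ1 hζv hlim hG
  -- lower bound at c2
  obtain ⟨A, hAdef⟩ : ∃ A, A = max (c2 - 2 * d3 * ζ1) 0 := ⟨_, rfl⟩
  have hAlow : (c2 ^ 2 - A ^ 2) / (4 * d3) - r3 * (1 - a31) ≤ ρ c2 ∨
      c2 ^ 2 / (4 * d3) - r3 * (1 - a32) ≤ ρ c2 := by
    rcases le_or_gt a32 a31 with ha | ha
    · have hle : r3 * (1 - a31) ≤ r3 * (1 - a32) := by
        apply mul_le_mul_of_nonneg_left _ hr3.le; linarith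
      exact lower_c2 d3 _ ρ hsup hc hd3 c1 c2 _ _ ζ1 A hc2 hc12 hR2pos.le h0
        (fun s h1 h2 => hRmax _ hle le_rfl s h1 (by linarith))
        (fun s h1 h2 => (hRM s h1 h2).mono fun t ht => ht.le) hζc
        (by rw [hAdef]; exact le_max_right _ _) (by rw [hAdef]; exact le_max_left _ _) hρ1
    · left
      have hle : r3 * (1 - a32) ≤ r3 * (1 - a31) := by
        apply mul_le_mul_of_nonneg_left _ hr3.le; linarith
      obtain ⟨m, hm, hmz⟩ : ∃ m, c2 - 2 * d3 * m = A ∧ m ≤ ζ1 := by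
        refine ⟨(c2 - A) / (2 * d3), by field_simp; ring, ?_⟩
        rw [div_le_iff₀ (by positivity)]
        have := le_max_left (c2 - 2 * d3 * ζ1) 0
        rw [← hAdef] at this
        linarith
      have hh : m * c1 - d3 * m ^ 2 - r3 * (1 - a31) ≤ ρ c1 := by
        have hdm := mul_le_mul_of_nonneg_left hmz hd3.le
        have := mul_nonneg (sub_nonneg.mpr hmz) (show 0 ≤ c1 - d3 * ζ1 - d3 * m by linarith)
        linarith
      have := lower_line d3 _ ρ hsup hc c1 m (r3 * (1 - a31)) hd3 hc1
        (hRmax _ le_rfl hle) hR1pos.le h0 hh c2 hc2.le hc12.le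
      have h2 : (c2 ^ 2 - A ^ 2) / (4 * d3) = m * c2 - d3 * m ^ 2 := by
        rw [← hm]; field_simp; ring
      rw [h2]; exact this
  have hP : ∀ p, A ^ 2 + 4 * d3 * r3 * (a32 - a31) ≤ (c2 - 2 * d3 * p) ^ 2 →
      p * c2 - d3 * p ^ 2 - r3 * (1 - a32) ≤ ρ c2 := by
    intro p hp
    have h1 : p * c2 - d3 * p ^ 2 = (c2 ^ 2 - (c2 - 2 * d3 * p) ^ 2) / (4 * d3) := by
      field_simp; ring
    rw [h1]
    rcases hAlow with h | h
    · refine le_trans ?_ h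
      have h2 : (c2 ^ 2 - A ^ 2) / (4 * d3) - r3 * (1 - a31) =
          (c2 ^ 2 - (A ^ 2 + 4 * d3 * r3 * (a32 - a31))) / (4 * d3) - r3 * (1 - a32) := by
        field_simp; ring
      rw [h2]
      gcongr
    · refine le_trans ?_ h
      gcongr
      linarith [sq_nonneg (c2 - 2 * d3 * p)]
  have hfin := fun p => final_step d3 _ ρ hsup hsub hc hd3 c2 (r3 * (1 - a32)) p hc2 hR2pos h0 hnn
    (fun s h1 h2 => (hRL s h1 h2).mono fun t ht => ht.le)
    (fun s h1 h2 => (hRL s h1 h2).mono fun t ht => ht.ge) hposc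
  have hfin2 : ∀ p, 2 * d3 * p ≤ c2 → p ≤ Real.sqrt (r3 * (1 - a32) / d3) →
      (c2 - 2 * d3 * p) ^ 2 = A ^ 2 + 4 * d3 * r3 * (a32 - a31) →
      ρ c2 ≤ p * c2 - d3 * p ^ 2 - r3 * (1 - a32) →
      snlp = d3 * p + r3 * (1 - a32) / p := by
    intro p h1 h2 h3 h4
    have hρc := hposc c2 le_rfl
    have hp : 0 < p := by
      by_contra hcon
      push Not at hcon
      linarith [mul_nonneg (neg_nonneg.mpr hcon) hc2.le, mul_nonneg hd3.le (sq_nonneg p)]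
    have hpR : d3 * p ^ 2 ≤ r3 * (1 - a32) := by
      have := (Real.le_sqrt hp.le (by positivity)).mp h2
      rw [le_div_iff₀ hd3] at this
      linarith
    rw [hsnlp]
    exact hfin p hp hpR (hP p h3.ge) (Or.inr h4)
  have hsqX : ∀ X y : ℝ, Real.sqrt X < y → X ≤ y ^ 2 := by
    intro X y h
    rcases le_total X 0 with h1 | h1
    · nlinarith [sq_nonneg y]
    · have := Real.sq_sqrt h1
      nlinarith [Real.sqrt_nonneg X]
  have hl1 : c2 - 2 * d3 * lnlp1 = Real.sqrt (4 * d3 * (r3 * (a32 - a31))) := by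
    rw [hlnlp1, mul_sub, sqrt_scale d3 _ hd3]
    field_simp
    ring
  have hl2 : c2 - 2 * d3 * lnlp2 = Real.sqrt ((c2 - 2 * d3 * ζ1) ^ 2
      + 4 * d3 * r3 * (a32 - a31)) := by
    rw [hlnlp2]
    field_simp
    ring
  have hz2 : 2 * d3 * ζ2 = c2 + Real.sqrt (4 * d3 * (r3 * (a31 - a32))) := by
    rw [hζ2, mul_add, sqrt_scale d3 _ hd3]
    field_simp
  have hz12 : ζ1 + ζ2 < c2 / d3 ↔ Real.sqrt (4 * d3 * (r3 * (a31 - a32))) < c2 - 2 * d3 * ζ1 := by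
    rw [lt_div_iff₀ hd3]
    constructor <;> intro h <;> linarith
  have hA1 : c2 / (2 * d3) < ζ1 → A = 0 := by
    intro h
    rw [div_lt_iff₀ (by positivity)] at h
    rw [hAdef]; exact max_eq_right (by linarith)
  have hA2 : ζ1 ≤ c2 / (2 * d3) → A = c2 - 2 * d3 * ζ1 ∧ 2 * d3 * ζ1 ≤ c2 := by
    intro h
    rw [le_div_iff₀ (by positivity)] at h
    exact ⟨by rw [hAdef]; exact max_eq_left (by linarith), by linarith⟩
  have hdr : 0 < 4 * d3 * r3 := by positivity
  split_ifs with hI hII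
  · obtain ⟨h1, h2, h3⟩ := hI
    have hs := Real.sqrt_nonneg (4 * d3 * (r3 * (a32 - a31)))
    have hsq : (c2 - 2 * d3 * lnlp1) ^ 2 = 4 * d3 * (r3 * (a32 - a31)) := by
      rw [hl1, Real.sq_sqrt]
      have : 0 < a32 - a31 := by linarith
      positivity
    refine hfin2 lnlp1 (by linarith) h3 ?_ ?_
    · rw [hsq, hA1 h1]; ring
    · have h4 : lnlp1 * c2 - d3 * lnlp1 ^ 2 - r3 * (1 - a32) =
          c2 ^ 2 / (4 * d3) - r3 * (1 - a31) := by
        have : lnlp1 * c2 - d3 * lnlp1 ^ 2 = (c2 ^ 2 - (c2 - 2 * d3 * lnlp1) ^ 2) / (4 * d3) := by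
          field_simp; ring
        rw [this, hsq]; field_simp; ring
      rw [h4]
      refine right_limit ρ (fun x => x ^ 2 / (4 * d3) - r3 * (1 - a31)) c2 (hcat c2 hc2)
        (by fun_prop) ?_
      filter_upwards [self_mem_nhdsWithin, mem_nhdsWithin_of_mem_nhds (Iio_mem_nhds hc12)]
        with x hx hx2
      have hx' : c2 < x := hx
      exact upper_env d3 _ ρ hsub hc hd3 c2 c1 _ hc2.le
        (fun s h1 h2 => (hRM s h1 h2).mono fun t ht => ht.ge) x hx' hx2 (hposc x hx'.le)
  · obtain ⟨h1, h2, h3⟩ := hII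
    obtain ⟨hA, hζ⟩ := hA2 h1
    have hX : 0 ≤ (c2 - 2 * d3 * ζ1) ^ 2 + 4 * d3 * r3 * (a32 - a31) := by
      rcases h3 with h | ⟨h, h'⟩
      · have : 0 < a32 - a31 := by linarith
        positivity
      · have := hsqX _ _ (hz12.mp h')
        linarith
    have hsq := Real.sq_sqrt hX
    rw [← hl2] at hsq
    have hs := Real.sqrt_nonneg ((c2 - 2 * d3 * ζ1) ^ 2 + 4 * d3 * r3 * (a32 - a31))
    rw [← hl2] at hs
    refine hfin2 lnlp2 (by linarith) h2 (by rw [hsq, hA]) ?_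
    have h4 : lnlp2 * c2 - d3 * lnlp2 ^ 2 - r3 * (1 - a32) =
          ζ1 * c2 - d3 * ζ1 ^ 2 - r3 * (1 - a31) := by
      have : lnlp2 * c2 - d3 * lnlp2 ^ 2 = (c2 ^ 2 - (c2 - 2 * d3 * lnlp2) ^ 2) / (4 * d3) := by
        field_simp; ring
      rw [this, hsq]; field_simp; ring
    rw [h4]
    refine right_limit ρ (fun x => ζ1 * x - d3 * ζ1 ^ 2 - r3 * (1 - a31)) c2 (hcat c2 hc2)
        (by fun_prop) ?_
    filter_upwards [self_mem_nhdsWithin, mem_nhdsWithin_of_mem_nhds (Iio_mem_nhds hc12)]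
        with x hx hx2
    have hx' : c2 < x := hx
    exact upper_line d3 _ ρ hsub hc hd3 c2 c1 ζ1 _ hc2.le hζ
        (fun s h1 h2 => (hRM s h1 h2).mono fun t ht => ht.ge) hρ1u x hx' hx2
        (fun s h1 _ _ => hposc s (by linarith))
  · obtain ⟨p, hpdef⟩ : ∃ p, p = Real.sqrt (r3 * (1 - a32) / d3) := ⟨_, rfl⟩
    have hp : 0 < p := by rw [hpdef]; exact Real.sqrt_pos.mpr (by positivity)
    have hp2 : d3 * p ^ 2 = r3 * (1 - a32) := by
      rw [hpdef, Real.sq_sqrt (by positivity)]; field_simp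
    have hpc : 2 * d3 * p < c2 := by
      apply lt_of_pow_lt_pow_left₀ 2 hc2.le
      have : (2 * d3 * p) ^ 2 = 4 * d3 * (r3 * (1 - a32)) := by rw [← hp2]; ring
      rw [this]
      nlinarith [mul_nonneg hdr.le ha32]
    have hgoal : 2 * Real.sqrt (d3 * r3 * (1 - a32)) = d3 * p + r3 * (1 - a32) / p := by
      have h1 : d3 * r3 * (1 - a32) = (d3 * p) ^ 2 := by
        rw [mul_assoc, ← hp2]; ring
      rw [h1, Real.sqrt_sq (by positivity), ← hp2]
      field_simp
      ring
    rw [hgoal, hsnlp]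
    refine hfin p hp hp2.le (hP p ?_) (Or.inl ⟨hp2, hpc⟩)
    rw [← hpdef] at hI hII
    rcases lt_or_ge (c2 / (2 * d3)) ζ1 with h1 | h1
    · rw [hA1 h1]
      rcases lt_or_ge a31 a32 with h2 | h2
      · have h3 : p < lnlp1 := by
          by_contra hcon
          exact hI ⟨h1, h2, not_lt.mp hcon⟩
        have h4 := mul_lt_mul_of_pos_left h3 hd3
        have := hsqX (4 * d3 * (r3 * (a32 - a31))) (c2 - 2 * d3 * p) (by rw [← hl1]; linarith)
        linarith
      · nlinarith [sq_nonneg (c2 - 2 * d3 * p), mul_nonneg hdr.le (sub_nonneg.mpr h2)]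
    · obtain ⟨hA, hζ⟩ := hA2 h1
      rw [hA]
      rcases lt_or_ge p lnlp2 with h2 | h2
      · have h4 := mul_lt_mul_of_pos_left h2 hd3
        exact hsqX _ _ (by rw [← hl2]; linarith)
      · have h3 : ¬ (a31 < a32 ∨ (a32 ≤ a31 ∧ ζ1 + ζ2 < c2 / d3)) := fun h => hII ⟨h1, h2, h⟩
        push Not at h3
        have h4 := h3.2 h3.1
        rw [← not_lt, hz12, not_lt] at h4
        have h5 := pow_le_pow_left₀ (by linarith) h4 2
        rw [Real.sq_sqrt (by
          have : 0 ≤ a31 - a32 := by linarith [h3.1]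
          positivity)] at h5
        linarith [sq_nonneg (c2 - 2 * d3 * p)]
end
end

section
/- Let d, r > 0 and λ ∈ (0,∞). Define ρ₁ : [0,∞) → ℝ as follows: if λ ≤ √(r/d), set ρ₁(s) := max{λs − (dλ² + r), 0}; if λ > √(r/d), set ρ₁(s) := λs − (dλ² + r) for s ≥ 2dλ, ρ₁(s) := s²/(4d) − r for 2√(dr) ≤ s < 2dλ, and ρ₁(s) := 0 for 0 ≤ s < 2√(dr). Then ρ₁ is continuous, nonnegative and non-decreasing on [0,∞), satisfies ρ₁(0) = 0 and ρ₁(s)/s → λ as s → ∞, and is a viscosity solution of min{ρ − s·ρ′ + d·(ρ′)² + r, ρ} = 0 on (0,∞). -/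
open Filter Set Topology

noncomputable section

theorem rho1_basic (d r lam : ℝ)
    (hd : 0 < d) (hr : 0 < r) (hlam : 0 < lam)
    (ρ : ℝ → ℝ)
    (hρdef : ∀ s, ρ s = if lam ≤ Real.sqrt (r / d) then max (lam * s - (d * lam ^ 2 + r)) 0
      else if 2 * d * lam ≤ s then lam * s - (d * lam ^ 2 + r)
      else if 2 * Real.sqrt (d * r) ≤ s then s ^ 2 / (4 * d) - r
      else 0) (s : ℝ) :
    0 ≤ ρ s ∧ (∀ p, 0 ≤ p → p ≤ lam → p * s - d * p ^ 2 - r ≤ ρ s) ∧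
    (ρ s = 0 ∨ ∃ q, 0 ≤ q ∧ q ≤ lam ∧ ρ s = q * s - d * q ^ 2 - r) := by
  rw [hρdef s]
  split_ifs with h1 h2 h3
  · have h1' : d * lam ^ 2 ≤ r := by
      rw [Real.le_sqrt hlam.le (by positivity), le_div_iff₀ hd] at h1
      linarith
    refine ⟨le_max_right _ _, ?_, ?_⟩
    · intro p hp hpl
      by_cases h : p * s - d * p ^ 2 - r ≤ 0
      · exact h.trans (le_max_right _ _)
      · push Not at h
        refine le_trans ?_ (le_max_left _ _)
        have hp0 : 0 < p := by
          rcases hp.lt_or_eq with h0 | h0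
          · exact h0
          · rw [← h0] at h
            nlinarith
        have hs : d * (lam + p) ≤ s := by
          have h5 : d * lam * p ≤ d * lam * lam :=
            mul_le_mul_of_nonneg_left hpl (by positivity)
          have : p * (d * (lam + p)) ≤ p * s := by nlinarith
          exact le_of_mul_le_mul_left this hp0
        nlinarith [mul_nonneg (sub_nonneg.2 hpl) (sub_nonneg.2 hs)]
    · rcases le_total (lam * s - (d * lam ^ 2 + r)) 0 with h | h
      · left; exact max_eq_right h
      · right
        refine ⟨lam, hlam.le, le_rfl, ?_⟩
        rw [max_eq_left h]; ring
  · have h1' : r < d * lam ^ 2 := by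
      rw [not_le, Real.sqrt_lt' hlam, div_lt_iff₀ hd] at h1
      linarith
    refine ⟨by nlinarith, ?_, Or.inr ⟨lam, hlam.le, le_rfl, by ring⟩⟩
    intro p hp hpl
    have hs : d * (lam + p) ≤ s := by nlinarith
    nlinarith [mul_nonneg (sub_nonneg.2 hpl) (sub_nonneg.2 hs)]
  · have hw : Real.sqrt (d * r) ^ 2 = d * r := Real.sq_sqrt (by positivity)
    have hw0 := Real.sqrt_nonneg (d * r)
    set w := Real.sqrt (d * r)
    have hs0 : 0 ≤ s := by linarith
    refine ⟨?_, ?_, Or.inr ⟨s / (2 * d), by positivity, ?_, ?_⟩⟩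
    · rw [sub_nonneg, le_div_iff₀ (by positivity)]
      nlinarith
    · intro p hp hpl
      have : s ^ 2 / (4 * d) - r - (p * s - d * p ^ 2 - r) = (s - 2 * d * p) ^ 2 / (4 * d) := by
        field_simp
        ring
      have h5 : 0 ≤ (s - 2 * d * p) ^ 2 / (4 * d) := by positivity
      linarith
    · rw [div_le_iff₀ (by positivity)]
      linarith
    · field_simp
      ring
  · have hw : Real.sqrt (d * r) ^ 2 = d * r := Real.sq_sqrt (by positivity)
    set w := Real.sqrt (d * r)
    refine ⟨le_rfl, ?_, Or.inl rfl⟩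
    intro p hp hpl
    have h5 : p * s ≤ p * (2 * w) := mul_le_mul_of_nonneg_left (not_le.1 h3).le hp
    have h6 : 0 ≤ d * (d * p ^ 2 + r - p * (2 * w)) := by
      nlinarith [sq_nonneg (d * p - w)]
    have := nonneg_of_mul_nonneg_right h6 hd
    linarith

/-- One-sided bounds on the derivative from a local inequality. -/
theorem deriv_ge_of_right {f : ℝ → ℝ} {x : ℝ} {c : ℝ} (hf : DifferentiableAt ℝ f x)
    (h : ∀ᶠ s in 𝓝[>] x, f x + c * (s - x) ≤ f s) : c ≤ deriv f x := by
  have h1 := (hasDerivWithinAt_iff_tendsto_slope' (s := Ioi x) (by simp)).1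
    hf.hasDerivAt.hasDerivWithinAt
  refine ge_of_tendsto h1 ?_
  filter_upwards [h, self_mem_nhdsWithin] with s hs hx
  rw [slope_def_field, le_div_iff₀ (sub_pos.2 hx)]
  linarith

theorem deriv_le_of_left {f : ℝ → ℝ} {x : ℝ} {c : ℝ} (hf : DifferentiableAt ℝ f x)
    (h : ∀ᶠ s in 𝓝[<] x, f x + c * (s - x) ≤ f s) : deriv f x ≤ c := by
  have h1 := (hasDerivWithinAt_iff_tendsto_slope' (s := Iio x) (by simp)).1
    hf.hasDerivAt.hasDerivWithinAt
  refine le_of_tendsto h1 ?_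
  filter_upwards [h, self_mem_nhdsWithin] with s hs hx
  rw [slope_def_field, div_le_iff_of_neg (sub_neg.2 hx)]
  linarith

theorem rho1_is_viscosity_solution (d r lam : ℝ)
    (hd : 0 < d) (hr : 0 < r) (hlam : 0 < lam)
    (ρ : ℝ → ℝ)
    (hρdef : ∀ s, ρ s = if lam ≤ Real.sqrt (r / d) then max (lam * s - (d * lam ^ 2 + r)) 0
      else if 2 * d * lam ≤ s then lam * s - (d * lam ^ 2 + r)
      else if 2 * Real.sqrt (d * r) ≤ s then s ^ 2 / (4 * d) - r
      else 0) :
    ContinuousOn ρ (Set.Ici 0) ∧ (∀ s, 0 ≤ s → 0 ≤ ρ s) ∧ MonotoneOn ρ (Set.Ici 0) ∧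
    ρ 0 = 0 ∧ Filter.Tendsto (fun s => ρ s / s) Filter.atTop (𝓝 lam) ∧
    IsViscSol d (fun _ => r) (Set.Ioi 0) ρ := by
  have key := rho1_basic d r lam hd hr hlam ρ hρdef
  have hmono : Monotone ρ := by
    intro s t hst
    rcases (key s).2.2 with h | ⟨q, hq0, hq1, h⟩
    · rw [h]; exact (key t).1
    · have := (key t).2.1 q hq0 hq1
      nlinarith
  have hlip : ∀ s t, t ≤ s → ρ s - ρ t ≤ lam * (s - t) := by
    intro s t hst
    rcases (key s).2.2 with h | ⟨q, hq0, hq1, h⟩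
    · have := (key t).1
      nlinarith
    · have := (key t).2.1 q hq0 hq1
      nlinarith
  have hcont : Continuous ρ := by
    have : LipschitzWith (Real.toNNReal lam) ρ := by
      refine LipschitzWith.of_dist_le_mul fun s t => ?_
      rw [Real.coe_toNNReal _ hlam.le, Real.dist_eq, Real.dist_eq]
      rcases le_total t s with h | h
      · rw [abs_of_nonneg (sub_nonneg.2 (hmono h)), abs_of_nonneg (sub_nonneg.2 h)]
        exact hlip s t h
      · rw [abs_sub_comm, abs_sub_comm s, abs_of_nonneg (sub_nonneg.2 (hmono h)),
          abs_of_nonneg (sub_nonneg.2 h)]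
        exact hlip t s h
    exact this.continuous
  have h0 : ρ 0 = 0 := by
    rcases (key 0).2.2 with h | ⟨q, hq0, hq1, h⟩
    · exact h
    · have := (key 0).1
      nlinarith [mul_nonneg hd.le (sq_nonneg q)]
  refine ⟨hcont.continuousOn, fun s _ => (key s).1, hmono.monotoneOn _, h0, ?_, ?_, ?_⟩
  · have hl : Tendsto (fun s : ℝ => lam - (d * lam ^ 2 + r) / s) atTop (𝓝 lam) := by
      simpa using (tendsto_const_nhds (x := lam)).sub
        ((tendsto_const_nhds (x := d * lam ^ 2 + r)).div_atTop tendsto_id)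
    refine tendsto_of_tendsto_of_tendsto_of_le_of_le' hl tendsto_const_nhds ?_ ?_
    · filter_upwards [eventually_gt_atTop 0] with s hs
      rw [le_div_iff₀ hs, sub_mul, div_mul_cancel₀ _ hs.ne']
      have := (key s).2.1 lam hlam.le le_rfl
      linarith
    · filter_upwards [eventually_gt_atTop 0] with s hs
      rw [div_le_iff₀ hs]
      have := hlip s 0 hs.le
      rw [h0] at this
      linarith
  · refine ⟨hcont.lowerSemicontinuous.lowerSemicontinuousOn _, fun s _ => (key s).1, ?_⟩
    intro φ hφ s₀ hs₀ hmin
    have hdφ : DifferentiableAt ℝ φ s₀ := hφ.differentiable (by norm_num) s₀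
    have hu : uscEnv (fun _ => r) s₀ = r := by simp [uscEnv]
    rw [hu]
    unfold StrictLocMin at hmin
    have hR : ∀ᶠ s in 𝓝[>] s₀, ρ s₀ - φ s₀ < ρ s - φ s :=
      hmin.filter_mono (nhdsWithin_mono _ fun x hx => ne_of_gt hx)
    have hL : ∀ᶠ s in 𝓝[<] s₀, ρ s₀ - φ s₀ < ρ s - φ s :=
      hmin.filter_mono (nhdsWithin_mono _ fun x hx => ne_of_lt hx)
    have hp1 : deriv φ s₀ ≤ lam := by
      have : -lam ≤ deriv (fun s => -φ s) s₀ := by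
        refine deriv_ge_of_right hdφ.neg ?_
        filter_upwards [hR, self_mem_nhdsWithin] with s hs hx
        have := hlip s s₀ (le_of_lt hx)
        linarith
      rw [deriv.fun_neg] at this
      linarith
    have hp0 : 0 ≤ deriv φ s₀ := by
      have : deriv (fun s => -φ s) s₀ ≤ 0 := by
        refine deriv_le_of_left hdφ.neg ?_
        filter_upwards [hL, self_mem_nhdsWithin] with s hs hx
        have := hmono (le_of_lt hx)
        linarith
      rw [deriv.fun_neg] at this
      linarith
    have := (key s₀).2.1 _ hp0 hp1
    linarith
  · refine ⟨hcont.upperSemicontinuous.upperSemicontinuousOn _, ?_⟩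
    intro φ hφ s₀ hs₀ hmax hpos
    have hdφ : DifferentiableAt ℝ φ s₀ := hφ.differentiable (by norm_num) s₀
    have hu : lscEnv (fun _ => r) s₀ = r := by simp [lscEnv]
    rw [hu]
    unfold StrictLocMax at hmax
    have hR : ∀ᶠ s in 𝓝[>] s₀, ρ s - φ s < ρ s₀ - φ s₀ :=
      hmax.filter_mono (nhdsWithin_mono _ fun x hx => ne_of_gt hx)
    have hL : ∀ᶠ s in 𝓝[<] s₀, ρ s - φ s < ρ s₀ - φ s₀ :=
      hmax.filter_mono (nhdsWithin_mono _ fun x hx => ne_of_lt hx)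
    rcases (key s₀).2.2 with h | ⟨q, hq0, hq1, h⟩
    · exact absurd h hpos.ne'
    · have e1 : q ≤ deriv φ s₀ := by
        refine deriv_ge_of_right hdφ ?_
        filter_upwards [hR] with s hs
        have := (key s).2.1 q hq0 hq1
        linarith
      have e2 : deriv φ s₀ ≤ q := by
        refine deriv_le_of_left hdφ ?_
        filter_upwards [hL] with s hs
        have := (key s).2.1 q hq0 hq1
        linarith
      rw [le_antisymm e2 e1, h]
      linarith
end
end

section
/- Let d, r > 0, let c_g ≥ 2√(dr), let g_max ≥ c_g²/(4d), and let λ > c_g/(2d). Set λ₁ := c_g/(2d) − √(g_max/d), and define ρ̄₁ : [0,∞) → ℝ by ρ̄₁(s) := λs − (dλ² + r) for s ≥ 2dλ, ρ̄₁(s) := s²/(4d) − r for c_g ≤ s < 2dλ, and ρ̄₁(s) := λ₁s − (dλ₁² + r − g_max) for 0 ≤ s < c_g. Then ρ̄₁ is continuous and nonnegative on [0,∞), satisfies ρ̄₁(0) ≥ 0, and is a viscosity super-solution of min{ρ − s·ρ′ + d·(ρ′)² + r − g_max·1_{(0,c_g)}(s), ρ} = 0 on (0,∞). -/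
open Filter Set Topology

noncomputable section

theorem rhobar1_is_supersolution (d r cg gmax lam : ℝ)
    (hd : 0 < d) (hr : 0 < r)
    (hcg : 2 * Real.sqrt (d * r) ≤ cg) (hgmax : cg ^ 2 / (4 * d) ≤ gmax)
    (hlam : cg / (2 * d) < lam)
    (lam1 : ℝ) (hlam1 : lam1 = cg / (2 * d) - Real.sqrt (gmax / d))
    (ρ : ℝ → ℝ)
    (hρdef : ∀ s, ρ s = if 2 * d * lam ≤ s then lam * s - (d * lam ^ 2 + r)
      else if cg ≤ s then s ^ 2 / (4 * d) - r
      else lam1 * s - (d * lam1 ^ 2 + r - gmax)) :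
    ContinuousOn ρ (Set.Ici 0) ∧ (∀ s, 0 ≤ s → 0 ≤ ρ s) ∧ 0 ≤ ρ 0 ∧
    IsViscSuper d (fun s => r - gmax * (if 0 < s ∧ s < cg then 1 else 0)) (Set.Ioi 0) ρ := by
  have hcg0 : 0 < cg := by
    have : 0 < Real.sqrt (d * r) := Real.sqrt_pos.2 (by positivity)
    linarith
  have hcg2 : r ≤ cg ^ 2 / (4 * d) := by
    rw [le_div_iff₀ (by positivity)]
    have h1 := Real.sq_sqrt (show 0 ≤ d * r by positivity)
    have h2 := Real.sqrt_nonneg (d * r)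
    nlinarith
  have hg0 : 0 ≤ gmax := hr.le.trans (hcg2.trans hgmax)
  obtain ⟨q, hq⟩ : ∃ q, q = Real.sqrt (gmax / d) := ⟨_, rfl⟩
  have hq2 : d * q ^ 2 = gmax := by
    rw [hq, Real.sq_sqrt (by positivity)]; field_simp
  obtain ⟨c, hc⟩ : ∃ c, c = cg / (2 * d) := ⟨_, rfl⟩
  have hcgc : cg = 2 * d * c := by rw [hc]; field_simp
  have hsq : ∀ s : ℝ, s ^ 2 / (4 * d) = d * (s / (2 * d)) ^ 2 := by
    intro s; field_simp; ring
  have hs2 : ∀ s : ℝ, s = 2 * d * (s / (2 * d)) := by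
    intro s; field_simp
  rw [← hq, ← hc] at hlam1
  rw [← hc] at hlam
  rw [hsq, ← hc] at hcg2 hgmax
  have hlam1' : lam1 ≤ 0 := by
    have h0 : 0 ≤ q := hq ▸ Real.sqrt_nonneg _
    have h1 : c ^ 2 ≤ q ^ 2 := by
      rw [← hq2] at hgmax
      exact le_of_mul_le_mul_left hgmax hd
    have := abs_le_of_sq_le_sq h1 h0
    linarith [le_abs_self c]
  have hltc : cg < 2 * d * lam := by
    rw [hcgc]; exact mul_lt_mul_of_pos_left hlam (by positivity)
  have hcont : Continuous ρ := by
    have : ρ = fun s => if 2 * d * lam ≤ s then lam * s - (d * lam ^ 2 + r)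
      else if cg ≤ s then s ^ 2 / (4 * d) - r
      else lam1 * s - (d * lam1 ^ 2 + r - gmax) := funext hρdef
    rw [this]
    refine Continuous.if_le (by fun_prop) (Continuous.if_le (by fun_prop) (by fun_prop)
      (by fun_prop) (by fun_prop) ?_) (by fun_prop) (by fun_prop) ?_
    · rintro s rfl
      rw [hsq, ← hc, hlam1, hcgc, ← hq2]; ring
    · rintro s rfl
      rw [if_pos hltc.le]
      field_simp; ring
  have hnn : ∀ s, 0 ≤ s → 0 ≤ ρ s := by
    intro s hs
    rw [hρdef]
    split_ifs with h1 h2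
    · have hl : 0 ≤ lam := le_trans (by rw [hc]; positivity) hlam.le
      have hc0 : 0 ≤ c := by rw [hc]; positivity
      have : c ^ 2 ≤ lam ^ 2 := pow_le_pow_left₀ hc0 hlam.le 2
      nlinarith [mul_le_mul_of_nonneg_left h1 hl, mul_le_mul_of_nonneg_left this hd.le]
    · have : r ≤ s ^ 2 / (4 * d) := by
        refine hcg2.trans ?_
        rw [hc, ← hsq]
        gcongr
      linarith
    · have h3 : lam1 * cg ≤ lam1 * s := mul_le_mul_of_nonpos_left (not_le.1 h2).le hlam1'
      have h4 : lam1 * cg - (d * lam1 ^ 2 + r - gmax) = d * c ^ 2 - r := by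
        rw [hlam1, hcgc, ← hq2]; ring
      linarith
  refine ⟨hcont.continuousOn, hnn, hnn 0 le_rfl,
    hcont.lowerSemicontinuous.lowerSemicontinuousOn _, fun s hs => hnn s (le_of_lt hs), ?_⟩
  intro φ hφ s₀ hs₀ hmin
  have hs₀' : 0 < s₀ := hs₀
  have hR : r - gmax * (if 0 < s₀ ∧ s₀ < cg then 1 else 0) ≤
      uscEnv (fun s => r - gmax * (if 0 < s ∧ s < cg then 1 else 0)) s₀ := by
    unfold uscEnv
    refine Filter.le_limsup_of_frequently_le ?_ ?_
    · intro h
      exact h.self_of_nhds le_rfl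
    · refine Filter.isBoundedUnder_of ⟨r, fun s => ?_⟩
      split_ifs <;> linarith
  have hloc : IsLocalMin (fun s => ρ s - φ s) s₀ := by
    have := eventually_nhdsWithin_iff.1 hmin
    filter_upwards [this] with s h
    by_cases e : s = s₀
    · rw [e]
    · exact (h e).le
  have key : ∀ a b : ℝ, (∀ᶠ s in 𝓝 s₀, ρ s = a * s - b) → deriv φ s₀ = a := by
    intro a b h
    have h1 : HasDerivAt (fun s : ℝ => a * s - b) a s₀ := by
      simpa using ((hasDerivAt_id s₀).const_mul a).sub_const b
    have h2 : HasDerivAt ρ a s₀ := h1.congr_of_eventuallyEq h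
    have h3 := (hφ.differentiable one_ne_zero s₀).hasDerivAt
    have := hloc.hasDerivAt_eq_zero (h2.sub h3)
    linarith
  rcases lt_or_ge s₀ cg with h | h
  · have hp := key lam1 (d * lam1 ^ 2 + r - gmax) (by
      filter_upwards [Iio_mem_nhds h] with s hs
      rw [hρdef, if_neg (not_le.2 (lt_trans hs hltc)), if_neg (not_le.2 hs)])
    rw [if_pos ⟨hs₀', h⟩] at hR
    rw [hp, hρdef, if_neg (not_le.2 (lt_trans h hltc)), if_neg (not_le.2 h)]
    linarith
  · rw [if_neg (fun h' => absurd h'.2 (not_lt.2 h))] at hR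
    rcases lt_or_ge (2 * d * lam) s₀ with h1 | h1
    · have hp := key lam (d * lam ^ 2 + r) (by
        filter_upwards [Ioi_mem_nhds h1] with s hs
        rw [hρdef, if_pos (le_of_lt hs)])
      rw [hp, hρdef, if_pos h1.le]
      linarith
    · have hv : ρ s₀ = d * (s₀ / (2 * d)) ^ 2 - r := by
        rw [hρdef]
        split_ifs with h2
        · have : s₀ = 2 * d * lam := le_antisymm h1 h2
          rw [this]; field_simp; ring
        · rw [hsq]
      have h5 : s₀ * deriv φ s₀ = 2 * d * (s₀ / (2 * d)) * deriv φ s₀ := by rw [← hs2]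
      rw [hv, h5]
      nlinarith [mul_nonneg hd.le (sq_nonneg (s₀ / (2 * d) - deriv φ s₀))]
end
end

section
/- Let d₃, r₃ > 0, let a₃₁, a₃₂ ≥ 0 with a₃₁ + a₃₂ < 1, let 0 < c₂ < c₁, and let μ ∈ [0,1]; set R^μ(s) := r₃·(1 − μ·a₃₁·1_{(c₂,c₁]}(s) − a₃₂·1_{(0,c₂]}(s)). Then the function ρ̄₂(s) := max{s²/(4d₃) − r₃(1 − a₃₁ − a₃₂), 0} is a viscosity super-solution of min{ρ − s·ρ′ + d₃·(ρ′)² + R^μ(s), ρ} = 0 on (0,∞). -/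
open Filter Set Topology

noncomputable section

theorem rhobar2_is_supersolution (d3 r3 a31 a32 c1 c2 mu : ℝ)
    (hd3 : 0 < d3) (hr3 : 0 < r3) (ha31 : 0 ≤ a31) (ha32 : 0 ≤ a32)
    (hsum : a31 + a32 < 1) (hc2 : 0 < c2) (hc12 : c2 < c1)
    (hmu0 : 0 ≤ mu) (hmu1 : mu ≤ 1) :
    IsViscSuper d3
      (fun s => r3 * (1 - mu * a31 * (if c2 < s ∧ s ≤ c1 then 1 else 0)
        - a32 * (if 0 < s ∧ s ≤ c2 then 1 else 0))) (Set.Ioi 0)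
      (fun s => max (s ^ 2 / (4 * d3) - r3 * (1 - a31 - a32)) 0) := by
  refine ⟨?_, fun s _ => le_max_right _ _, ?_⟩
  · apply ContinuousOn.lowerSemicontinuousOn
    fun_prop
  · intro φ _ s₀ _ _
    have hma : mu * a31 ≤ a31 := by nlinarith
    have hma0 : 0 ≤ mu * a31 := mul_nonneg hmu0 ha31
    have hR : r3 * (1 - a31 - a32) ≤ uscEnv (fun s => r3 * (1 - mu * a31 * (if c2 < s ∧ s ≤ c1 then 1 else 0)
        - a32 * (if 0 < s ∧ s ≤ c2 then 1 else 0))) s₀ := by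
      unfold uscEnv
      refine Filter.le_limsup_of_frequently_le (Filter.Eventually.frequently
        (Filter.Eventually.of_forall fun s => ?_)) ⟨r3, ?_⟩
      · apply mul_le_mul_of_nonneg_left _ hr3.le
        split_ifs <;> linarith
      · rw [Filter.eventually_map]
        refine Filter.Eventually.of_forall fun s => ?_
        apply mul_le_of_le_one_right hr3.le
        split_ifs <;> linarith
    have h1 := le_max_left (s₀ ^ 2 / (4 * d3) - r3 * (1 - a31 - a32)) 0
    have h2 : s₀ ^ 2 / (4 * d3) - s₀ * deriv φ s₀ + d3 * deriv φ s₀ ^ 2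
        = (s₀ - 2 * d3 * deriv φ s₀) ^ 2 / (4 * d3) := by
      field_simp
      ring
    have h3 : 0 ≤ (s₀ - 2 * d3 * deriv φ s₀) ^ 2 / (4 * d3) := by positivity
    simp only []
    linarith
end
end

section
/- Let d₃, r₃ > 0, let 0 ≤ a₃₁ ≤ 1 and 0 ≤ a₃₂ < 1, and let c₁ > c₂ with c₂ ≥ 2√(d₃r₃(1 − a₃₂)) and c₂ > 0. Set λ̄ := (c₁ + c₂)/(4d₃) + r₃(1 − a₃₂)/(c₁ − c₂) and r̄ := d₃·[(c₁ − c₂)/(4d₃) − r₃(1 − a₃₂)/(c₁ − c₂)]², and define ρ̄ : [0,c₁] → ℝ by ρ̄(s) := λ̄s − d₃λ̄² + r̄ for c₂ < s ≤ c₁; ρ̄(s) := s²/(4d₃) − r₃(1 − a₃₂) for 2√(d₃r₃(1 − a₃₂)) < s ≤ c₂; and ρ̄(s) := 0 for 0 ≤ s ≤ 2√(d₃r₃(1 − a₃₂)). Then ρ̄ is continuous and nonnegative on [0,c₁] with ρ̄(0) = 0 and ρ̄(c₁) = c₁²/(4d₃), and ρ̄ is a viscosity super-solution of min{ρ − s·ρ′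 + d₃·(ρ′)² + R(s), ρ} = 0 on (0,c₁), where R(s) := r₃·(1 − a₃₁·1_{[c₂,c₁]}(s) − a₃₂·1_{(0,c₂]}(s)). -/
open Filter Set Topology

noncomputable section

theorem explicit_supersolution_prop61 (d3 r3 a31 a32 c1 c2 : ℝ)
    (hd3 : 0 < d3) (hr3 : 0 < r3) (ha31 : 0 ≤ a31) (ha31' : a31 ≤ 1)
    (ha32 : 0 ≤ a32) (ha32' : a32 < 1)
    (hc2pos : 0 < c2) (hc2 : 2 * Real.sqrt (d3 * r3 * (1 - a32)) ≤ c2) (hc12 : c2 < c1)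
    (lamb rb : ℝ)
    (hlamb : lamb = (c1 + c2) / (4 * d3) + r3 * (1 - a32) / (c1 - c2))
    (hrb : rb = d3 * ((c1 - c2) / (4 * d3) - r3 * (1 - a32) / (c1 - c2)) ^ 2)
    (ρ : ℝ → ℝ)
    (hρdef : ∀ s, ρ s = if c2 < s then lamb * s - d3 * lamb ^ 2 + rb
      else if 2 * Real.sqrt (d3 * r3 * (1 - a32)) < s then s ^ 2 / (4 * d3) - r3 * (1 - a32)
      else 0) :
    ContinuousOn ρ (Set.Icc 0 c1) ∧ (∀ s ∈ Set.Icc (0 : ℝ) c1, 0 ≤ ρ s) ∧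
    ρ 0 = 0 ∧ ρ c1 = c1 ^ 2 / (4 * d3) ∧
    IsViscSuper d3
      (fun s => r3 * (1 - a31 * (if c2 ≤ s ∧ s ≤ c1 then 1 else 0)
        - a32 * (if 0 < s ∧ s ≤ c2 then 1 else 0))) (Set.Ioo 0 c1) ρ := by
  have h1 : 0 < c1 - c2 := by linarith
  have hm : 0 < r3 * (1 - a32) := mul_pos hr3 (by linarith)
  obtain ⟨σ, hσ⟩ : ∃ σ, σ = 2 * Real.sqrt (d3 * r3 * (1 - a32)) := ⟨_, rfl⟩
  have hσ0 : 0 ≤ σ := by rw [hσ]; positivity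
  have hσ2 : σ ^ 2 = 4 * d3 * (r3 * (1 - a32)) := by
    rw [hσ, mul_pow, Real.sq_sqrt (by rw [mul_assoc]; positivity)]; ring
  rw [← hσ] at hc2
  simp only [← hσ] at hρdef
  have hR1 : r3 * (1 - a32) ≤ r3 := by nlinarith
  have hR2 : 0 ≤ r3 * (1 - a31) := mul_nonneg hr3.le (by linarith)
  have hRb : ∀ s : ℝ, r3 * (1 - a31 * (if c2 ≤ s ∧ s ≤ c1 then 1 else 0)
        - a32 * (if 0 < s ∧ s ≤ c2 then 1 else 0)) ≤ r3 := by
    intro s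
    have : 0 ≤ r3 * a31 := by positivity
    have : 0 ≤ r3 * a32 := by positivity
    split_ifs <;> nlinarith
  obtain ⟨m, hmd⟩ : ∃ m, m = r3 * (1 - a32) := ⟨_, rfl⟩
  simp only [← hmd] at hm hσ2 hρdef hR1 hlamb hrb
  have e0 : lamb * c2 - d3 * lamb ^ 2 + rb = c2 ^ 2 / (4 * d3) - m := by
    rw [hlamb, hrb]; field_simp; ring
  have e1 : lamb * c1 - d3 * lamb ^ 2 + rb = c1 ^ 2 / (4 * d3) := by
    rw [hlamb, hrb]; field_simp; ring
  have hl : 0 < lamb := by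
    rw [hlamb]
    have : 0 < c1 + c2 := by linarith
    positivity
  have hrb0 : 0 ≤ rb := by rw [hrb]; positivity
  have em : σ ^ 2 / (4 * d3) - m = 0 := by rw [hσ2]; field_simp; ring
  have form : ρ = fun s => lamb * (max s c2 - c2) + (max (min s c2) σ ^ 2 / (4 * d3) - m) := by
    funext s
    rw [hρdef]
    split_ifs with h h'
    · rw [max_eq_left h.le, min_eq_right h.le, max_eq_left hc2, ← e0]; ring
    · rw [max_eq_right (not_lt.1 h), min_eq_left (not_lt.1 h), max_eq_left h'.le]; ring
    · rw [max_eq_right (not_lt.1 h), min_eq_left (not_lt.1 h), max_eq_right (not_lt.1 h'), em]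
      ring
  have hcont : Continuous ρ := by rw [form]; fun_prop
  have hnn : ∀ s, 0 ≤ ρ s := by
    intro s
    rw [form]
    have a : 0 ≤ max s c2 - c2 := by linarith [le_max_right s c2]
    have b : σ ^ 2 / (4 * d3) ≤ max (min s c2) σ ^ 2 / (4 * d3) := by
      gcongr; exact le_max_right _ _
    have := mul_nonneg hl.le a
    simp only
    linarith
  refine ⟨hcont.continuousOn, fun s _ => hnn s, ?_, ?_,
    hcont.lowerSemicontinuous.lowerSemicontinuousOn _, fun s _ => hnn s, ?_⟩
  · rw [hρdef, if_neg (by linarith), if_neg (by linarith)]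
  · rw [hρdef, if_pos hc12, e1]
  intro φ hφ s ⟨hs0, hs1⟩ hmin
  have key : ∀ v, (∃ᶠ x in 𝓝 s, v ≤ r3 * (1 - a31 * (if c2 ≤ x ∧ x ≤ c1 then 1 else 0)
        - a32 * (if 0 < x ∧ x ≤ c2 then 1 else 0))) → v ≤ uscEnv (fun s => r3 * (1 - a31 * (if c2 ≤ s ∧ s ≤ c1 then 1 else 0)
        - a32 * (if 0 < s ∧ s ≤ c2 then 1 else 0))) s := by
    intro v hv
    exact le_limsup_of_frequently_le hv 
      (Filter.isBoundedUnder_of ⟨r3, hRb⟩)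
  rcases le_or_gt s c2 with h | h
  · have k := key m (by
      have : ∃ᶠ x in 𝓝[<] s, m ≤ r3 * (1 - a31 * (if c2 ≤ x ∧ x ≤ c1 then 1 else 0)
        - a32 * (if 0 < x ∧ x ≤ c2 then 1 else 0)) := by
        apply Filter.Eventually.frequently
        filter_upwards [Ioo_mem_nhdsLT hs0] with x hx
        rw [if_neg (by rintro ⟨a, _⟩; linarith [hx.2]), if_pos ⟨hx.1, by linarith [hx.2]⟩, hmd]
        apply le_of_eq; ring
      exact this.filter_mono nhdsWithin_le_nhds)
    have hρ : s ^ 2 / (4 * d3) - m ≤ ρ s := by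
      rw [form]
      simp only
      rw [max_eq_right h, min_eq_left h]
      have : s ^ 2 / (4 * d3) ≤ max s σ ^ 2 / (4 * d3) := by
        gcongr; exact le_max_left _ _
      linarith
    have hsq : s ^ 2 / (4 * d3) - s * deriv φ s + d3 * deriv φ s ^ 2
        = d3 * (deriv φ s - s / (2 * d3)) ^ 2 := by field_simp; ring
    have : 0 ≤ d3 * (deriv φ s - s / (2 * d3)) ^ 2 := by positivity
    linarith
  · have k := key 0 (by
      apply Filter.Eventually.frequently
      filter_upwards [Ioo_mem_nhds h hs1] with x hx
      rw [if_pos ⟨hx.1.le, hx.2.le⟩, if_neg (by rintro ⟨_, a⟩; linarith [hx.1])]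
      linarith)
    have hloc : IsLocalMin (fun s => ρ s - φ s) s := by
      have := eventually_nhdsWithin_iff.1 hmin
      filter_upwards [this] with x hx
      by_cases hxs : x = s
      · rw [hxs]
      · exact (hx hxs).le
    have hd : HasDerivAt ρ lamb s := by
      have hlin : HasDerivAt (fun x : ℝ => lamb * x - d3 * lamb ^ 2 + rb) lamb s := by
        simpa using (((hasDerivAt_id s).const_mul lamb).sub_const (d3 * lamb ^ 2)).add_const rb
      apply hlin.congr_of_eventuallyEq
      filter_upwards [Ioi_mem_nhds h] with x hx
      rw [hρdef, if_pos (mem_Ioi.1 hx)]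
    have hφd := (hφ.differentiable (by norm_num) s).hasDerivAt
    have hz := hloc.hasDerivAt_eq_zero (hd.sub hφd)
    have hp : deriv φ s = lamb := by linarith
    rw [hp, hρdef, if_pos h]
    linarith
end
end
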